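/- Suppose that Δ₈ and Δ₁₀ are admissible exponents (for t = 8 and t = 10 respectively) satisfying 1/2 < Δ₈ < 3/5, 1/10 < Δ₁₀ < 1/4 and (3/2)Δ₈ − 5/7 < Δ₁₀ < 2Δ₈ − 27/28. Put θ = max{3/17, (7 + 2Δ₁₀ − 3Δ₈)/(33 + 2Δ₁₀ − 3Δ₈)} and Δ′₁₀ = Δ₈(1 − θ) + 4θ − 1. Then every real number Δ with Δ > Δ′₁₀ is an admissible exponent for t = 10. -/

import Mathlib

open MeasureTheory
open scoped Classical

/-- `e(α) = exp(2πiα)`. -/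
noncomputable def eC (α : ℝ) : ℂ := Complex.exp (2 * Real.pi * Complex.I * α)

/-- An integer is `R`-smooth if all of its prime divisors are at most `R`. -/
def IsSmooth (R : ℝ) (x : ℤ) : Prop := ∀ p : ℕ, p.Prime → (p : ℤ) ∣ x → (p : ℝ) ≤ R

/-- The smooth quartic Weyl sum `g_δ(α; P, R) = ∑_{x ∈ 𝒜(P,R), δP < x ≤ P} e(αx⁴)`. -/
noncomputable def gW (δ P R α : ℝ) : ℂ :=
  ∑ x ∈ Finset.Icc (⌊δ * P⌋ + 1) ⌊P⌋,
    if IsSmooth R x then eC (α * (x : ℝ) ^ 4) else 0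

/-- The classical quartic Weyl sum `f_δ(α; P) = ∑_{δP < x ≤ P} e(αx⁴)`. -/
noncomputable def fW (δ P α : ℝ) : ℂ :=
  ∑ x ∈ Finset.Icc (⌊δ * P⌋ + 1) ⌊P⌋, eC (α * (x : ℝ) ^ 4)

/-- A real number `Δ` is an admissible exponent for the (even) integer `t` if there exist
`η > 0` and `C > 0` such that, for all `P ≥ 2` and all `1 ≤ R ≤ P^η`, one has
`∫₀¹ |f₀(α;P)|² |g₀(α;P,R)|^{t-2} dα ≤ C P^{t-4+Δ}`. -/
def AdmissibleExponent (t : ℕ) (Δ : ℝ) : Prop :=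
  ∃ η > (0 : ℝ), ∃ C > (0 : ℝ), ∀ P : ℝ, 2 ≤ P → ∀ R : ℝ, 1 ≤ R → R ≤ P ^ η →
    (∫ α in (0:ℝ)..1, ‖fW 0 P α‖ ^ 2 * ‖gW 0 P R α‖ ^ (t - 2))
      ≤ C * P ^ ((t : ℝ) - 4 + Δ)


/-! ### Divisor bound -/

lemma card_divisors_bound (ε : ℝ) (hε : 0 < ε) :
    ∃ C : ℝ, 1 ≤ C ∧ ∀ n : ℕ, n ≠ 0 → (n.divisors.card : ℝ) ≤ C * (n : ℝ) ^ ε := by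
  set δ : ℝ := (2 : ℝ) ^ ε - 1 with hδ
  have h2 : (1 : ℝ) < (2 : ℝ) ^ ε := Real.one_lt_rpow (by norm_num) hε
  have hδ0 : 0 < δ := by linarith
  set K : ℝ := 1 + 1 / δ with hK
  have hK1 : 1 ≤ K := by have := one_div_pos.mpr hδ0; linarith
  obtain ⟨B, hB⟩ := exists_nat_gt ((2 : ℝ) ^ (1 / ε))
  refine ⟨K ^ B, one_le_pow₀ hK1, fun n hn => ?_⟩
  have key : ∀ p ∈ n.primeFactors, ((n.factorization p + 1 : ℕ) : ℝ) ≤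
      (if p < B then K else 1) * ((p ^ n.factorization p : ℕ) : ℝ) ^ ε := by
    intro p hp
    have hpp := Nat.prime_of_mem_primeFactors hp
    set a := n.factorization p
    have hp2 : (2 : ℝ) ≤ p := by exact_mod_cast hpp.two_le
    have hpe : ((p ^ a : ℕ) : ℝ) ^ ε = ((p : ℝ) ^ ε) ^ a := by
      push_cast
      rw [← Real.rpow_natCast, ← Real.rpow_mul (by positivity), mul_comm, Real.rpow_mul (by positivity),
        Real.rpow_natCast]
    rw [hpe]
    split_ifs with h
    · have h3 : (2 : ℝ) ^ ε ≤ (p : ℝ) ^ ε := Real.rpow_le_rpow (by norm_num) hp2 hε.le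
      have h4 : (1 + δ) ^ a ≤ ((p : ℝ) ^ ε) ^ a := pow_le_pow_left₀ (by linarith) (by linarith) _
      have h5 := one_add_mul_le_pow (a := δ) (by linarith) a
      have h6 : K * (1 + a * δ) = 1 + a * δ + 1 / δ + a := by
        rw [hK]; field_simp; ring
      have h7 : 0 ≤ a * δ + 1 / δ := by positivity
      push_cast
      nlinarith
    · have h3 : (2 : ℝ) ≤ (p : ℝ) ^ ε := by
        have : (2 : ℝ) ^ (1 / ε) ≤ p := by
          have : (B : ℝ) ≤ p := by exact_mod_cast not_lt.mp h
          linarith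
        calc (2 : ℝ) = ((2 : ℝ) ^ (1 / ε)) ^ ε := by
              rw [← Real.rpow_mul (by norm_num), one_div_mul_cancel hε.ne', Real.rpow_one]
          _ ≤ _ := Real.rpow_le_rpow (by positivity) this hε.le
      have h4 : (2 : ℝ) ^ a ≤ ((p : ℝ) ^ ε) ^ a := pow_le_pow_left₀ (by norm_num) h3 _
      have h5 : a + 1 ≤ 2 ^ a := Nat.lt_two_pow_self
      have h6 : ((a + 1 : ℕ) : ℝ) ≤ (2 : ℝ) ^ a := by exact_mod_cast h5
      linarith
  rw [Nat.card_divisors hn]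
  push_cast
  calc ∏ p ∈ n.primeFactors, ((n.factorization p : ℝ) + 1)
      ≤ ∏ p ∈ n.primeFactors, ((if p < B then K else 1) * ((p ^ n.factorization p : ℕ) : ℝ) ^ ε) := by
        apply Finset.prod_le_prod
        · intros; positivity
        · intro p hp; have := key p hp; push_cast at this ⊢; exact this
    _ = (∏ p ∈ n.primeFactors, (if p < B then K else 1)) * (n : ℝ) ^ ε := by
        rw [Finset.prod_mul_distrib, Real.finsetProd_rpow _ _ (by intros; positivity)]
        congr 2
        rw [← Nat.cast_prod]
        congr 1
        exact Nat.prod_factorization_pow_eq_self hn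
    _ ≤ _ := by
        gcongr
        rw [← Finset.prod_filter, Finset.prod_const]
        apply pow_le_pow_right₀ hK1
        calc _ ≤ (Finset.range B).card := Finset.card_le_card (by intro x; simp)
          _ = B := by simp

/-! ### Elementary properties of `eC` and counting -/

lemma eC_add (a b : ℝ) : eC (a + b) = eC a * eC b := by
  unfold eC; rw [← Complex.exp_add]; congr 1; push_cast; ring

@[simp] lemma eC_zero : eC 0 = 1 := by simp [eC]

@[simp] lemma norm_eC (a : ℝ) : ‖eC a‖ = 1 := by
  unfold eC
  rw [show 2 * (Real.pi : ℂ) * Complex.I * a = ((2 * Real.pi * a : ℝ) : ℂ) * Complex.I by push_cast; ring]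
  exact Complex.norm_exp_ofReal_mul_I _

lemma eC_neg (a : ℝ) : eC (-a) = starRingEnd ℂ (eC a) := by
  unfold eC
  rw [← Complex.exp_conj]
  congr 1
  simp [map_ofNat]

lemma eC_sub (a b : ℝ) : eC (a - b) = eC a * starRingEnd ℂ (eC b) := by
  rw [sub_eq_add_neg, eC_add, eC_neg]

lemma eC_int (n : ℤ) : eC n = 1 := by
  unfold eC
  rw [Complex.exp_eq_one_iff]
  exact ⟨n, by push_cast; ring⟩

lemma eC_sum {ι : Type*} (s : Finset ι) (f : ι → ℝ) : eC (∑ i ∈ s, f i) = ∏ i ∈ s, eC (f i) := by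
  induction s using Finset.induction_on with
  | empty => simp
  | insert a s ha ih => rw [Finset.sum_insert ha, Finset.prod_insert ha, eC_add, ih]

lemma eC_nat_mul (n : ℕ) (a : ℝ) : eC (n * a) = eC a ^ n := by
  unfold eC; rw [← Complex.exp_nat_mul]; congr 1; push_cast; ring

@[fun_prop] lemma continuous_eC : Continuous eC := by unfold eC; fun_prop

lemma integral_eC (n : ℤ) : ∫ α in (0:ℝ)..1, eC (α * n) = if n = 0 then 1 else 0 := by
  split_ifs with h
  · simp [h]
  · unfold eC
    have : ∀ α : ℝ, Complex.exp (2 * Real.pi * Complex.I * ((α * n : ℝ) : ℂ))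
        = Complex.exp ((2 * Real.pi * Complex.I * n) * α) := by
      intro α; congr 1; push_cast; ring
    simp_rw [this]
    rw [integral_exp_mul_complex]
    · have : Complex.exp (2 * Real.pi * Complex.I * n * ((1:ℝ):ℂ)) = 1 := by
        rw [Complex.exp_eq_one_iff]; exact ⟨n, by push_cast; ring⟩
      rw [this]; simp
    · simp [Real.pi_ne_zero, h]

/-- counting solutions by orthogonality -/
lemma integral_sum_eC {ι : Type*} (s : Finset ι) (φ : ι → ℤ) :
    ∫ α in (0:ℝ)..1, ∑ i ∈ s, eC (α * φ i) = ((s.filter (fun i => φ i = 0)).card : ℂ) := by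
  rw [intervalIntegral.integral_finsetSum]
  · simp_rw [integral_eC]; simp
  · intro i _
    apply Continuous.intervalIntegrable
    fun_prop

lemma card_eq_integral {ι : Type*} (s : Finset ι) (φ : ι → ℤ) (F : ℝ → ℝ)
    (hF : ∀ α, (F α : ℂ) = ∑ i ∈ s, eC (α * φ i)) :
    ∫ α in (0:ℝ)..1, F α = ((s.filter (fun i => φ i = 0)).card : ℝ) := by
  have := integral_sum_eC s φ
  simp_rw [← hF] at this
  rw [intervalIntegral.integral_ofReal] at this
  exact_mod_cast this

/-- a trigonometric polynomial bound: number of solutions is at most the integral of the norm -/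
lemma card_le_integral {ι : Type*} (s : Finset ι) (φ : ι → ℤ) (F : ℝ → ℝ) (hFc : Continuous F)
    (hF : ∀ α, ‖∑ i ∈ s, eC (α * φ i)‖ ≤ F α) :
    ((s.filter (fun i => φ i = 0)).card : ℝ) ≤ ∫ α in (0:ℝ)..1, F α := by
  have h := integral_sum_eC s φ
  have h2 : ‖∫ α in (0:ℝ)..1, ∑ i ∈ s, eC (α * φ i)‖ ≤ ∫ α in (0:ℝ)..1, F α := by
    apply intervalIntegral.norm_integral_le_of_norm_le (by norm_num)
    · exact Filter.Eventually.of_forall (fun α _ => hF α)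
    · exact hFc.intervalIntegrable _ _
  rw [h] at h2
  simpa using h2


/-! ### Distance to the nearest integer and geometric sums -/

/-- distance to the nearest integer -/
noncomputable def dn (x : ℝ) : ℝ := |x - round x|

lemma dn_nonneg (x : ℝ) : 0 ≤ dn x := abs_nonneg _

lemma dn_le_half (x : ℝ) : dn x ≤ 1 / 2 := abs_sub_round x

lemma dn_le (x : ℝ) (n : ℤ) : dn x ≤ |x - n| := round_le x n

lemma dn_neg (x : ℝ) : dn (-x) = dn x := by
  apply le_antisymm
  · have := dn_le (-x) (-round x)
    rw [show -x - ((-round x : ℤ) : ℝ) = -(x - round x) by push_cast; ring, abs_neg] at this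
    exact this
  · have := dn_le x (-round (-x))
    rw [show x - ((-round (-x) : ℤ) : ℝ) = -(-x - round (-x)) by push_cast; ring, abs_neg] at this
    exact this

lemma dn_abs (x : ℝ) : dn |x| = dn x := by
  rcases abs_cases x with ⟨h, _⟩ | ⟨h, _⟩ <;> rw [h]
  exact dn_neg x

lemma norm_eC_sub_one (x : ℝ) : 4 * dn x ≤ ‖eC x - 1‖ := by
  set y := x - round x with hy
  have h1 : eC x = eC y := by
    rw [hy, eC_sub, ← eC_neg]
    have := eC_int (-round x)
    push_cast at this
    rw [this, mul_one]
  rw [h1]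
  have h2 : eC y - 1 = Complex.exp (Complex.I * ((2 * Real.pi * y : ℝ) : ℂ)) - 1 := by
    unfold eC; congr 2; push_cast; ring
  rw [h2, Complex.norm_exp_I_mul_ofReal_sub_one]
  have hy2 : |y| ≤ 1 / 2 := abs_sub_round x
  have h3 : |Real.pi * y| ≤ Real.pi / 2 := by
    rw [abs_mul, abs_of_pos Real.pi_pos]; nlinarith [Real.pi_pos]
  have h4 := Real.mul_abs_le_abs_sin h3
  rw [abs_mul, abs_of_pos Real.pi_pos] at h4
  have h5 : 2 / Real.pi * (Real.pi * |y|) = 2 * |y| := by field_simp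
  rw [h5] at h4
  rw [show 2 * Real.pi * y / 2 = Real.pi * y by ring, norm_mul, Real.norm_eq_abs, Real.norm_eq_abs]
  have : dn x = |y| := rfl
  rw [this]
  norm_num
  linarith

lemma geom_sum_bound (x c : ℝ) (a b : ℤ) :
    2 * dn x * ‖∑ z ∈ Finset.Ico a b, eC (x * z + c)‖ ≤ 1 := by
  rcases le_or_gt b a with h | h
  · rw [Finset.Ico_eq_empty (by omega)]; simp
  have key : (eC x - 1) * ∑ z ∈ Finset.Ico a b, eC (x * z + c) = eC (x * b + c) - eC (x * a + c) := by
    obtain ⟨n, rfl⟩ : ∃ n : ℕ, b = a + n := ⟨(b - a).toNat, by omega⟩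
    clear h
    induction n with
    | zero => simp
    | succ n ih =>
      have : Finset.Ico a (a + ((n + 1 : ℕ) : ℤ)) = insert (a + n : ℤ) (Finset.Ico a (a + n)) := by
        ext z; simp; omega
      rw [this, Finset.sum_insert (by simp), mul_add, ih]
      have : eC (x * ((a + ((n+1 : ℕ):ℤ) : ℤ) : ℝ) + c) = eC x * eC (x * ((a + n : ℤ) : ℝ) + c) := by
        rw [← eC_add]; congr 1; push_cast; ring
      rw [this]; ring
  have h1 := norm_eC_sub_one x
  have h2 : ‖(eC x - 1) * ∑ z ∈ Finset.Ico a b, eC (x * z + c)‖ ≤ 2 := by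
    rw [key]
    calc _ ≤ ‖eC (x * b + c)‖ + ‖eC (x * a + c)‖ := norm_sub_le _ _
      _ = 2 := by simp; norm_num
  rw [norm_mul] at h2
  have := norm_nonneg (∑ z ∈ Finset.Ico a b, eC (x * z + c))
  nlinarith

/-- `min (K, 1/(2‖x‖))` -/
noncomputable def mn (K x : ℝ) : ℝ := if 2 * dn x * K ≤ 1 then K else 1 / (2 * dn x)

lemma le_mn (K x s : ℝ) (h1 : s ≤ K) (h2 : 2 * dn x * s ≤ 1) : s ≤ mn K x := by
  unfold mn
  split_ifs with h
  · exact h1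
  · have : 0 < dn x := by
      rcases (dn_nonneg x).lt_or_eq with h0 | h0
      · exact h0
      · rw [← h0] at h; simp at h
    rw [le_div_iff₀ (by positivity)]; linarith

lemma mn_nonneg (K x : ℝ) (hK : 0 ≤ K) : 0 ≤ mn K x := by
  unfold mn; have := dn_nonneg x; split_ifs <;> positivity

lemma mn_le (K x : ℝ) : mn K x ≤ K := by
  unfold mn
  split_ifs with h
  · exact le_rfl
  · have : 0 < dn x := by
      rcases (dn_nonneg x).lt_or_eq with h0 | h0
      · exact h0
      · rw [← h0] at h; norm_num at h
    rw [div_le_iff₀ (by positivity)]; linarith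

lemma mn_mul_le (K x : ℝ) : mn K x * (2 * dn x) ≤ 1 := by
  unfold mn
  split_ifs with h
  · linarith
  · have : 0 < dn x := by
      rcases (dn_nonneg x).lt_or_eq with h0 | h0
      · exact h0
      · rw [← h0] at h; norm_num at h
    rw [div_mul_cancel₀ _ (by positivity)]

lemma mn_abs (K x : ℝ) : mn K |x| = mn K x := by unfold mn; rw [dn_abs]

/-- sum over a separated set on one side -/
lemma recip_side (K : ℝ) (hK : 0 ≤ K) (q : ℕ) (hq : 1 ≤ q) (S : Finset ℕ) (x : ℕ → ℝ)
    (hx : ∀ n ∈ S, 0 ≤ x n ∧ x n ≤ 1 / 2)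
    (hsep : ∀ n ∈ S, ∀ n' ∈ S, n ≠ n' → 1 / (2 * q : ℝ) ≤ |x n - x n'|)
    (f : ℕ → ℝ) (hf1 : ∀ n ∈ S, f n ≤ K) (hf2 : ∀ n ∈ S, f n * (2 * x n) ≤ 1) :
    ∑ n ∈ S, f n ≤ K + q * (1 + Real.log q) := by
  have hq0 : (0 : ℝ) < q := by exact_mod_cast hq
  set k : ℕ → ℕ := fun n => ⌊2 * q * x n⌋₊ with hk
  set w : ℕ → ℝ := fun j => if j = 0 then K else q / j with hw
  have hw0 : ∀ j, 0 ≤ w j := by intro j; simp only [hw]; split_ifs <;> positivity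
  have hinj : Set.InjOn k S := by
    intro n hn n' hn' h
    by_contra hne
    have h1 := hsep n hn n' hn' hne
    have ha := Nat.floor_le (a := 2 * q * x n) (by have := (hx n hn).1; positivity)
    have hb := Nat.floor_le (a := 2 * q * x n') (by have := (hx n' hn').1; positivity)
    have hc := Nat.lt_floor_add_one (2 * q * x n)
    have hd := Nat.lt_floor_add_one (2 * q * x n')
    have h2 : (⌊2 * q * x n⌋₊ : ℝ) = ⌊2 * q * x n'⌋₊ := congrArg (Nat.cast) h
    rw [div_le_iff₀ (by positivity)] at h1
    rcases abs_cases (x n - x n') with ⟨h3, _⟩ | ⟨h3, _⟩ <;> rw [h3] at h1 <;> nlinarith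
  calc ∑ n ∈ S, f n ≤ ∑ n ∈ S, w (k n) := by
        apply Finset.sum_le_sum
        intro n hn
        simp only [hw]
        split_ifs with h
        · exact hf1 n hn
        · have hkp : (0 : ℝ) < k n := by exact_mod_cast Nat.pos_of_ne_zero h
          have ha := Nat.floor_le (a := 2 * q * x n) (by have := (hx n hn).1; positivity)
          have h3 := hf2 n hn
          rw [le_div_iff₀ hkp]
          by_cases hfn : f n ≤ 0
          · nlinarith
          · push Not at hfn
            calc f n * k n ≤ f n * (2 * q * x n) := by gcongr
              _ = q * (f n * (2 * x n)) := by ring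
              _ ≤ q * 1 := by gcongr
              _ = q := mul_one _
    _ = ∑ j ∈ S.image k, w j := by rw [Finset.sum_image hinj]
    _ ≤ ∑ j ∈ Finset.range (q + 1), w j := by
        apply Finset.sum_le_sum_of_subset_of_nonneg
        · intro j hj
          rw [Finset.mem_image] at hj
          obtain ⟨n, hn, rfl⟩ := hj
          rw [Finset.mem_range, Nat.lt_succ_iff]
          apply Nat.floor_le_of_le
          have := (hx n hn).2
          nlinarith
        · intros; exact hw0 _
    _ = K + q * (harmonic q : ℝ) := by
        rw [Finset.sum_range_succ', add_comm, harmonic]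
        congr 1
        push_cast
        rw [Finset.mul_sum]
        apply Finset.sum_congr rfl
        intro i _
        simp only [hw]
        rw [if_neg (by omega)]
        push_cast; rw [div_eq_mul_inv]
    _ ≤ _ := by
        gcongr
        exact harmonic_le_one_add_log q

lemma recip_block (α : ℝ) (K : ℝ) (hK : 0 ≤ K) (a : ℤ) (q : ℕ) (hq : 1 ≤ q)
    (hco : IsCoprime a (q : ℤ)) (hα : |α - a / q| ≤ 1 / (q : ℝ) ^ 2) (S : Finset ℕ)
    (hS : ∀ n ∈ S, ∀ n' ∈ S, 2 * |(n : ℤ) - n'| ≤ q) :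
    ∑ n ∈ S, mn K (α * n) ≤ 2 * (K + q * (1 + Real.log q)) := by
  have hq0 : (0 : ℝ) < q := by exact_mod_cast hq
  set x : ℕ → ℝ := fun n => α * n - round (α * n) with hx
  have hsep : ∀ n ∈ S, ∀ n' ∈ S, n ≠ n' → 1 / (2 * q : ℝ) ≤ |x n - x n'| := by
    intro n hn n' hn' hne
    set d : ℤ := (n : ℤ) - n' with hd
    have hd0 : d ≠ 0 := by omega
    have hd1 := hS n hn n' hn'
    rw [← hd] at hd1
    have hnd : ¬ (q : ℤ) ∣ a * d := by
      intro h
      have h1 := hco.symm.dvd_of_dvd_mul_left h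
      have h2 := Int.le_of_dvd (abs_pos.mpr hd0) ((dvd_abs _ _).mpr h1)
      omega
    set r : ℤ := round (α * n) - round (α * n') with hr
    have h1 : x n - x n' = (a * d - q * r : ℤ) / (q : ℝ) + (α - a / q) * d := by
      simp only [hx, hr, hd]; push_cast; field_simp; ring
    have h2 : (1 : ℝ) ≤ |((a * d - q * r : ℤ) : ℝ)| := by
      have : (a * d - q * r : ℤ) ≠ 0 := by
        intro h; exact hnd ⟨r, by linarith⟩
      have := Int.one_le_abs this
      exact_mod_cast this
    have h3 : |(α - a / q) * d| ≤ 1 / (2 * q) := by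
      rw [abs_mul]
      have h4 : 2 * |(d : ℝ)| ≤ q := by exact_mod_cast hd1
      calc _ ≤ 1 / (q : ℝ) ^ 2 * (q / 2) := by gcongr; linarith
        _ = _ := by field_simp
    have h4 : |((a * d - q * r : ℤ) : ℝ) / q| ≥ 1 / q := by
      rw [abs_div, abs_of_pos hq0]; gcongr
    have h5 : (1 : ℝ) / q = 1 / (2 * q) + 1 / (2 * q) := by field_simp; norm_num
    rw [h1]
    have h6 := abs_sub_abs_le_abs_sub (((a * d - q * r : ℤ) : ℝ) / q) (-((α - a / q) * d))
    rw [sub_neg_eq_add, abs_neg] at h6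
    linarith
  have hdn : ∀ n : ℕ, |x n| = dn (α * n) := fun n => rfl
  rw [← Finset.sum_filter_add_sum_filter_not S (fun n => 0 ≤ x n), two_mul]
  apply add_le_add
  · apply recip_side K hK q hq _ x
    · intro n hn
      rw [Finset.mem_filter] at hn
      refine ⟨hn.2, ?_⟩
      have := dn_le_half (α * n); rw [← hdn, abs_of_nonneg hn.2] at this; exact this
    · intro n hn n' hn'
      exact hsep n (Finset.mem_filter.mp hn).1 n' (Finset.mem_filter.mp hn').1
    · intro n _; exact mn_le _ _
    · intro n hn
      rw [Finset.mem_filter] at hn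
      have := mn_mul_le K (α * n)
      rw [← hdn, abs_of_nonneg hn.2] at this; exact this
  · apply recip_side K hK q hq _ (fun n => -x n)
    · intro n hn
      rw [Finset.mem_filter] at hn
      have h0 : x n < 0 := not_le.mp hn.2
      refine ⟨by simp; exact h0.le, ?_⟩
      have := dn_le_half (α * n); rw [← hdn, abs_of_neg h0] at this; exact this
    · intro n hn n' hn' h
      have := hsep n (Finset.mem_filter.mp hn).1 n' (Finset.mem_filter.mp hn').1 h
      rw [show -x n - -x n' = -(x n - x n') by ring, abs_neg]; exact this
    · intro n _; exact mn_le _ _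
    · intro n hn
      rw [Finset.mem_filter] at hn
      have h0 : x n < 0 := not_le.mp hn.2
      have := mn_mul_le K (α * n)
      rw [← hdn, abs_of_neg h0] at this; exact this

lemma recip_sum (α : ℝ) (K : ℝ) (hK : 0 ≤ K) (a : ℤ) (q : ℕ) (hq : 1 ≤ q)
    (hco : IsCoprime a (q : ℤ)) (hα : |α - a / q| ≤ 1 / (q : ℝ) ^ 2) (N : ℕ) :
    ∑ n ∈ Finset.range (N + 1), mn K (α * n) ≤
      (2 * N / q + 1) * (2 * (K + q * (1 + Real.log q))) := by
  have hq0 : (0 : ℝ) < q := by exact_mod_cast hq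
  set B := q / 2 + 1 with hB
  have hmaps : ∀ n ∈ Finset.range (N + 1), n / B ∈ Finset.range (N / B + 1) := by
    intro n hn
    rw [Finset.mem_range] at *
    have := Nat.div_le_div_right (c := B) (show n ≤ N by omega)
    omega
  rw [← Finset.sum_fiberwise_of_maps_to hmaps]
  have hlog : 0 ≤ Real.log q := Real.log_nonneg (by exact_mod_cast hq)
  calc _ ≤ ∑ j ∈ Finset.range (N / B + 1), 2 * (K + q * (1 + Real.log q)) := by
        apply Finset.sum_le_sum
        intro j _
        apply recip_block α K hK a q hq hco hα
        intro n hn n' hn'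
        rw [Finset.mem_filter] at hn hn'
        have h1 := Nat.div_add_mod n B
        have h2 := Nat.div_add_mod n' B
        have h3 := Nat.mod_lt n (show 0 < B by omega)
        have h4 := Nat.mod_lt n' (show 0 < B by omega)
        rw [hn.2] at h1
        rw [hn'.2] at h2
        rcases abs_cases ((n : ℤ) - n') with ⟨h, _⟩ | ⟨h, _⟩ <;> rw [h] <;> omega
    _ = ((N / B + 1 : ℕ) : ℝ) * (2 * (K + q * (1 + Real.log q))) := by simp
    _ ≤ _ := by
        gcongr
        push_cast
        gcongr
        calc ((N / B : ℕ) : ℝ) ≤ N / B := Nat.cast_div_le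
          _ ≤ N / (q / 2) := by
            gcongr
            have h : q ≤ 2 * B := by omega
            have : (q : ℝ) ≤ 2 * B := by exact_mod_cast h
            linarith
          _ = 2 * N / q := by field_simp


/-! ### Roots of unity modulo q, residue classes, gcd trick -/

lemma dvd_div_gcd {Z x y : ℕ} (hZ : 0 < Z) (h : Z ∣ x * y) : Z / Nat.gcd Z x ∣ y := by
  have hg : 0 < Nat.gcd Z x := Nat.gcd_pos_of_pos_left _ hZ
  have hco := Nat.coprime_div_gcd_div_gcd hg
  apply hco.dvd_of_dvd_mul_left
  have h1 : Nat.gcd Z x * (Z / Nat.gcd Z x) ∣ Nat.gcd Z x * (x / Nat.gcd Z x * y) := by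
    rw [← mul_assoc, Nat.mul_div_cancel' (Nat.gcd_dvd_left _ _), Nat.mul_div_cancel' (Nat.gcd_dvd_right _ _)]
    exact h
  exact Nat.dvd_of_mul_dvd_mul_left hg h1

lemma sqrt_one_count (q : ℕ) [NeZero q] :
    (Finset.univ.filter (fun u : (ZMod q)ˣ => u ^ 2 = 1)).card ≤ 2 * q.divisors.card := by
  have hq : 0 < q := Nat.pos_of_ne_zero (NeZero.ne q)
  set v : (ZMod q)ˣ → ℤ := fun u => ((u : ZMod q).val : ℤ) with hv
  have hv0 : ∀ u, 0 ≤ v u ∧ v u < q := fun u => ⟨by positivity, by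
    have := ZMod.val_lt (u : ZMod q); simp only [hv]; exact_mod_cast this⟩
  set F : (ZMod q)ˣ → ℕ × Bool := fun u => (Int.gcd q (v u - 1), decide (2 * v u < q)) with hF
  have hcast : ∀ u, ((v u : ℤ) : ZMod q) = u := by
    intro u; simp [hv]
  calc _ ≤ (q.divisors ×ˢ (Finset.univ : Finset Bool)).card := by
        apply Finset.card_le_card_of_injOn F
        · intro u _
          simp only [hF, Finset.coe_product, Set.mem_prod, Finset.mem_coe, Nat.mem_divisors, Finset.mem_univ, and_true]
          refine ⟨?_, hq.ne'⟩
          have := Int.gcd_dvd_left (a := (q : ℤ)) (b := v u - 1)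
          exact_mod_cast this
        · intro u hu u' hu' h
          simp only [Finset.coe_filter, Finset.mem_univ, true_and, Set.mem_ofPred_eq] at hu hu'
          simp only [hF, Prod.mk.injEq, decide_eq_decide] at h
          obtain ⟨h1, h2⟩ := h
          have hsq : ∀ u : (ZMod q)ˣ, u ^ 2 = 1 → (q : ℤ) ∣ (v u - 1) * (v u + 1) := by
            intro u hu
            rw [← ZMod.intCast_zmod_eq_zero_iff_dvd]
            push_cast
            rw [hcast]
            have : (u : ZMod q) ^ 2 = 1 := by have h0 := congrArg Units.val hu; push_cast at h0; exact h0
            linear_combination this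
          set g := Int.gcd q (v u - 1) with hg
          have hgp : 0 < g := Int.gcd_pos_of_ne_zero_left _ (by exact_mod_cast hq.ne')
          obtain ⟨r, hr⟩ : (g : ℤ) ∣ q := Int.gcd_dvd_left ..
          obtain ⟨s, hs⟩ : (g : ℤ) ∣ v u - 1 := Int.gcd_dvd_right ..
          obtain ⟨s', hs'⟩ : (g : ℤ) ∣ v u' - 1 := by rw [h1]; exact Int.gcd_dvd_right ..
          have hrs : ∀ (u : (ZMod q)ˣ) (s : ℤ), u ^ 2 = 1 → g = Int.gcd q (v u - 1) → v u - 1 = g * s → r ∣ v u + 1 := by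
            intro u s hu hg hs
            have hco : IsCoprime r s := by
              rw [Int.isCoprime_iff_gcd_eq_one]
              have := hg
              rw [hr, hs, Int.gcd_mul_left] at this
              simp only [Int.natAbs_natCast] at this
              exact Nat.eq_of_mul_eq_mul_left hgp (by omega)
            have h3 := hsq u hu
            rw [hr, hs] at h3
            have h4 : r ∣ s * (v u + 1) := by
              apply Int.dvd_of_mul_dvd_mul_left (a := (g:ℤ)) (by exact_mod_cast hgp.ne')
              rw [← mul_assoc]; exact h3
            exact hco.dvd_of_dvd_mul_left h4
          have e1 := hrs u s hu rfl hs
          have e2 := hrs u' s' hu' h1 hs'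
          -- difference divisible by g and r
          have d1 : (g : ℤ) ∣ v u - v u' := ⟨s - s', by linear_combination hs - hs'⟩
          have d2 : r ∣ v u - v u' := by
            have := dvd_sub e1 e2; rwa [show v u + 1 - (v u' + 1) = v u - v u' by ring] at this
          have d3 : (q : ℤ) ∣ 2 * (v u - v u') := by
            -- 2 = (v+1) - (v-1) = r a - g s
            obtain ⟨a, ha⟩ := e1
            obtain ⟨x, hx⟩ := d1
            obtain ⟨y, hy⟩ := d2
            refine ⟨a * x - s * y, ?_⟩
            have : (2 : ℤ) = r * a - g * s := by linear_combination ha - hs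
            calc 2 * (v u - v u') = r * a * (v u - v u') - g * s * (v u - v u') := by rw [this]; ring
              _ = r * a * (g * x) - g * s * (r * y) := by nth_rewrite 1 [hx]; rw [hy]
              _ = q * (a * x - s * y) := by rw [hr]; ring
          have hvv : v u = v u' := by
            obtain ⟨k, hk⟩ := d3
            have b1 := hv0 u
            have b2 := hv0 u'
            have hk1 : k < 1 := by
              by_contra hcon
              push Not at hcon
              have : (q : ℤ) * 1 ≤ q * k := by gcongr
              omega
            have hk2 : -1 < k := by
              by_contra hcon
              push Not at hcon
              have : (q : ℤ) * k ≤ q * (-1) := by gcongr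
              omega
            have : k = 0 := by omega
            rw [this] at hk; omega
          apply Units.ext
          rw [← hcast u, ← hcast u', hvv]
    _ = _ := by rw [Finset.card_product]; simp [mul_comm]

lemma root_mul_count (q : ℕ) [NeZero q] (k : ℕ) :
    (Finset.univ.filter (fun u : (ZMod q)ˣ => u ^ (2 * k) = 1)).card ≤
      (2 * q.divisors.card) * (Finset.univ.filter (fun u : (ZMod q)ˣ => u ^ k = 1)).card := by
  apply Finset.card_le_mul_card_image_of_maps_to (f := fun u => u ^ 2)
  · intro u hu
    simp only [Finset.mem_filter, Finset.mem_univ, true_and] at hu ⊢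
    rw [← pow_mul]; exact hu
  · intro b _
    rcases (Finset.filter (fun x : (ZMod q)ˣ => x ^ 2 = b) (Finset.univ.filter (fun u : (ZMod q)ˣ => u ^ (2 * k) = 1))).eq_empty_or_nonempty with h | ⟨u0, h0⟩
    · rw [h]; simp
    · refine le_trans ?_ (sqrt_one_count q)
      apply Finset.card_le_card_of_injOn (fun u => u * u0⁻¹)
      · intro u hu
        simp only [Finset.coe_filter, Finset.mem_filter, Finset.mem_univ, true_and, Set.mem_ofPred_eq] at hu h0 ⊢
        rw [mul_pow, hu.2, inv_pow, h0.2]; simp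
      · intro u _ u' _ h
        simpa using h

lemma root_count_four (q : ℕ) [NeZero q] :
    (Finset.univ.filter (fun u : (ZMod q)ˣ => u ^ 4 = 1)).card ≤ (2 * q.divisors.card) ^ 2 := by
  have h1 := root_mul_count q 2
  have h2 := sqrt_one_count q
  calc _ ≤ _ := h1
    _ ≤ (2 * q.divisors.card) * (2 * q.divisors.card) := by gcongr
    _ = _ := by ring

lemma root_count_eight (q : ℕ) [NeZero q] :
    (Finset.univ.filter (fun u : (ZMod q)ˣ => u ^ 8 = 1)).card ≤ (2 * q.divisors.card) ^ 3 := by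
  have h1 := root_mul_count q 4
  have h2 := root_count_four q
  calc _ ≤ _ := h1
    _ ≤ (2 * q.divisors.card) * (2 * q.divisors.card) ^ 2 := by gcongr
    _ = _ := by ring

/-- numbers in an interval of length `T`, all congruent mod `q` -/
lemma class_count (q : ℕ) (hq : 0 < q) (S : Finset ℕ) (a T : ℕ) (h1 : ∀ n ∈ S, a < n ∧ n ≤ a + T)
    (h2 : ∀ n ∈ S, ∀ n' ∈ S, n ≡ n' [MOD q]) : S.card ≤ T / q + 1 := by
  have : S.card ≤ (Finset.range (T / q + 1)).card := by
    apply Finset.card_le_card_of_injOn (fun n => (n - a - 1) / q)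
    · intro n hn
      simp only [Finset.coe_range, Set.mem_Iio]
      have := h1 n hn
      have h3 : (n - a - 1) / q ≤ T / q := Nat.div_le_div_right (by omega)
      omega
    · intro n hn n' hn' h
      simp only at h
      have b1 := h1 n hn
      have b2 := h1 n' hn'
      have h3 : n - a - 1 ≡ n' - a - 1 [MOD q] := by
        apply Nat.ModEq.add_right_cancel' (a + 1)
        rw [show n - a - 1 + (a + 1) = n by omega, show n' - a - 1 + (a + 1) = n' by omega]
        exact h2 n hn n' hn'
      have e1 := Nat.div_add_mod (n - a - 1) q
      have e2 := Nat.div_add_mod (n' - a - 1) q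
      have h3' : (n - a - 1) % q = (n' - a - 1) % q := h3
      rw [h, h3'] at e1
      omega
  simpa using this

/-- unit attached to the quotient `n₁/n₂` modulo `q` -/
noncomputable def quoUnit (q n₁ n₂ : ℕ) : (ZMod q)ˣ :=
  if h : Nat.Coprime n₁ q ∧ Nat.Coprime n₂ q then ZMod.unitOfCoprime n₁ h.1 * (ZMod.unitOfCoprime n₂ h.2)⁻¹ else 1

lemma quoUnit_mul {q n₁ n₂ : ℕ} (h1 : Nat.Coprime n₁ q) (h2 : Nat.Coprime n₂ q) :
    (quoUnit q n₁ n₂ : ZMod q) * n₂ = n₁ := by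
  have : quoUnit q n₁ n₂ * ZMod.unitOfCoprime n₂ h2 = ZMod.unitOfCoprime n₁ h1 := by
    unfold quoUnit; rw [dif_pos ⟨h1, h2⟩]; simp
  have := congrArg Units.val this
  simpa using this

lemma quoUnit_pow {q n₁ n₂ : ℕ} (h1 : Nat.Coprime n₁ q) (h2 : Nat.Coprime n₂ q) (k : ℕ)
    (h : ((n₁ : ZMod q)) ^ k = (n₂ : ZMod q) ^ k) : quoUnit q n₁ n₂ ^ k = 1 := by
  have h3 := quoUnit_mul h1 h2
  have h4 : ((quoUnit q n₁ n₂ : ZMod q)) ^ k * (n₂ : ZMod q) ^ k = (n₂ : ZMod q) ^ k := by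
    rw [← mul_pow, h3, h]
  have hu : IsUnit ((n₂ : ZMod q) ^ k) := ((ZMod.isUnit_iff_coprime n₂ q).mpr h2).pow k
  apply Units.ext
  push_cast
  have := hu.mul_right_cancel (h4.trans (one_mul _).symm)
  exact this

lemma coprime_of_dvd_pow_sub {q n₁ n₂ k : ℕ} (hlt : n₂ ≤ n₁) (hco : Nat.Coprime n₁ n₂) (hk : k ≠ 0)
    (h : q ∣ n₁ ^ k - n₂ ^ k) : Nat.Coprime n₁ q ∧ Nat.Coprime n₂ q := by
  have hle : n₂ ^ k ≤ n₁ ^ k := Nat.pow_le_pow_left hlt k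
  constructor
  · apply Nat.coprime_of_dvd
    intro p hp h1 h2
    have h3 := h2.trans h
    have h4 : p ∣ n₂ ^ k := by
      have h5 : p ∣ n₁ ^ k := dvd_pow h1 hk
      exact (Nat.dvd_sub_iff_right hle h5).mp h3
    have := Nat.dvd_gcd h1 (hp.dvd_of_dvd_pow h4)
    rw [hco] at this
    exact hp.one_lt.ne' (Nat.dvd_one.mp this)
  · apply Nat.coprime_of_dvd
    intro p hp h1 h2
    have h3 := h2.trans h
    have h4 : p ∣ n₁ ^ k := by
      have h5 : p ∣ n₂ ^ k := dvd_pow h1 hk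
      have := (Nat.dvd_add_right h5).mpr h3
      rwa [Nat.add_sub_cancel' hle] at this
    have := Nat.dvd_gcd (hp.dvd_of_dvd_pow h4) h1
    rw [hco] at this
    exact hp.one_lt.ne' (Nat.dvd_one.mp this)

lemma pow_eq_of_dvd {q n₁ n₂ k : ℕ} (hlt : n₂ ≤ n₁) (h : q ∣ n₁ ^ k - n₂ ^ k) :
    ((n₁ : ZMod q)) ^ k = (n₂ : ZMod q) ^ k := by
  have hle : n₂ ^ k ≤ n₁ ^ k := Nat.pow_le_pow_left hlt k
  have := (ZMod.natCast_eq_zero_iff _ q).mpr h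
  rw [Nat.cast_sub hle, sub_eq_zero] at this
  exact_mod_cast this

/-- for fixed `n₂`, the number of `n₁` -/
lemma n1_count (q : ℕ) (hq : 0 < q) (n₂ T : ℕ) (S : Finset ℕ)
    (hS : ∀ n₁ ∈ S, n₂ < n₁ ∧ n₁ ≤ n₂ + T ∧ Nat.Coprime n₁ n₂ ∧ q ∣ n₁ ^ 8 - n₂ ^ 8) :
    S.card ≤ (T / q + 1) * (2 * q.divisors.card) ^ 3 := by
  have : NeZero q := ⟨hq.ne'⟩
  refine le_trans ?_ (Nat.mul_le_mul_left _ (root_count_eight q))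
  apply Finset.card_le_mul_card_image_of_maps_to (f := fun n₁ => quoUnit q n₁ n₂)
  · intro n₁ hn
    obtain ⟨h1, h2, h3, h4⟩ := hS n₁ hn
    obtain ⟨c1, c2⟩ := coprime_of_dvd_pow_sub h1.le h3 (by norm_num) h4
    simp only [Finset.mem_filter, Finset.mem_univ, true_and]
    exact quoUnit_pow c1 c2 8 (pow_eq_of_dvd h1.le h4)
  · intro u _
    apply class_count q hq _ n₂ T
    · intro n hn
      rw [Finset.mem_filter] at hn
      have := hS n hn.1
      exact ⟨this.1, this.2.1⟩
    · intro n hn n' hn'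
      rw [Finset.mem_filter] at hn hn'
      obtain ⟨h1, h2, h3, h4⟩ := hS n hn.1
      obtain ⟨h1', h2', h3', h4'⟩ := hS n' hn'.1
      obtain ⟨c1, c2⟩ := coprime_of_dvd_pow_sub h1.le h3 (by norm_num) h4
      obtain ⟨c1', c2'⟩ := coprime_of_dvd_pow_sub h1'.le h3' (by norm_num) h4'
      rw [← ZMod.natCast_eq_natCast_iff, ← quoUnit_mul c1 c2, ← quoUnit_mul c1' c2', hn.2, hn'.2]

/-- gcd trick -/
lemma gcd_trick (b k : ℕ) (hk : k ≠ 0) (S : Finset ℕ) (hS : ∀ s ∈ S, b ∣ s ^ k) :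
    ∃ g : ℕ, b ∣ g ^ k ∧ ∀ s ∈ S, g ∣ s := by
  refine ⟨S.gcd id, ?_, fun s hs => Finset.gcd_dvd hs⟩
  induction S using Finset.induction_on with
  | empty =>
    simp only [Finset.gcd_empty]
    simp [hk]
  | insert a s ha ih =>
    rw [Finset.gcd_insert]
    have h1 := hS a (by simp)
    have h2 := ih (fun s hs => hS s (by simp [hs]))
    have := Nat.dvd_gcd h1 h2
    rw [Nat.pow_gcd_pow] at this
    exact this


lemma harmonic_sum_le (Y : ℕ) (W : ℝ) (hlog : 1 + Real.log Y ≤ W) :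
    ∑ j ∈ Finset.Icc 1 Y, (1 : ℝ) / j ≤ W := by
  have h := harmonic_le_one_add_log Y
  rw [harmonic_eq_sum_Icc] at h
  push_cast at h
  simp only [one_div]
  exact h.trans hlog

/-- number of multiples in `S ⊆ [1,N]` -/
lemma mult_count (N g : ℕ) (S : Finset ℕ) (hS : ∀ s ∈ S, 1 ≤ s ∧ s ≤ N ∧ g ∣ s) :
    S.card * g ≤ N := by
  rcases Nat.eq_zero_or_pos g with rfl | hg
  · simp
  have : S.card ≤ (Finset.Icc 1 (N / g)).card := by
    apply Finset.card_le_card_of_injOn (fun s => s / g)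
    · intro s hs
      obtain ⟨h1, h2, h3⟩ := hS s hs
      simp only [Finset.coe_Icc, Set.mem_Icc]
      exact ⟨Nat.div_pos (Nat.le_of_dvd (by omega) h3) hg, Nat.div_le_div_right h2⟩
    · intro s hs s' hs' h
      have h3 := (hS s hs).2.2
      have h3' := (hS s' hs').2.2
      exact (Nat.div_left_inj h3 h3').mp h
  rw [Nat.card_Icc, Nat.add_sub_cancel] at this
  calc S.card * g ≤ (N / g) * g := by gcongr
    _ ≤ N := Nat.div_mul_le_self N g

lemma rpow_quarter_le {b g k m : ℕ} (hg : 1 ≤ g) (h : b ∣ g ^ k) (hk : k ≤ 4 * m) :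
    (b : ℝ) ^ ((1 : ℝ) / 4) ≤ (g : ℝ) ^ m := by
  have h1 : b ≤ g ^ (4 * m) := (Nat.le_of_dvd (by positivity) h).trans (Nat.pow_le_pow_right hg hk)
  have h2 : (b : ℝ) ≤ ((g : ℝ) ^ m) ^ (4 : ℝ) := by
    have : ((g : ℝ) ^ m) ^ (4 : ℝ) = (g : ℝ) ^ (4 * m) := by
      rw [show (4 : ℝ) = ((4 : ℕ) : ℝ) by norm_num, Real.rpow_natCast, ← pow_mul, mul_comm]
    rw [this]; exact_mod_cast h1
  calc (b : ℝ) ^ ((1 : ℝ) / 4) ≤ (((g : ℝ) ^ m) ^ (4 : ℝ)) ^ ((1 : ℝ) / 4) :=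
        Real.rpow_le_rpow (by positivity) h2 (by norm_num)
    _ = _ := by rw [← Real.rpow_mul (by positivity)]; norm_num

lemma sum_gcd_h (Z N : ℕ) (hZ : 0 < Z) (W : ℝ) (hW : (Z.divisors.card : ℝ) ≤ W) :
    ∑ h ∈ Finset.Icc 1 N, ((Nat.gcd Z (h ^ 3) : ℕ) : ℝ) ^ ((1 : ℝ) / 4) ≤ W * N := by
  have hmaps : ∀ h ∈ Finset.Icc 1 N, Nat.gcd Z (h ^ 3) ∈ Z.divisors := by
    intro h _; rw [Nat.mem_divisors]; exact ⟨Nat.gcd_dvd_left _ _, hZ.ne'⟩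
  rw [← Finset.sum_fiberwise_of_maps_to hmaps]
  calc _ ≤ ∑ A ∈ Z.divisors, (N : ℝ) := by
        apply Finset.sum_le_sum
        intro A hA
        set S := (Finset.Icc 1 N).filter (fun h => Nat.gcd Z (h ^ 3) = A) with hS
        have h1 : ∑ h ∈ S, ((Nat.gcd Z (h ^ 3) : ℕ) : ℝ) ^ ((1 : ℝ) / 4) = S.card * (A : ℝ) ^ ((1 : ℝ) / 4) := by
          rw [Finset.sum_congr rfl (g := fun _ => (A : ℝ) ^ ((1 : ℝ) / 4))]
          · simp
          · intro h hh; rw [(Finset.mem_filter.mp hh).2]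
        rw [h1]
        rcases S.eq_empty_or_nonempty with he | ⟨s, hs⟩
        · rw [he]; simp
        · obtain ⟨g, hg1, hg2⟩ := gcd_trick A 3 (by norm_num) S (by
            intro s hs; rw [← (Finset.mem_filter.mp hs).2]; exact Nat.gcd_dvd_right _ _)
          have hs1 : 1 ≤ s := by
            have := (Finset.mem_filter.mp hs).1; rw [Finset.mem_Icc] at this; exact this.1
          have hg : 1 ≤ g := Nat.pos_of_dvd_of_pos (hg2 s hs) hs1
          have h2 := mult_count N g S (by
            intro s hs
            have := (Finset.mem_filter.mp hs).1; rw [Finset.mem_Icc] at this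
            exact ⟨this.1, this.2, hg2 s hs⟩)
          have h3 := rpow_quarter_le (m := 1) hg hg1 (by norm_num)
          rw [pow_one] at h3
          calc (S.card : ℝ) * (A : ℝ) ^ ((1 : ℝ) / 4) ≤ S.card * g := by gcongr
            _ ≤ N := by exact_mod_cast h2
    _ = Z.divisors.card * N := by simp
    _ ≤ _ := by gcongr

lemma sum_gcd_g (Z Y : ℕ) (hZ : 0 < Z) (W : ℝ) (hW : (Z.divisors.card : ℝ) ≤ W)
    (hlog : 1 + Real.log Y ≤ W) :
    ∑ g ∈ Finset.Icc 1 Y, ((1 : ℝ) / g ^ 2) * ((Nat.gcd Z (g ^ 8) : ℕ) : ℝ) ^ ((1 : ℝ) / 4) ≤ W * W := by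
  have hmaps : ∀ h ∈ Finset.Icc 1 Y, Nat.gcd Z (h ^ 8) ∈ Z.divisors := by
    intro h _; rw [Nat.mem_divisors]; exact ⟨Nat.gcd_dvd_left _ _, hZ.ne'⟩
  rw [← Finset.sum_fiberwise_of_maps_to hmaps]
  have hW0 : 0 ≤ W := le_trans (by positivity) hW
  calc _ ≤ ∑ A ∈ Z.divisors, W := by
        apply Finset.sum_le_sum
        intro A hA
        set S := (Finset.Icc 1 Y).filter (fun h => Nat.gcd Z (h ^ 8) = A) with hS
        rcases S.eq_empty_or_nonempty with he | ⟨s, hs⟩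
        · rw [he]; simpa using hW0
        · obtain ⟨g, hg1, hg2⟩ := gcd_trick A 8 (by norm_num) S (by
            intro s hs; rw [← (Finset.mem_filter.mp hs).2]; exact Nat.gcd_dvd_right _ _)
          have hs1 : 1 ≤ s := by
            have := (Finset.mem_filter.mp hs).1; rw [Finset.mem_Icc] at this; exact this.1
          have hg : 1 ≤ g := Nat.pos_of_dvd_of_pos (hg2 s hs) hs1
          have h3 := rpow_quarter_le (m := 2) hg hg1 (by norm_num)
          have hgR : (1 : ℝ) ≤ g := by exact_mod_cast hg
          calc _ ≤ ∑ s ∈ S, (1 : ℝ) / ((s / g : ℕ) : ℝ) := by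
                apply Finset.sum_le_sum
                intro s hs
                have hsm := Finset.mem_filter.mp hs
                have hs1 := (Finset.mem_Icc.mp hsm.1).1
                rw [hsm.2]
                obtain ⟨j, hj⟩ := hg2 s hs
                have hj0 : 0 < j := by
                  rcases Nat.eq_zero_or_pos j with h | h
                  · rw [h] at hj; omega
                  · exact h
                have hj1 : (1 : ℝ) ≤ j := by exact_mod_cast hj0
                have hsg : s / g = j := by rw [hj]; exact Nat.mul_div_cancel_left j hg
                rw [hsg, hj]
                push_cast
                calc (1 : ℝ) / ((g : ℝ) * j) ^ 2 * (A : ℝ) ^ ((1 : ℝ) / 4)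
                    ≤ (1 : ℝ) / ((g : ℝ) * j) ^ 2 * (g : ℝ) ^ 2 := by gcongr
                  _ = 1 / (j : ℝ) ^ 2 := by field_simp
                  _ ≤ 1 / j := by
                    gcongr
                    nlinarith
            _ = ∑ j ∈ S.image (fun s => s / g), (1 : ℝ) / j := by
                rw [Finset.sum_image]
                intro s hs s' hs' h
                exact (Nat.div_left_inj (hg2 s hs) (hg2 s' hs')).mp h
            _ ≤ ∑ j ∈ Finset.Icc 1 Y, (1 : ℝ) / j := by
                apply Finset.sum_le_sum_of_subset_of_nonneg
                · intro j hj
                  rw [Finset.mem_image] at hj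
                  obtain ⟨s, hs, rfl⟩ := hj
                  have hsm := Finset.mem_Icc.mp (Finset.mem_filter.mp hs).1
                  rw [Finset.mem_Icc]
                  exact ⟨Nat.div_pos (Nat.le_of_dvd (by omega) (hg2 s hs)) hg, (Nat.div_le_self _ _).trans hsm.2⟩
                · intros; positivity
            _ ≤ W := harmonic_sum_le Y W hlog
    _ = Z.divisors.card * W := by simp
    _ ≤ _ := by gcongr

/-- modulus left after removing the common factors with `h³` and `g⁸` -/
def redMod (Z h g : ℕ) : ℕ := Z / Nat.gcd Z (h ^ 3) / Nat.gcd (Z / Nat.gcd Z (h ^ 3)) (g ^ 8)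

lemma pair_count (Z Y l h g : ℕ) (hZ : 0 < Z) (hg : 1 ≤ g) (W : ℝ)
    (hW : ∀ n, n ∣ Z → (n.divisors.card : ℝ) ≤ W) (S : Finset (ℕ × ℕ × ℕ))
    (hS : ∀ t ∈ S, t.1 = h ∧ Nat.gcd t.2.1 t.2.2 = g ∧ 1 ≤ t.2.2 ∧ t.2.2 < t.2.1 ∧ t.2.1 ≤ Y ∧
      t.2.1 ≤ t.2.2 + l ∧ Z ∣ t.1 ^ 3 * (t.2.1 ^ 8 - t.2.2 ^ 8)) :
    (S.card : ℝ) ≤ (l / g / redMod Z h g + 1) * (2 * W) ^ 3 * (Y / g) := by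
  set q := redMod Z h g with hq
  have hZ1 : 0 < Z / Nat.gcd Z (h ^ 3) := Nat.div_pos (Nat.gcd_le_left _ hZ) (Nat.gcd_pos_of_pos_left _ hZ)
  have hq0 : 0 < q := Nat.div_pos (Nat.gcd_le_left _ hZ1) (Nat.gcd_pos_of_pos_left _ hZ1)
  have hqZ : q ∣ Z := (Nat.div_dvd_of_dvd (Nat.gcd_dvd_left _ _)).trans (Nat.div_dvd_of_dvd (Nat.gcd_dvd_left _ _))
  have key : S.card ≤ ((l / g) / q + 1) * (2 * q.divisors.card) ^ 3 * (Finset.Icc 1 (Y / g)).card := by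
    apply Finset.card_le_mul_card_image_of_maps_to (f := fun t => t.2.2 / g)
    · intro t ht
      obtain ⟨h1, h2, h3, h4, h5, h6, h7⟩ := hS t ht
      rw [Finset.mem_Icc]
      have hd : g ∣ t.2.2 := by rw [← h2]; exact Nat.gcd_dvd_right _ _
      exact ⟨Nat.div_pos (Nat.le_of_dvd (by omega) hd) hg, Nat.div_le_div_right (by omega)⟩
    · intro n₂ _
      set F := S.filter (fun t => t.2.2 / g = n₂) with hF
      have hinj : Set.InjOn (fun t : ℕ × ℕ × ℕ => t.2.1 / g) F := by
        intro t ht t' ht' he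
        have ht := Finset.mem_filter.mp ht
        have ht' := Finset.mem_filter.mp ht'
        obtain ⟨h1, h2, -⟩ := hS t ht.1
        obtain ⟨h1', h2', -⟩ := hS t' ht'.1
        have d1 : g ∣ t.2.1 := by rw [← h2]; exact Nat.gcd_dvd_left _ _
        have d2 : g ∣ t.2.2 := by rw [← h2]; exact Nat.gcd_dvd_right _ _
        have d1' : g ∣ t'.2.1 := by rw [← h2']; exact Nat.gcd_dvd_left _ _
        have d2' : g ∣ t'.2.2 := by rw [← h2']; exact Nat.gcd_dvd_right _ _
        have e1 := (Nat.div_left_inj d1 d1').mp he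
        have e2 := (Nat.div_left_inj d2 d2').mp (ht.2.trans ht'.2.symm)
        exact Prod.ext (h1.trans h1'.symm) (Prod.ext e1 e2)
      rw [← Finset.card_image_of_injOn hinj]
      apply n1_count q hq0 n₂ (l / g)
      intro n₁ hn
      rw [Finset.mem_image] at hn
      obtain ⟨t, ht, rfl⟩ := hn
      have ht := Finset.mem_filter.mp ht
      obtain ⟨h1, h2, h3, h4, h5, h6, h7⟩ := hS t ht.1
      obtain ⟨a, ha⟩ : g ∣ t.2.1 := by rw [← h2]; exact Nat.gcd_dvd_left _ _
      obtain ⟨b, hb⟩ : g ∣ t.2.2 := by rw [← h2]; exact Nat.gcd_dvd_right _ _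
      have ea : t.2.1 / g = a := by rw [ha]; exact Nat.mul_div_cancel_left a hg
      have eb : n₂ = b := by rw [← ht.2, hb]; exact Nat.mul_div_cancel_left b hg
      rw [ea, eb]
      rw [ha, hb] at h4 h6
      refine ⟨Nat.lt_of_mul_lt_mul_left h4, ?_, ?_, ?_⟩
      · have h8 : a - b ≤ l / g := by
          rw [Nat.le_div_iff_mul_le hg, Nat.sub_mul]
          have : a * g = g * a := mul_comm _ _
          have : b * g = g * b := mul_comm _ _
          omega
        omega
      · have := h2
        rw [ha, hb, Nat.gcd_mul_left] at this
        exact Nat.eq_of_mul_eq_mul_left hg (by rw [this, mul_one])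
      · rw [h1, ha, hb, mul_pow, mul_pow, ← Nat.mul_sub] at h7
        exact dvd_div_gcd hZ1 (dvd_div_gcd hZ h7)
  have hWq := hW q hqZ
  have hW0 : 0 ≤ W := le_trans (by positivity) hWq
  rw [Nat.card_Icc, Nat.add_sub_cancel] at key
  calc (S.card : ℝ) ≤ (((l / g) / q + 1) * (2 * q.divisors.card) ^ 3 * (Y / g) : ℕ) := by exact_mod_cast key
    _ = ((((l / g) / q : ℕ) : ℝ) + 1) * (2 * (q.divisors.card : ℝ)) ^ 3 * ((Y / g : ℕ) : ℝ) := by push_cast; ring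
    _ ≤ _ := by
      gcongr
      · calc (((l / g) / q : ℕ) : ℝ) ≤ ((l / g : ℕ) : ℝ) / q := Nat.cast_div_le
          _ ≤ _ := by gcongr; exact Nat.cast_div_le
      · exact Nat.cast_div_le

lemma redMod_inv (Z h g : ℕ) (hZ : 0 < Z) :
    (1 : ℝ) / redMod Z h g ≤ (Z : ℝ) ^ (-((1 : ℝ) / 4)) * ((Nat.gcd Z (h ^ 3) : ℕ) : ℝ) ^ ((1 : ℝ) / 4) *
      ((Nat.gcd (Z / Nat.gcd Z (h ^ 3)) (g ^ 8) : ℕ) : ℝ) ^ ((1 : ℝ) / 4) := by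
  set A := Nat.gcd Z (h ^ 3) with hA
  set Z1 := Z / A with hZ1d
  set b := Nat.gcd Z1 (g ^ 8) with hb
  have hA0 : 0 < A := Nat.gcd_pos_of_pos_left _ hZ
  have hZ1 : 0 < Z1 := Nat.div_pos (Nat.gcd_le_left _ hZ) hA0
  have hb0 : 0 < b := Nat.gcd_pos_of_pos_left _ hZ1
  have hq0 : 0 < redMod Z h g := Nat.div_pos (Nat.gcd_le_left _ hZ1) hb0
  have e : Z = A * (b * redMod Z h g) := by
    have : b * redMod Z h g = Z1 := Nat.mul_div_cancel' (Nat.gcd_dvd_left _ _)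
    rw [this]; exact (Nat.mul_div_cancel' (Nat.gcd_dvd_left _ _)).symm
  set q := redMod Z h g with hq
  have hqR : (1 : ℝ) ≤ q := by exact_mod_cast hq0
  have hAR : (0 : ℝ) < A := by exact_mod_cast hA0
  have hbR : (0 : ℝ) < b := by exact_mod_cast hb0
  have eR : (Z : ℝ) = A * (b * q) := by exact_mod_cast e
  rw [eR, Real.rpow_neg (by positivity), Real.mul_rpow (by positivity) (by positivity),
    Real.mul_rpow (by positivity) (by positivity)]
  have h1 : (q : ℝ) ^ ((1 : ℝ) / 4) ≤ q := by
    calc _ ≤ (q : ℝ) ^ (1 : ℝ) := Real.rpow_le_rpow_of_exponent_le hqR (by norm_num)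
      _ = q := Real.rpow_one _
  have h2 : (0 : ℝ) < (q : ℝ) ^ ((1 : ℝ) / 4) := by positivity
  have h3 : (0 : ℝ) < (A : ℝ) ^ ((1 : ℝ) / 4) := by positivity
  have h4 : (0 : ℝ) < (b : ℝ) ^ ((1 : ℝ) / 4) := by positivity
  calc (1 : ℝ) / q ≤ 1 / (q : ℝ) ^ ((1 : ℝ) / 4) := by gcongr
    _ = _ := by field_simp

lemma final_count (Z Hn Y l : ℕ) (hZ : 0 < Z) (W : ℝ) (hW1 : 1 ≤ W)
    (hW : ∀ n, n ∣ Z → (n.divisors.card : ℝ) ≤ W) (hlog : 1 + Real.log Y ≤ W)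
    (T : Finset (ℕ × ℕ × ℕ))
    (hT : ∀ t ∈ T, 1 ≤ t.1 ∧ t.1 ≤ Hn ∧ 1 ≤ t.2.2 ∧ t.2.2 < t.2.1 ∧ t.2.1 ≤ Y ∧ t.2.1 ≤ t.2.2 + l ∧
      Z ∣ t.1 ^ 3 * (t.2.1 ^ 8 - t.2.2 ^ 8)) :
    (T.card : ℝ) ≤ 8 * W ^ 6 * Hn * Y * (1 + l * (Z : ℝ) ^ (-((1 : ℝ) / 4))) := by
  set ζ : ℝ := (Z : ℝ) ^ (-((1 : ℝ) / 4)) with hζ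
  have hζ0 : 0 ≤ ζ := by positivity
  have hmaps : ∀ t ∈ T, (t.1, Nat.gcd t.2.1 t.2.2) ∈ Finset.Icc 1 Hn ×ˢ Finset.Icc 1 Y := by
    intro t ht
    obtain ⟨h1, h2, h3, h4, h5, h6, h7⟩ := hT t ht
    simp only [Finset.mem_product, Finset.mem_Icc]
    refine ⟨⟨h1, h2⟩, Nat.gcd_pos_of_pos_right _ h3, (Nat.gcd_le_left _ (by omega)).trans h5⟩
  rw [Finset.card_eq_sum_card_fiberwise hmaps, Finset.sum_product]
  push_cast
  have hZ1 : ∀ h, 0 < Z / Nat.gcd Z (h ^ 3) := fun h => Nat.div_pos (Nat.gcd_le_left _ hZ) (Nat.gcd_pos_of_pos_left _ hZ)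
  calc _ ≤ ∑ h ∈ Finset.Icc 1 Hn, ∑ g ∈ Finset.Icc 1 Y, (8 * W ^ 3 * Y * (1 / g) +
          8 * W ^ 3 * Y * l * ζ * (((Nat.gcd Z (h ^ 3) : ℕ) : ℝ) ^ ((1 : ℝ) / 4) * (((1 : ℝ) / g ^ 2) *
          ((Nat.gcd (Z / Nat.gcd Z (h ^ 3)) (g ^ 8) : ℕ) : ℝ) ^ ((1 : ℝ) / 4)))) := by
        apply Finset.sum_le_sum
        intro h hh
        apply Finset.sum_le_sum
        intro g hg
        rw [Finset.mem_Icc] at hh hg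
        have hgR : (1 : ℝ) ≤ g := by exact_mod_cast hg.1
        refine (pair_count Z Y l h g hZ hg.1 W hW _ ?_).trans ?_
        · intro t ht
          rw [Finset.mem_filter] at ht
          obtain ⟨h1, h2, h3, h4, h5, h6, h7⟩ := hT t ht.1
          have := ht.2
          rw [Prod.mk.injEq] at this
          exact ⟨this.1, this.2, h3, h4, h5, h6, h7⟩
        · have h1 := redMod_inv Z h g hZ
          rw [← hζ] at h1
          set A := ((Nat.gcd Z (h ^ 3) : ℕ) : ℝ) ^ ((1 : ℝ) / 4)
          set B := ((Nat.gcd (Z / Nat.gcd Z (h ^ 3)) (g ^ 8) : ℕ) : ℝ) ^ ((1 : ℝ) / 4)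
          calc ((l : ℝ) / g / redMod Z h g + 1) * (2 * W) ^ 3 * (Y / g)
              = (l / g * (1 / redMod Z h g) + 1) * (2 * W) ^ 3 * (Y / g) := by ring
            _ ≤ (l / g * (ζ * A * B) + 1) * (2 * W) ^ 3 * (Y / g) := by gcongr
            _ = _ := by ring
    _ = 8 * W ^ 3 * Y * (Hn * ∑ g ∈ Finset.Icc 1 Y, (1 : ℝ) / g) + 8 * W ^ 3 * Y * l * ζ *
          ∑ h ∈ Finset.Icc 1 Hn, (((Nat.gcd Z (h ^ 3) : ℕ) : ℝ) ^ ((1 : ℝ) / 4) *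
          ∑ g ∈ Finset.Icc 1 Y, ((1 : ℝ) / g ^ 2) *
          ((Nat.gcd (Z / Nat.gcd Z (h ^ 3)) (g ^ 8) : ℕ) : ℝ) ^ ((1 : ℝ) / 4)) := by
        simp_rw [Finset.sum_add_distrib, ← Finset.mul_sum]
        simp [mul_assoc, mul_left_comm]
    _ ≤ 8 * W ^ 3 * Y * (Hn * W) + 8 * W ^ 3 * Y * l * ζ *
          ∑ h ∈ Finset.Icc 1 Hn, (((Nat.gcd Z (h ^ 3) : ℕ) : ℝ) ^ ((1 : ℝ) / 4) * (W * W)) := by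
        gcongr
        · exact harmonic_sum_le Y W hlog
        · exact sum_gcd_g _ Y (hZ1 _) W (hW _ (Nat.div_dvd_of_dvd (Nat.gcd_dvd_left _ _))) hlog
    _ ≤ 8 * W ^ 3 * Y * (Hn * W) + 8 * W ^ 3 * Y * l * ζ * (W * Hn * (W * W)) := by
        rw [← Finset.sum_mul]
        gcongr
        exact sum_gcd_h Z Hn hZ W (hW Z dvd_rfl)
    _ ≤ _ := by
        have h1 : W ^ 4 ≤ W ^ 6 := pow_le_pow_right₀ hW1 (by norm_num)
        have h2 : 0 ≤ 8 * (Hn : ℝ) * Y := by positivity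
        nlinarith


lemma rat_sep (x y : ℚ) (D : ℕ) (hD : 0 < D) (hx : x.den ∣ D) (hy : y.den ∣ D) (hne : x ≠ y) :
    (1 : ℝ) ≤ |(x : ℝ) - y| * D := by
  obtain ⟨a, ha⟩ := hx
  obtain ⟨b, hb⟩ := hy
  have e1 : x * D = ((x.num * a : ℤ) : ℚ) := by
    rw [ha]; push_cast; rw [← mul_assoc, Rat.mul_den_eq_num]
  have e2 : y * D = ((y.num * b : ℤ) : ℚ) := by
    rw [hb]; push_cast; rw [← mul_assoc, Rat.mul_den_eq_num]
  have hDq : (D : ℚ) ≠ 0 := by exact_mod_cast hD.ne'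
  have h1 : (x.num * a - y.num * b : ℤ) ≠ 0 := by
    intro h
    apply hne
    have : x * D = y * D := by rw [e1, e2]; congr 1; omega
    exact mul_right_cancel₀ hDq this
  have h2 := Int.one_le_abs h1
  have h3 : |x - y| * D = ((|x.num * a - y.num * b| : ℤ) : ℚ) := by
    have h6 : |x - y| * D = |(x - y) * D| := by
      rw [abs_mul, abs_of_nonneg (show (0 : ℚ) ≤ D by positivity)]
    rw [h6, sub_mul, e1, e2]
    push_cast
    rfl
  have h4 : (1 : ℚ) ≤ |x - y| * D := by rw [h3]; exact_mod_cast h2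
  have h5 : ((1 : ℚ) : ℝ) ≤ ((|x - y| * D : ℚ) : ℝ) := by exact_mod_cast h4
  push_cast at h5
  exact h5

lemma pair_rat (α τ : ℝ) (Hh D : ℕ) (hD : 0 < D) (hH : 1 ≤ Hh) (hτ : 16 * τ * (Hh : ℝ) ^ 3 < 1) (S : Finset ℕ)
    (hS : ∀ h ∈ S, Hh ≤ h ∧ h ≤ 2 * Hh ∧ dn (α * ((h ^ 3 * D : ℕ) : ℝ)) ≤ τ) (hne : S.Nonempty) :
    ∃ (φ : ℚ) (c : ℕ), 1 ≤ c ∧ S.card * c ≤ 2 * Hh ∧ c ≤ 2 * Hh ∧ φ.den ∣ c ^ 3 * D ∧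
      (∀ h ∈ S, φ.den ∣ h ^ 3 * D) ∧ |α - φ| * ((Hh : ℝ) ^ 3 * D) ≤ τ := by
  obtain ⟨h0, hh0⟩ := hne
  have hτ0 : 0 ≤ τ := (dn_nonneg _).trans (hS h0 hh0).2.2
  set b : ℕ → ℤ := fun h => round (α * ((h ^ 3 * D : ℕ) : ℝ)) with hb
  have hb' : ∀ h ∈ S, |α * ((h ^ 3 * D : ℕ) : ℝ) - b h| ≤ τ := fun h hh => (hS h hh).2.2
  set φ : ℚ := (b h0 : ℚ) / ((h0 ^ 3 * D : ℕ) : ℚ) with hφ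
  have hpos : ∀ h ∈ S, 0 < h := fun h hh => lt_of_lt_of_le hH (hS h hh).1
  have hcross : ∀ h ∈ S, b h * (h0 : ℤ) ^ 3 = b h0 * (h : ℤ) ^ 3 := by
    intro h hh
    have h1 := hb' h hh
    have h2 := hb' h0 hh0
    have b1 : (h : ℝ) ≤ 2 * Hh := by exact_mod_cast (hS h hh).2.1
    have b2 : (h0 : ℝ) ≤ 2 * Hh := by exact_mod_cast (hS h0 hh0).2.1
    have c1 : (h : ℝ) ^ 3 ≤ (2 * Hh) ^ 3 := by gcongr
    have c2 : (h0 : ℝ) ^ 3 ≤ (2 * Hh) ^ 3 := by gcongr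
    have h3 : |((b h * (h0 : ℤ) ^ 3 - b h0 * (h : ℤ) ^ 3 : ℤ) : ℝ)| < 1 := by
      have : ((b h * (h0 : ℤ) ^ 3 - b h0 * (h : ℤ) ^ 3 : ℤ) : ℝ) =
          (α * ((h0 ^ 3 * D : ℕ) : ℝ) - b h0) * (h : ℝ) ^ 3 - (α * ((h ^ 3 * D : ℕ) : ℝ) - b h) * (h0 : ℝ) ^ 3 := by
        push_cast; ring
      rw [this]
      calc _ ≤ |(α * ((h0 ^ 3 * D : ℕ) : ℝ) - b h0) * (h : ℝ) ^ 3| + |(α * ((h ^ 3 * D : ℕ) : ℝ) - b h) * (h0 : ℝ) ^ 3| := abs_sub _ _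
        _ = |α * ((h0 ^ 3 * D : ℕ) : ℝ) - b h0| * (h : ℝ) ^ 3 + |α * ((h ^ 3 * D : ℕ) : ℝ) - b h| * (h0 : ℝ) ^ 3 := by
            rw [abs_mul, abs_mul, abs_of_nonneg (show (0:ℝ) ≤ (h:ℝ)^3 by positivity), abs_of_nonneg (show (0:ℝ) ≤ (h0:ℝ)^3 by positivity)]
        _ ≤ τ * (2 * Hh) ^ 3 + τ * (2 * Hh) ^ 3 := by gcongr
        _ < 1 := by nlinarith
    have h4 : |b h * (h0 : ℤ) ^ 3 - b h0 * (h : ℤ) ^ 3| < 1 := by exact_mod_cast h3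
    have := Int.abs_lt_one_iff.mp h4
    omega
  have hφh : ∀ h ∈ S, φ = (b h : ℚ) / ((h ^ 3 * D : ℕ) : ℚ) := by
    intro h hh
    have p1 : (h : ℚ) ≠ 0 := by exact_mod_cast (hpos h hh).ne'
    have p0 : (h0 : ℚ) ≠ 0 := by exact_mod_cast (hpos h0 hh0).ne'
    have pD : (D : ℚ) ≠ 0 := by exact_mod_cast hD.ne'
    have h1 : (b h : ℚ) * (h0 : ℚ) ^ 3 = b h0 * (h : ℚ) ^ 3 := by exact_mod_cast hcross h hh
    rw [hφ]
    push_cast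
    rw [div_eq_div_iff (by positivity) (by positivity)]
    linear_combination (-D : ℚ) * h1
  have hden : ∀ h ∈ S, φ.den ∣ h ^ 3 * D := by
    intro h hh
    have := Rat.den_dvd (b h) ((h ^ 3 * D : ℕ) : ℤ)
    rw [← Rat.intCast_div_eq_divInt] at this
    rw [hφh h hh]
    exact_mod_cast this
  set d := φ.den / Nat.gcd φ.den D with hd
  obtain ⟨c, hc1, hc2⟩ := gcd_trick d 3 (by norm_num) S (by
    intro h hh
    apply dvd_div_gcd φ.den_pos
    rw [mul_comm]; exact hden h hh)
  have hcpos : 1 ≤ c := Nat.pos_of_dvd_of_pos (hc2 h0 hh0) (hpos h0 hh0)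
  have hmc := mult_count (2 * Hh) c S (fun h hh => ⟨hpos h hh, (hS h hh).2.1, hc2 h hh⟩)
  refine ⟨φ, c, hcpos, hmc, ?_, ?_, hden, ?_⟩
  · have : 1 ≤ S.card := Finset.card_pos.mpr ⟨h0, hh0⟩
    nlinarith
  · have h1 : Nat.gcd φ.den D * d = φ.den := Nat.mul_div_cancel' (Nat.gcd_dvd_left _ _)
    rw [← h1, mul_comm]
    exact mul_dvd_mul hc1 (Nat.gcd_dvd_right _ _)
  · have h1 := hb' h0 hh0
    have b1 : (Hh : ℝ) ≤ h0 := by exact_mod_cast (hS h0 hh0).1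
    have p0 : (0 : ℝ) < h0 := by exact_mod_cast hpos h0 hh0
    have pD : (0 : ℝ) < D := by exact_mod_cast hD
    have e : α * ((h0 ^ 3 * D : ℕ) : ℝ) - b h0 = (α - φ) * ((h0 : ℝ) ^ 3 * D) := by
      rw [hφ]; push_cast; field_simp
    rw [e, abs_mul, abs_of_pos (show (0:ℝ) < (h0 : ℝ) ^ 3 * D by positivity)] at h1
    refine le_trans ?_ h1
    gcongr

/-- the sum of gcds -/
lemma sum_gcd_pairs (Y : ℕ) (W : ℝ) (hW : ∀ n, 0 < n → n ≤ Y → (n.divisors.card : ℝ) ≤ W) :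
    ∑ p ∈ Finset.Icc 1 Y ×ˢ Finset.Icc 1 Y, ((Nat.gcd p.1 p.2 : ℕ) : ℝ) ≤ W * Y ^ 2 := by
  rw [Finset.sum_product]
  calc _ ≤ ∑ m ∈ Finset.Icc 1 Y, W * Y := by
        apply Finset.sum_le_sum
        intro m hm
        rw [Finset.mem_Icc] at hm
        have hmaps : ∀ n ∈ Finset.Icc 1 Y, Nat.gcd m n ∈ m.divisors := by
          intro n _; rw [Nat.mem_divisors]; exact ⟨Nat.gcd_dvd_left _ _, by omega⟩
        rw [← Finset.sum_fiberwise_of_maps_to hmaps]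
        calc _ ≤ ∑ d ∈ m.divisors, (Y : ℝ) := by
              apply Finset.sum_le_sum
              intro d _
              have h1 := mult_count Y d ((Finset.Icc 1 Y).filter (fun n => Nat.gcd m n = d)) (by
                intro s hs
                rw [Finset.mem_filter, Finset.mem_Icc] at hs
                exact ⟨hs.1.1, hs.1.2, by rw [← hs.2]; exact Nat.gcd_dvd_right _ _⟩)
              rw [Finset.sum_congr rfl (g := fun _ => (d : ℝ))]
              · rw [Finset.sum_const, nsmul_eq_mul]; exact_mod_cast h1
              · intro n hn; rw [(Finset.mem_filter.mp hn).2]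
          _ = m.divisors.card * Y := by simp
          _ ≤ _ := by gcongr; exact hW m hm.1 hm.2
    _ = _ := by simp; ring

section pairs
variable (α τ M C0 s W : ℝ) (Hh Y : ℕ) (Pr : Finset (ℕ × ℕ)) (φ : ℕ × ℕ → ℚ) (c : ℕ × ℕ → ℕ)

/-- Pair data for the counting argument. -/
structure PairData : Prop where
  hH : 1 ≤ Hh
  hM : 1 ≤ M
  hC0 : 0 < C0
  hs : 0 ≤ s
  hs3 : s ^ 3 = 2 * τ * (Y : ℝ) ^ 8
  hτ : 0 ≤ τ
  hW1 : 1 ≤ W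
  hW : ∀ n : ℕ, 0 < n → n ≤ 8 * Hh ^ 3 * Y ^ 8 → (n.divisors.card : ℝ) ≤ W
  hlogY : 1 + Real.log Y ≤ W
  hlogH : 1 + Real.log (2 * Hh : ℕ) ≤ W
  hm2 : ∀ p ∈ Pr, M ≤ p.2
  hm12 : ∀ p ∈ Pr, p.2 < p.1
  hmY : ∀ p ∈ Pr, p.1 ≤ Y
  hc1 : ∀ p ∈ Pr, 1 ≤ c p
  hc2 : ∀ p ∈ Pr, c p ≤ 2 * Hh
  hden : ∀ p ∈ Pr, (φ p).den ∣ c p ^ 3 * (p.1 ^ 8 - p.2 ^ 8)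
  happ : ∀ p ∈ Pr, |α - φ p| * ((Hh : ℝ) ^ 3 * ((p.1 ^ 8 - p.2 ^ 8 : ℕ) : ℝ)) ≤ τ
end pairs

namespace PairData
variable {α τ M C0 s W : ℝ} {Hh Y : ℕ} {Pr : Finset (ℕ × ℕ)} {φ : ℕ × ℕ → ℚ} {c : ℕ × ℕ → ℕ}

lemma Ypos (d : PairData α τ M C0 s W Hh Y Pr φ c) {p} (hp : p ∈ Pr) : 1 ≤ Y := by
  have := d.hm12 p hp; have := d.hmY p hp; omega

lemma p2pos (d : PairData α τ M C0 s W Hh Y Pr φ c) {p} (hp : p ∈ Pr) : 1 ≤ p.2 := by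
  have h1 := d.hm2 p hp
  have h2 := d.hM
  have : (1 : ℝ) ≤ p.2 := h2.trans h1
  exact_mod_cast this

lemma gpos (d : PairData α τ M C0 s W Hh Y Pr φ c) {p} (hp : p ∈ Pr) : 1 ≤ Nat.gcd p.1 p.2 :=
  Nat.gcd_pos_of_pos_right _ (d.p2pos hp)

lemma hWY (d : PairData α τ M C0 s W Hh Y Pr φ c) (n : ℕ) (h0 : 0 < n) (hn : n ≤ Y) :
    (n.divisors.card : ℝ) ≤ W := by
  apply d.hW n h0
  have h1 := d.hH
  have h2 : Y ≤ Y ^ 8 := Nat.le_self_pow (by norm_num) Y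
  have h3 : 1 ≤ Hh ^ 3 := Nat.one_le_pow _ _ h1
  nlinarith

lemma Dlower (d : PairData α τ M C0 s W Hh Y Pr φ c) {p} (hp : p ∈ Pr) :
    ((p.1 - p.2 : ℕ) : ℝ) * M ^ 7 ≤ ((p.1 ^ 8 - p.2 ^ 8 : ℕ) : ℝ) := by
  have h1 := d.hm12 p hp
  have h2 := d.hm2 p hp
  have hM := d.hM
  rw [Nat.cast_sub (Nat.pow_le_pow_left h1.le 8), Nat.cast_sub h1.le]
  push_cast
  have h3 : (p.2 : ℝ) ≤ p.1 := by exact_mod_cast h1.le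
  have e : (p.1 : ℝ) ^ 8 - (p.2 : ℝ) ^ 8 = (p.1 - p.2 : ℝ) * (p.1 ^ 7 + (p.2 * (p.1 ^ 6 + p.1 ^ 5 * p.2 + p.1 ^ 4 * p.2 ^ 2
     + p.1 ^ 3 * p.2 ^ 3 + p.1 ^ 2 * p.2 ^ 4 + p.1 * p.2 ^ 5 + p.2 ^ 6))) := by ring
  rw [e]
  apply mul_le_mul_of_nonneg_left _ (by linarith)
  have h4 : M ^ 7 ≤ (p.1 : ℝ) ^ 7 := by gcongr; linarith
  have h5 : (0 : ℝ) ≤ (p.2 * (p.1 ^ 6 + p.1 ^ 5 * p.2 + p.1 ^ 4 * p.2 ^ 2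
     + p.1 ^ 3 * p.2 ^ 3 + p.1 ^ 2 * p.2 ^ 4 + p.1 * p.2 ^ 5 + p.2 ^ 6)) := by positivity
  linarith

lemma Dpos (d : PairData α τ M C0 s W Hh Y Pr φ c) {p} (hp : p ∈ Pr) : 0 < p.1 ^ 8 - p.2 ^ 8 :=
  Nat.sub_pos_of_lt (Nat.pow_lt_pow_left (d.hm12 p hp) (by norm_num))

lemma Dupper (d : PairData α τ M C0 s W Hh Y Pr φ c) {p} (hp : p ∈ Pr) : p.1 ^ 8 - p.2 ^ 8 ≤ Y ^ 8 :=
  (Nat.sub_le _ _).trans (Nat.pow_le_pow_left (d.hmY p hp) 8)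

lemma den_le (d : PairData α τ M C0 s W Hh Y Pr φ c) {p} (hp : p ∈ Pr) : (φ p).den ≤ 8 * Hh ^ 3 * Y ^ 8 := by
  have h1 := Nat.le_of_dvd (Nat.mul_pos (pow_pos (d.hc1 p hp) 3) (d.Dpos hp)) (d.hden p hp)
  calc _ ≤ _ := h1
    _ ≤ (2 * Hh) ^ 3 * Y ^ 8 := Nat.mul_le_mul (Nat.pow_le_pow_left (d.hc2 p hp) 3) (d.Dupper hp)
    _ = _ := by ring

/-- pairs with large `c` -/
lemma part2 (d : PairData α τ M C0 s W Hh Y Pr φ c) :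
    ∑ p ∈ Pr.filter (fun p => C0 < c p * (Nat.gcd p.1 p.2 : ℕ)), (2 * Hh : ℝ) / c p ≤
      2 * Hh * (W * Y ^ 2) / C0 := by
  have hC0 := d.hC0
  calc _ ≤ ∑ p ∈ Pr.filter (fun p => C0 < c p * (Nat.gcd p.1 p.2 : ℕ)), (2 * Hh : ℝ) / C0 * (Nat.gcd p.1 p.2 : ℕ) := by
        apply Finset.sum_le_sum
        intro p hp
        rw [Finset.mem_filter] at hp
        have h1 : (0 : ℝ) < c p := by exact_mod_cast d.hc1 p hp.1
        rw [div_mul_eq_mul_div, div_le_div_iff₀ h1 hC0]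
        have h2 := hp.2
        have : (0 : ℝ) ≤ Hh := by positivity
        nlinarith
    _ ≤ ∑ p ∈ Finset.Icc 1 Y ×ˢ Finset.Icc 1 Y, (2 * Hh : ℝ) / C0 * (Nat.gcd p.1 p.2 : ℕ) := by
        apply Finset.sum_le_sum_of_subset_of_nonneg
        · intro p hp
          have hp := (Finset.mem_filter.mp hp).1
          have h1 := d.hm12 p hp
          have h2 := d.hmY p hp
          have h3 := d.p2pos hp
          simp only [Finset.mem_product, Finset.mem_Icc]
          omega
        · intros; positivity
    _ = (2 * Hh : ℝ) / C0 * ∑ p ∈ Finset.Icc 1 Y ×ˢ Finset.Icc 1 Y, ((Nat.gcd p.1 p.2 : ℕ) : ℝ) := by rw [Finset.mul_sum]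
    _ ≤ (2 * Hh : ℝ) / C0 * (W * Y ^ 2) := by
        gcongr
        exact sum_gcd_pairs Y W d.hWY
    _ = _ := by ring

/-- pairs with small difference -/
lemma part3 (d : PairData α τ M C0 s W Hh Y Pr φ c) (Q : Finset (ℕ × ℕ)) (hQ : Q ⊆ Pr)
    (h1 : ∀ p ∈ Q, c p * (Nat.gcd p.1 p.2 : ℕ) ≤ C0)
    (h2 : ∀ p ∈ Q, ((p.1 - p.2 : ℕ) : ℝ) * (Hh : ℝ) ^ 3 ≤ (c p : ℝ) ^ 3 * s ^ 3) :
    ∑ p ∈ Q, (2 * Hh : ℝ) / c p ≤ 2 * s * (Y * (C0 ^ 3 * s ^ 3 / Hh ^ 3)) := by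
  have hs := d.hs
  have hH : (0 : ℝ) < Hh := by exact_mod_cast d.hH
  set L := C0 ^ 3 * s ^ 3 / Hh ^ 3 with hL
  have hL0 : 0 ≤ L := by have := d.hC0; positivity
  have hcard : (Q.card : ℝ) ≤ Y * L := by
    have : Q.card ≤ (Finset.Icc 1 Y ×ˢ Finset.Icc 1 ⌊L⌋₊).card := by
      apply Finset.card_le_card_of_injOn (fun p => (p.2, p.1 - p.2))
      · intro p hp
        have hpQ := hQ hp
        have e1 := d.hm12 p hpQ
        have e2 := d.hmY p hpQ
        have e3 := d.p2pos hpQ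
        simp only [Finset.coe_product, Finset.coe_Icc, Set.mem_prod, Set.mem_Icc]
        refine ⟨⟨e3, by omega⟩, by omega, ?_⟩
        apply Nat.le_floor
        rw [hL, le_div_iff₀ (by positivity)]
        refine (h2 p hp).trans ?_
        have hc : (c p : ℝ) ≤ C0 := by
          have e4 : (1 : ℝ) ≤ (Nat.gcd p.1 p.2 : ℕ) := by exact_mod_cast d.gpos hpQ
          have e5 := h1 p hp
          have e6 : (0 : ℝ) ≤ c p := by positivity
          nlinarith
        gcongr
      · intro p hp p' hp' h
        have e1 := d.hm12 p (hQ hp)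
        have e1' := d.hm12 p' (hQ hp')
        simp only [Prod.mk.injEq] at h
        apply Prod.ext <;> omega
    rw [Finset.card_product, Nat.card_Icc, Nat.card_Icc, Nat.add_sub_cancel, Nat.add_sub_cancel] at this
    calc (Q.card : ℝ) ≤ ((Y * ⌊L⌋₊ : ℕ) : ℝ) := by exact_mod_cast this
      _ = Y * (⌊L⌋₊ : ℝ) := by push_cast; ring
      _ ≤ _ := by gcongr; exact Nat.floor_le hL0
  calc _ ≤ ∑ p ∈ Q, 2 * s := by
        apply Finset.sum_le_sum
        intro p hp
        have hpQ := hQ hp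
        have hc : (0 : ℝ) < c p := by exact_mod_cast d.hc1 p hpQ
        have e1 := d.hm12 p hpQ
        have e2 : (1 : ℝ) ≤ ((p.1 - p.2 : ℕ) : ℝ) := by
          have : 1 ≤ p.1 - p.2 := by omega
          exact_mod_cast this
        have e3 : (Hh : ℝ) ^ 3 ≤ (c p * s) ^ 3 := by
          rw [mul_pow]
          refine le_trans ?_ (h2 p hp)
          have : (0 : ℝ) ≤ (Hh : ℝ) ^ 3 := by positivity
          nlinarith
        have e4 : (Hh : ℝ) ≤ c p * s := le_of_pow_le_pow_left₀ (by norm_num) (by positivity) e3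
        rw [div_le_iff₀ hc]
        linarith
    _ = Q.card * (2 * s) := by simp
    _ ≤ Y * L * (2 * s) := by gcongr
    _ = _ := by ring

/-- equal keys give equal fractions -/
lemma same_key (d : PairData α τ M C0 s W Hh Y Pr φ c) {p p' : ℕ × ℕ} (hp : p ∈ Pr) (hp' : p' ∈ Pr)
    (hc : c p = c p') (hl : p.1 - p.2 = p'.1 - p'.2)
    (h2 : (c p : ℝ) ^ 3 * s ^ 3 < ((p.1 - p.2 : ℕ) : ℝ) * (Hh : ℝ) ^ 3) : φ p = φ p' := by
  by_contra hne
  set l := p.1 - p.2 with hl0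
  set D := p.1 ^ 8 - p.2 ^ 8 with hD
  set D' := p'.1 ^ 8 - p'.2 ^ 8 with hD'
  have hlD : l ∣ D := Nat.sub_dvd_pow_sub_pow _ _ _
  have hlD' : l ∣ D' := by rw [hl]; exact Nat.sub_dvd_pow_sub_pow _ _ _
  have hDp : 0 < D := d.Dpos hp
  have hDp' : 0 < D' := d.Dpos hp'
  have hlp : 0 < l := by have := d.hm12 p hp; omega
  obtain ⟨k, hk⟩ := hlD
  obtain ⟨k', hk'⟩ := hlD'
  have hkp : 0 < k := Nat.pos_of_ne_zero (by rintro rfl; omega)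
  have hkp' : 0 < k' := Nat.pos_of_ne_zero (by rintro rfl; omega)
  have hcp := d.hc1 p hp
  have hH := d.hH
  have key := rat_sep (φ p) (φ p') (c p ^ 3 * (l * k * k')) (by positivity)
    ((d.hden p hp).trans ⟨k', by rw [← hD, hk]; ring⟩)
    ((d.hden p' hp').trans ⟨k, by rw [← hD', hk', hc]; ring⟩) hne
  have a1 := d.happ p hp
  have a2 := d.happ p' hp'
  rw [← hD] at a1
  rw [← hD'] at a2
  have u1 := d.Dupper hp
  have u2 := d.Dupper hp'
  rw [← hD] at u1
  rw [← hD'] at u2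
  have u1' : (D : ℝ) ≤ (Y : ℝ) ^ 8 := by exact_mod_cast u1
  have u2' : (D' : ℝ) ≤ (Y : ℝ) ^ 8 := by exact_mod_cast u2
  have eD : (D : ℝ) = l * k := by exact_mod_cast hk
  have eD' : (D' : ℝ) = l * k' := by exact_mod_cast hk'
  have hlR : (0 : ℝ) < l := by exact_mod_cast hlp
  have hkR : (0 : ℝ) < k := by exact_mod_cast hkp
  have hkR' : (0 : ℝ) < k' := by exact_mod_cast hkp'
  have hcR : (0 : ℝ) < c p := by exact_mod_cast hcp
  have hHR : (0 : ℝ) < Hh := by exact_mod_cast hH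
  have tri : |(φ p : ℝ) - φ p'| ≤ |α - φ p| + |α - φ p'| := by
    rw [show (φ p : ℝ) - φ p' = -(α - φ p) + (α - φ p') by ring]
    refine (abs_add_le _ _).trans ?_
    rw [abs_neg]
  push_cast at key
  -- l Hh^3 ≤ c^3 τ (D + D')
  have m1 : (l : ℝ) * Hh ^ 3 ≤ (c p : ℝ) ^ 3 * (τ * D' + τ * D) := by
    calc (l : ℝ) * Hh ^ 3 = 1 * (l * Hh ^ 3) := by ring
      _ ≤ (|(φ p : ℝ) - φ p'| * ((c p : ℝ) ^ 3 * (l * k * k'))) * (l * Hh ^ 3) := by gcongr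
      _ ≤ ((|α - φ p| + |α - φ p'|) * ((c p : ℝ) ^ 3 * (l * k * k'))) * (l * Hh ^ 3) := by gcongr
      _ = (c p : ℝ) ^ 3 * ((|α - φ p| * (Hh ^ 3 * D)) * D' + (|α - φ p'| * (Hh ^ 3 * D')) * D) := by
          rw [eD, eD']; ring
      _ ≤ _ := by gcongr
  have m2 : (c p : ℝ) ^ 3 * (τ * D' + τ * D) ≤ (c p : ℝ) ^ 3 * s ^ 3 := by
    have := d.hτ
    rw [d.hs3]
    have : τ * D' + τ * D ≤ 2 * τ * (Y : ℝ) ^ 8 := by nlinarith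
    gcongr
  linarith

end PairData


lemma divisor_pairs_count (Y : ℕ) (W : ℝ) (hW : ∀ n, 0 < n → n ≤ Y → (n.divisors.card : ℝ) ≤ W) :
    ((((Finset.Icc 1 Y ×ˢ Finset.Icc 1 Y).filter (fun p => p.2 ∣ p.1)).card : ℕ) : ℝ) ≤ W * Y := by
  have hmaps : ∀ p ∈ (Finset.Icc 1 Y ×ˢ Finset.Icc 1 Y).filter (fun p => p.2 ∣ p.1), p.1 ∈ Finset.Icc 1 Y := by
    intro p hp
    exact (Finset.mem_product.mp (Finset.mem_filter.mp hp).1).1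
  rw [Finset.card_eq_sum_card_fiberwise hmaps]
  push_cast
  calc _ ≤ ∑ b ∈ Finset.Icc 1 Y, W := by
        apply Finset.sum_le_sum
        intro b hb
        rw [Finset.mem_Icc] at hb
        refine le_trans ?_ (hW b hb.1 hb.2)
        norm_cast
        apply Finset.card_le_card_of_injOn (fun p => p.2)
        · intro p hp
          simp only [Finset.coe_filter, Finset.mem_filter, Set.mem_ofPred_eq] at hp
          simp only [Finset.mem_coe, Nat.mem_divisors]
          exact ⟨hp.2 ▸ hp.1.2, by omega⟩
        · intro p hp p' hp' h
          simp only [Finset.coe_filter, Finset.mem_filter, Set.mem_ofPred_eq] at hp hp'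
          exact Prod.ext (hp.2.trans hp'.2.symm) h
    _ = _ := by simp; ring

namespace PairData
variable {α τ M C0 s W : ℝ} {Hh Y : ℕ} {Pr : Finset (ℕ × ℕ)} {φ : ℕ × ℕ → ℚ} {c : ℕ × ℕ → ℕ}

/-- the key of a pair -/
def key (c : ℕ × ℕ → ℕ) (p : ℕ × ℕ) : ℕ × ℕ × ℕ := (c p, p.1 - p.2, Nat.gcd p.1 p.2)

lemma part4 (d : PairData α τ M C0 s W Hh Y Pr φ c) (Q : Finset (ℕ × ℕ)) (hQ : Q ⊆ Pr)
    (h1 : ∀ p ∈ Q, ((Q.filter (fun p' => key c p' = key c p)).card : ℝ) ≤ (2 * W) ^ 3) :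
    ∑ p ∈ Q, (2 * Hh : ℝ) / c p ≤ 16 * W ^ 5 * Hh * Y := by
  have hW := d.hW1
  set K := Finset.Icc 1 (2 * Hh) ×ˢ ((Finset.Icc 1 Y ×ˢ Finset.Icc 1 Y).filter (fun p => p.2 ∣ p.1)) with hK
  have hmaps : ∀ p ∈ Q, key c p ∈ K := by
    intro p hp
    have hp := hQ hp
    have e1 := d.hm12 p hp
    have e2 := d.hmY p hp
    have e3 := d.p2pos hp
    have e4 := d.gpos hp
    have e5 : Nat.gcd p.1 p.2 ∣ p.1 - p.2 := Nat.dvd_sub (Nat.gcd_dvd_left _ _) (Nat.gcd_dvd_right _ _)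
    have e6 := Nat.le_of_dvd (by omega) e5
    have e7 := d.hc1 p hp
    have e8 := d.hc2 p hp
    simp only [hK, key, Finset.mem_product, Finset.mem_filter, Finset.mem_Icc]
    refine ⟨⟨e7, e8⟩, ⟨⟨by omega, by omega⟩, e4, by omega⟩, e5⟩
  rw [← Finset.sum_fiberwise_of_maps_to hmaps]
  calc _ ≤ ∑ k ∈ K, (2 * W) ^ 3 * ((2 * Hh : ℝ) / k.1) := by
        apply Finset.sum_le_sum
        intro k _
        rcases (Q.filter (fun p => key c p = k)).eq_empty_or_nonempty with h | ⟨p, hp⟩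
        · rw [h]; simp; positivity
        · rw [Finset.sum_congr rfl (g := fun _ => (2 * Hh : ℝ) / k.1)]
          · rw [Finset.sum_const, nsmul_eq_mul]
            gcongr
            have hp := Finset.mem_filter.mp hp
            have := h1 p hp.1
            rw [hp.2] at this
            exact this
          · intro p' hp'
            rw [← (Finset.mem_filter.mp hp').2]; rfl
    _ = (2 * W) ^ 3 * (2 * Hh) * (∑ a ∈ Finset.Icc 1 (2 * Hh), (1 : ℝ) / a) *
        (((Finset.Icc 1 Y ×ˢ Finset.Icc 1 Y).filter (fun p => p.2 ∣ p.1)).card : ℕ) := by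
        rw [hK, Finset.sum_product]
        simp only [Finset.sum_const, nsmul_eq_mul]
        rw [Finset.mul_sum, Finset.sum_mul]
        apply Finset.sum_congr rfl
        intro a _
        ring
    _ ≤ (2 * W) ^ 3 * (2 * Hh) * W * (W * Y) := by
        gcongr
        · exact harmonic_sum_le _ _ d.hlogH
        · exact divisor_pairs_count Y W d.hWY
    _ = _ := by ring

set_option maxHeartbeats 1000000 in
lemma part5a (d : PairData α τ M C0 s W Hh Y Pr φ c) {p : ℕ × ℕ} (hp : p ∈ Pr) (G : Finset (ℕ × ℕ))
    (hG : G ⊆ Pr) (hkey : ∀ p' ∈ G, key c p' = key c p) (hcard : (2 * W) ^ 3 < (G.card : ℝ))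
    (h1 : c p * (Nat.gcd p.1 p.2 : ℕ) ≤ C0)
    (h2 : (c p : ℝ) ^ 3 * s ^ 3 < ((p.1 - p.2 : ℕ) : ℝ) * (Hh : ℝ) ^ 3) :
    ((φ p).den : ℝ) ≤ C0 ^ 3 * Y ^ 4 * ((p.1 - p.2 : ℕ) : ℝ) := by
  set Z := (φ p).den with hZ
  have hZpos : 0 < Z := (φ p).den_pos
  set g := Nat.gcd p.1 p.2 with hg
  have hgpos : 1 ≤ g := d.gpos hp
  set l := p.1 - p.2 with hl
  have hlpos : 1 ≤ l := by have := d.hm12 p hp; omega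
  have hgl : g ∣ l := Nat.dvd_sub (Nat.gcd_dvd_left _ _) (Nat.gcd_dvd_right _ _)
  obtain ⟨l', hl'⟩ := hgl
  have hl'pos : 1 ≤ l' := Nat.pos_of_ne_zero (by rintro rfl; omega)
  set x := c p ^ 3 * g ^ 8 with hx
  set Z' := Z / Nat.gcd Z x with hZ'
  have hZ'Z : Nat.gcd Z x * Z' = Z := Nat.mul_div_cancel' (Nat.gcd_dvd_left _ _)
  have hZ'pos : 0 < Z' := Nat.pos_of_ne_zero (by intro h; rw [h] at hZ'Z; omega)
  have hxpos : 0 < x := by have := d.hc1 p hp; positivity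
  have : NeZero Z' := ⟨hZ'pos.ne'⟩
  -- each pair in the group
  have hpair : ∀ p' ∈ G, ∃ n₁ n₂ : ℕ, p'.1 = g * n₁ ∧ p'.2 = g * n₂ ∧ Nat.Coprime n₁ n₂ ∧ n₁ = n₂ + l' ∧
      Z' ∣ n₁ ^ 8 - n₂ ^ 8 := by
    intro p' hp'
    have hk := hkey p' hp'
    simp only [key, Prod.mk.injEq] at hk
    have hpP := hG hp'
    have hφ : φ p = φ p' := d.same_key hp hpP hk.1.symm hk.2.1.symm h2
    have hd := d.hden p' hpP
    rw [← hφ, hk.1] at hd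
    have e3 := d.hm12 p' hpP
    obtain ⟨n₁, hn₁⟩ : g ∣ p'.1 := by rw [hg, ← hk.2.2]; exact Nat.gcd_dvd_left _ _
    obtain ⟨n₂, hn₂⟩ : g ∣ p'.2 := by rw [hg, ← hk.2.2]; exact Nat.gcd_dvd_right _ _
    refine ⟨n₁, n₂, hn₁, hn₂, ?_, ?_, ?_⟩
    · have h3 := hk.2.2
      rw [hn₁, hn₂, Nat.gcd_mul_left, ← hg] at h3
      exact Nat.eq_of_mul_eq_mul_left hgpos (by rw [h3, mul_one])
    · have h3 := hk.2.1
      rw [← hl, hl', hn₁, hn₂] at h3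
      rw [hn₁, hn₂] at e3
      have : g * n₁ = g * (n₂ + l') := by rw [mul_add]; omega
      exact Nat.eq_of_mul_eq_mul_left hgpos this
    · apply dvd_div_gcd hZpos
      rw [hn₁, hn₂, mul_pow, mul_pow, ← Nat.mul_sub, ← mul_assoc] at hd
      exact hd
  -- pigeonhole
  have hcardlt : (Finset.univ.filter (fun u : (ZMod Z')ˣ => u ^ 8 = 1)).card < G.card := by
    have h3 := root_count_eight Z'
    have h4 : (Z'.divisors.card : ℝ) ≤ W := by
      apply d.hW Z' hZ'pos
      exact (Nat.div_le_self _ _).trans (d.den_le hp)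
    have h5 : ((Finset.univ.filter (fun u : (ZMod Z')ˣ => u ^ 8 = 1)).card : ℝ) ≤ (2 * W) ^ 3 := by
      calc _ ≤ (((2 * Z'.divisors.card) ^ 3 : ℕ) : ℝ) := by exact_mod_cast h3
        _ ≤ _ := by push_cast; gcongr
    exact_mod_cast h5.trans_lt hcard
  obtain ⟨a, ha, b, hb, hab, huv⟩ := Finset.exists_ne_map_eq_of_card_lt_of_maps_to hcardlt
    (f := fun p' => quoUnit Z' (p'.1 / g) (p'.2 / g)) (by
      intro p' hp'
      obtain ⟨n₁, n₂, e1, e2, e3, e4, e5⟩ := hpair p' hp'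
      have q := coprime_of_dvd_pow_sub (by omega) e3 (by norm_num) e5
      simp only [Finset.coe_filter, Finset.mem_univ, true_and, Set.mem_ofPred_eq]
      rw [e1, e2, Nat.mul_div_cancel_left _ hgpos, Nat.mul_div_cancel_left _ hgpos]
      exact quoUnit_pow q.1 q.2 8 (pow_eq_of_dvd (by omega) e5))
  obtain ⟨n₁, n₂, e1, e2, e3, e4, e5⟩ := hpair a ha
  obtain ⟨m₁, m₂, f1, f2, f3, f4, f5⟩ := hpair b hb
  have q := coprime_of_dvd_pow_sub (by omega) e3 (by norm_num) e5
  have q' := coprime_of_dvd_pow_sub (by omega) f3 (by norm_num) f5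
  rw [e1, e2, f1, f2, Nat.mul_div_cancel_left _ hgpos, Nat.mul_div_cancel_left _ hgpos,
    Nat.mul_div_cancel_left _ hgpos, Nat.mul_div_cancel_left _ hgpos] at huv
  have r1 := quoUnit_mul q.1 q.2
  have r2 := quoUnit_mul q'.1 q'.2
  rw [← huv] at r2
  have hne : n₂ ≠ m₂ := by
    rintro rfl
    apply hab
    apply Prod.ext
    · rw [e1, f1, e4, f4]
    · rw [e2, f2]
  have hz : ((l' * ((n₂ : ℤ) - m₂) : ℤ) : ZMod Z') = 0 := by
    push_cast
    generalize (quoUnit Z' n₁ n₂ : ZMod Z') = v at r1 r2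
    rw [e4] at r1
    rw [f4] at r2
    push_cast at r1 r2
    linear_combination (-(n₂ : ZMod Z')) * r2 + (m₂ : ZMod Z') * r1
  have hdvd : (Z' : ℤ) ∣ l' * ((n₂ : ℤ) - m₂) := (ZMod.intCast_zmod_eq_zero_iff_dvd _ _).mp hz
  have hle : (Z' : ℤ) ≤ |l' * ((n₂ : ℤ) - m₂)| := by
    apply Int.le_of_dvd
    · apply abs_pos.mpr
      apply mul_ne_zero
      · exact_mod_cast (show l' ≠ 0 by omega)
      · omega
    · exact (dvd_abs _ _).mpr hdvd
  have Y1 : g * n₂ ≤ Y := by rw [← e2]; have := d.hm12 a (hG ha); have := d.hmY a (hG ha); omega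
  have Y2 : g * m₂ ≤ Y := by rw [← f2]; have := d.hm12 b (hG hb); have := d.hmY b (hG hb); omega
  have hle2 : (Z' : ℤ) * g ^ 2 ≤ l * Y := by
    have h6 : (g : ℤ) * |(n₂ : ℤ) - m₂| ≤ Y := by
      rw [← Nat.abs_cast g, ← abs_mul, abs_le]
      zify at Y1 Y2
      have t1 : (0 : ℤ) ≤ g * n₂ := by positivity
      have t2 : (0 : ℤ) ≤ g * m₂ := by positivity
      rw [mul_sub]
      constructor <;> linarith
    rw [abs_mul, Nat.abs_cast] at hle
    have : (l : ℤ) = g * l' := by exact_mod_cast hl'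
    calc (Z' : ℤ) * g ^ 2 ≤ (l' * |(n₂ : ℤ) - m₂|) * g ^ 2 := by gcongr
      _ = (g * l') * (g * |(n₂ : ℤ) - m₂|) := by ring
      _ ≤ (g * l') * Y := by gcongr
      _ = _ := by rw [this]
  have hle3 : (Z' : ℝ) * g ^ 2 ≤ l * Y := by exact_mod_cast hle2
  have hZle : (Z : ℝ) ≤ x * Z' := by
    have : Z ≤ x * Z' := by
      rw [← hZ'Z]
      exact Nat.mul_le_mul_right _ (Nat.le_of_dvd hxpos (Nat.gcd_dvd_right _ _))
    exact_mod_cast this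
  have hgY : (g : ℝ) ≤ Y := by
    have h7 : g ≤ Y := by
      have := Nat.le_of_dvd (d.p2pos hp) (Nat.gcd_dvd_right p.1 p.2)
      have := d.hm12 p hp; have := d.hmY p hp; omega
    exact_mod_cast h7
  calc (Z : ℝ) ≤ x * Z' := hZle
    _ = (c p * g) ^ 3 * g ^ 3 * (Z' * g ^ 2) := by rw [hx]; push_cast; ring
    _ ≤ C0 ^ 3 * Y ^ 3 * (l * Y) := by have := d.hC0; gcongr
    _ = _ := by ring

lemma part5b (d : PairData α τ M C0 s W Hh Y Pr φ c) {p p' : ℕ × ℕ} (hp : p ∈ Pr) (hp' : p' ∈ Pr)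
    (h1 : ((φ p).den : ℝ) ≤ C0 ^ 3 * Y ^ 4 * ((p.1 - p.2 : ℕ) : ℝ))
    (h2 : ((φ p').den : ℝ) ≤ C0 ^ 3 * Y ^ 4 * ((p'.1 - p'.2 : ℕ) : ℝ))
    (h3 : 2 * C0 ^ 6 * Y ^ 9 * τ < Hh ^ 3 * M ^ 7) : φ p = φ p' := by
  by_contra hne
  have key := rat_sep (φ p) (φ p') ((φ p).den * (φ p').den) (Nat.mul_pos (φ p).den_pos (φ p').den_pos)
    (dvd_mul_right _ _) (dvd_mul_left _ _) hne
  have a1 := d.happ p hp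
  have a2 := d.happ p' hp'
  have b1 := d.Dlower hp
  have b2 := d.Dlower hp'
  have tri : |(φ p : ℝ) - φ p'| ≤ |α - φ p| + |α - φ p'| := by
    rw [show (φ p : ℝ) - φ p' = -(α - φ p) + (α - φ p') by ring]
    refine (abs_add_le _ _).trans ?_
    rw [abs_neg]
  have l1 : ((p.1 - p.2 : ℕ) : ℝ) ≤ Y := by
    have := d.hmY p hp
    exact_mod_cast (show p.1 - p.2 ≤ Y by omega)
  have l2 : ((p'.1 - p'.2 : ℕ) : ℝ) ≤ Y := by
    have := d.hmY p' hp'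
    exact_mod_cast (show p'.1 - p'.2 ≤ Y by omega)
  set l := ((p.1 - p.2 : ℕ) : ℝ)
  set l' := ((p'.1 - p'.2 : ℕ) : ℝ)
  set D := ((p.1 ^ 8 - p.2 ^ 8 : ℕ) : ℝ)
  set D' := ((p'.1 ^ 8 - p'.2 ^ 8 : ℕ) : ℝ)
  have hl0 : 0 ≤ l := Nat.cast_nonneg _
  have hl0' : 0 ≤ l' := Nat.cast_nonneg _
  push_cast at key
  have hτ := d.hτ
  have hC0 := d.hC0
  have hM := d.hM
  set K := C0 ^ 3 * (Y : ℝ) ^ 4 with hK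
  have hK0 : 0 ≤ K := by positivity
  have m1 : |α - φ p| * ((Hh : ℝ) ^ 3 * (l * M ^ 7)) ≤ τ := le_trans (by gcongr) a1
  have m2 : |α - φ p'| * ((Hh : ℝ) ^ 3 * (l' * M ^ 7)) ≤ τ := le_trans (by gcongr) a2
  have m3 : (Hh : ℝ) ^ 3 * M ^ 7 ≤ K ^ 2 * (τ * l' + τ * l) := by
    calc (Hh : ℝ) ^ 3 * M ^ 7 = 1 * ((Hh : ℝ) ^ 3 * M ^ 7) := by ring
      _ ≤ ((|α - φ p| + |α - φ p'|) * ((K * l) * (K * l'))) * ((Hh : ℝ) ^ 3 * M ^ 7) := by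
          gcongr
          refine key.trans ?_
          gcongr
      _ = K ^ 2 * ((|α - φ p| * ((Hh : ℝ) ^ 3 * (l * M ^ 7))) * l' + (|α - φ p'| * ((Hh : ℝ) ^ 3 * (l' * M ^ 7))) * l) := by ring
      _ ≤ _ := by gcongr
  have m4 : K ^ 2 * (τ * l' + τ * l) ≤ K ^ 2 * (τ * Y + τ * Y) := by gcongr
  have m5 : K ^ 2 * (τ * Y + τ * Y) = 2 * C0 ^ 6 * Y ^ 9 * τ := by rw [hK]; ring
  linarith

end PairData


namespace PairData
variable {α τ M C0 s W : ℝ} {Hh Y : ℕ} {Pr : Finset (ℕ × ℕ)} {φ : ℕ × ℕ → ℚ} {c : ℕ × ℕ → ℕ}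

lemma part6 (d : PairData α τ M C0 s W Hh Y Pr φ c) (Ex : Finset (ℕ × ℕ)) (hEx : Ex ⊆ Pr)
    (hφ : ∀ p ∈ Ex, ∀ p' ∈ Ex, φ p = φ p')
    (X1 Q4 B : ℝ) (hQ4 : 0 < Q4) (hX1 : 0 < X1) (hB : 0 ≤ B)
    (hα : ∀ (q : ℕ) (a : ℤ), 1 ≤ q → (q : ℝ) ≤ X1 → X1 / Q4 < |q * α - a|)
    (hB1 : (Y : ℝ) ^ 4 ≤ B ^ 4 * X1) (hB2 : (Y : ℝ) ^ 3 * τ * Q4 ≤ B ^ 4 * (X1 * (Hh ^ 3 * M ^ 7)))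
    (T : Finset (ℕ × ℕ × ℕ)) (hT : ∀ t ∈ T, t.2 ∈ Ex ∧ 1 ≤ t.1 ∧ t.1 ≤ 2 * Hh ∧
      (φ t.2).den ∣ t.1 ^ 3 * (t.2.1 ^ 8 - t.2.2 ^ 8)) :
    (T.card : ℝ) ≤ 16 * W ^ 6 * Hh * Y * (1 + B) := by
  have hW := d.hW1
  rcases T.eq_empty_or_nonempty with h | ⟨t0, ht0⟩
  · rw [h]; simp; positivity
  have hne : Ex.Nonempty := ⟨t0.2, (hT t0 ht0).1⟩
  obtain ⟨p, hp, hmax⟩ := Finset.exists_max_image Ex (fun p => p.1 - p.2) hne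
  set l := p.1 - p.2 with hl
  have hpP := hEx hp
  have hl1 : 1 ≤ l := by have := d.hm12 p hpP; omega
  have hlY : l ≤ Y := by have := d.hmY p hpP; omega
  set Z := (φ p).den with hZ
  have hZpos : 0 < Z := (φ p).den_pos
  have hM := d.hM
  have hH : (0 : ℝ) < Hh := by exact_mod_cast d.hH
  have hτ := d.hτ
  have hlR : (0 : ℝ) < l := by exact_mod_cast hl1
  have hZR : (0 : ℝ) < Z := by exact_mod_cast hZpos
  have hlYR : (l : ℝ) ≤ Y := by exact_mod_cast hlY
  have hbound : (l : ℝ) ^ 4 ≤ B ^ 4 * Z := by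
    by_cases hZX : (Z : ℝ) ≤ X1
    · have h1 := hα Z (φ p).num hZpos hZX
      have h2 := d.happ p hpP
      have h3 := d.Dlower hpP
      have h4 : (Z : ℝ) * α - (φ p).num = Z * (α - φ p) := by
        have : ((φ p : ℚ) : ℝ) * Z = (φ p).num := by exact_mod_cast Rat.mul_den_eq_num (φ p)
        linear_combination this
      rw [h4, abs_mul, abs_of_pos hZR, div_lt_iff₀ hQ4] at h1
      have h5 : |α - φ p| * ((Hh : ℝ) ^ 3 * (l * M ^ 7)) ≤ τ := le_trans (by gcongr) h2
      have h6 : X1 * ((Hh : ℝ) ^ 3 * (l * M ^ 7)) ≤ Z * Q4 * τ := by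
        calc _ ≤ (Z * |α - φ p| * Q4) * ((Hh : ℝ) ^ 3 * (l * M ^ 7)) := by gcongr
          _ = Z * Q4 * (|α - φ p| * ((Hh : ℝ) ^ 3 * (l * M ^ 7))) := by ring
          _ ≤ _ := by gcongr
      have hpos : 0 < X1 * ((Hh : ℝ) ^ 3 * M ^ 7) := by positivity
      have h7 : (l : ℝ) ^ 4 * (X1 * ((Hh : ℝ) ^ 3 * M ^ 7)) ≤ B ^ 4 * Z * (X1 * ((Hh : ℝ) ^ 3 * M ^ 7)) := by
        calc _ = (l : ℝ) ^ 3 * (X1 * ((Hh : ℝ) ^ 3 * (l * M ^ 7))) := by ring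
          _ ≤ (Y : ℝ) ^ 3 * (Z * Q4 * τ) := by gcongr
          _ = Z * ((Y : ℝ) ^ 3 * τ * Q4) := by ring
          _ ≤ Z * (B ^ 4 * (X1 * (Hh ^ 3 * M ^ 7))) := by gcongr
          _ = _ := by ring
      exact le_of_mul_le_mul_right h7 hpos
    · push Not at hZX
      calc (l : ℝ) ^ 4 ≤ (Y : ℝ) ^ 4 := by gcongr
        _ ≤ _ := hB1
        _ ≤ _ := by gcongr
  have hfin := final_count Z (2 * Hh) Y l hZpos W hW (by
    intro n hn
    exact d.hW n (Nat.pos_of_dvd_of_pos hn hZpos) ((Nat.le_of_dvd hZpos hn).trans (d.den_le hpP))) d.hlogY T (by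
    intro t ht
    obtain ⟨e1, e2, e3, e4⟩ := hT t ht
    have e5 := d.p2pos (hEx e1)
    have e6 := d.hm12 _ (hEx e1)
    have e7 := d.hmY _ (hEx e1)
    have e8 := hmax _ e1
    refine ⟨e2, e3, e5, e6, e7, ?_, ?_⟩
    · omega
    · rw [hZ, hφ p hp t.2 e1]; exact e4)
  have hlB : (l : ℝ) * (Z : ℝ) ^ (-((1 : ℝ) / 4)) ≤ B := by
    rw [Real.rpow_neg hZR.le, ← div_eq_mul_inv, div_le_iff₀ (by positivity)]
    apply le_of_pow_le_pow_left₀ (show 4 ≠ 0 by norm_num) (by positivity)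
    rw [mul_pow, ← Real.rpow_natCast ((Z : ℝ) ^ ((1 : ℝ) / 4)), ← Real.rpow_mul hZR.le]
    norm_num
    exact hbound
  calc _ ≤ _ := hfin
    _ ≤ 8 * W ^ 6 * (2 * Hh : ℕ) * Y * (1 + B) := by gcongr
    _ = _ := by push_cast; ring

end PairData

/-- The dyadic counting lemma. -/
lemma E_count (α τ M C0 W X1 Q4 B : ℝ) (Hh Y : ℕ)
    (hH : 1 ≤ Hh) (hM : 1 ≤ M) (hC0 : 0 < C0) (hτ : 0 ≤ τ) (hW1 : 1 ≤ W)
    (hW : ∀ n : ℕ, 0 < n → n ≤ 8 * Hh ^ 3 * Y ^ 8 → (n.divisors.card : ℝ) ≤ W)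
    (hlogY : 1 + Real.log Y ≤ W) (hlogH : 1 + Real.log (2 * Hh : ℕ) ≤ W)
    (hτ2 : 16 * τ * (Hh : ℝ) ^ 3 < 1)
    (h5b : 2 * C0 ^ 6 * Y ^ 9 * τ < Hh ^ 3 * M ^ 7)
    (hQ4 : 0 < Q4) (hX1 : 0 < X1) (hB : 0 ≤ B)
    (hα : ∀ (q : ℕ) (a : ℤ), 1 ≤ q → (q : ℝ) ≤ X1 → X1 / Q4 < |q * α - a|)
    (hB1 : (Y : ℝ) ^ 4 ≤ B ^ 4 * X1) (hB2 : (Y : ℝ) ^ 3 * τ * Q4 ≤ B ^ 4 * (X1 * (Hh ^ 3 * M ^ 7)))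
    (T : Finset (ℕ × ℕ × ℕ)) (hT : ∀ t ∈ T, Hh ≤ t.1 ∧ t.1 ≤ 2 * Hh ∧ M ≤ t.2.2 ∧ t.2.2 < t.2.1 ∧ t.2.1 ≤ Y ∧
      dn (α * ((t.1 ^ 3 * (t.2.1 ^ 8 - t.2.2 ^ 8) : ℕ) : ℝ)) ≤ τ)
    (s : ℝ) (hs : 0 ≤ s) (hs3 : s ^ 3 = 2 * τ * (Y : ℝ) ^ 8) :
    (T.card : ℝ) ≤ 2 * Hh * (W * Y ^ 2) / C0 + 2 * s * (Y * (C0 ^ 3 * s ^ 3 / Hh ^ 3))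
      + 16 * W ^ 5 * Hh * Y + 16 * W ^ 6 * Hh * Y * (1 + B) := by
  set Pr := T.image (fun t => t.2) with hPr
  set S : ℕ × ℕ → Finset ℕ := fun p => (T.filter (fun t => t.2 = p)).image (fun t => t.1) with hS
  have hex : ∀ p : ℕ × ℕ, ∃ φc : ℚ × ℕ, p ∈ Pr → (1 ≤ φc.2 ∧ (S p).card * φc.2 ≤ 2 * Hh ∧ φc.2 ≤ 2 * Hh ∧
      φc.1.den ∣ φc.2 ^ 3 * (p.1 ^ 8 - p.2 ^ 8) ∧
      (∀ h ∈ S p, φc.1.den ∣ h ^ 3 * (p.1 ^ 8 - p.2 ^ 8)) ∧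
      |α - φc.1| * ((Hh : ℝ) ^ 3 * ((p.1 ^ 8 - p.2 ^ 8 : ℕ) : ℝ)) ≤ τ) := by
    intro p
    by_cases hp : p ∈ Pr
    · obtain ⟨t, ht, rfl⟩ := Finset.mem_image.mp hp
      obtain ⟨e1, e2, e3, e4, e5, e6⟩ := hT t ht
      obtain ⟨φ, c, h1⟩ := pair_rat α τ Hh (t.2.1 ^ 8 - t.2.2 ^ 8)
        (Nat.sub_pos_of_lt (Nat.pow_lt_pow_left e4 (by norm_num))) hH hτ2 (S t.2) (by
          intro h hh
          obtain ⟨t', ht', rfl⟩ := Finset.mem_image.mp hh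
          obtain ⟨ht', heq⟩ := Finset.mem_filter.mp ht'
          obtain ⟨f1, f2, f3, f4, f5, f6⟩ := hT t' ht'
          rw [heq] at f6
          exact ⟨f1, f2, f6⟩) ⟨t.1, Finset.mem_image.mpr ⟨t, Finset.mem_filter.mpr ⟨ht, rfl⟩, rfl⟩⟩
      exact ⟨(φ, c), fun _ => h1⟩
    · exact ⟨(0, 0), fun h => absurd h hp⟩
  choose φc hφc using hex
  set φ : ℕ × ℕ → ℚ := fun p => (φc p).1 with hφ
  set c : ℕ × ℕ → ℕ := fun p => (φc p).2 with hc
  have hTp : ∀ p ∈ Pr, ∃ t ∈ T, t.2 = p := fun p hp => Finset.mem_image.mp hp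
  have d : PairData α τ M C0 s W Hh Y Pr φ c := by
    refine ⟨hH, hM, hC0, hs, hs3, hτ, hW1, hW, hlogY, hlogH, ?_, ?_, ?_, fun p hp => (hφc p hp).1,
      fun p hp => (hφc p hp).2.2.1, fun p hp => (hφc p hp).2.2.2.1, fun p hp => (hφc p hp).2.2.2.2.2⟩
    · intro p hp; obtain ⟨t, ht, rfl⟩ := hTp p hp; exact (hT t ht).2.2.1
    · intro p hp; obtain ⟨t, ht, rfl⟩ := hTp p hp; exact (hT t ht).2.2.2.1
    · intro p hp; obtain ⟨t, ht, rfl⟩ := hTp p hp; exact (hT t ht).2.2.2.2.1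
  have hfib : ∀ p ∈ Pr, ((T.filter (fun t => t.2 = p)).card : ℝ) ≤ (2 * Hh : ℝ) / c p := by
    intro p hp
    have e1 : (T.filter (fun t => t.2 = p)).card = (S p).card := by
      rw [hS]
      symm
      apply Finset.card_image_of_injOn
      intro t ht t' ht' h
      simp only [Finset.coe_filter, Set.mem_ofPred_eq] at ht ht'
      exact Prod.ext h (ht.2.trans ht'.2.symm)
    have e2 : (0 : ℝ) < c p := by exact_mod_cast d.hc1 p hp
    rw [e1, le_div_iff₀ e2]
    exact_mod_cast (hφc p hp).2.1
  -- the four classes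
  set P2 := Pr.filter (fun p => C0 < c p * (Nat.gcd p.1 p.2 : ℕ)) with hP2
  set P2' := Pr.filter (fun p => ¬ C0 < c p * (Nat.gcd p.1 p.2 : ℕ)) with hP2'
  set P3 := P2'.filter (fun p => ((p.1 - p.2 : ℕ) : ℝ) * (Hh : ℝ) ^ 3 ≤ (c p : ℝ) ^ 3 * s ^ 3) with hP3
  set P3' := P2'.filter (fun p => ¬ ((p.1 - p.2 : ℕ) : ℝ) * (Hh : ℝ) ^ 3 ≤ (c p : ℝ) ^ 3 * s ^ 3) with hP3'
  set grp : ℕ × ℕ → Finset (ℕ × ℕ) := fun p => P3'.filter (fun p' => PairData.key c p' = PairData.key c p) with hgrp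
  set P4 := P3'.filter (fun p => ((grp p).card : ℝ) ≤ (2 * W) ^ 3) with hP4
  set P4' := P3'.filter (fun p => ¬ ((grp p).card : ℝ) ≤ (2 * W) ^ 3) with hP4'
  have s2' : P2' ⊆ Pr := Finset.filter_subset _ _
  have s3 : P3 ⊆ Pr := (Finset.filter_subset _ _).trans s2'
  have s3' : P3' ⊆ Pr := (Finset.filter_subset _ _).trans s2'
  have s4 : P4 ⊆ Pr := (Finset.filter_subset _ _).trans s3'
  have s4' : P4' ⊆ Pr := (Finset.filter_subset _ _).trans s3'
  have i2 : ∀ p ∈ P2', c p * (Nat.gcd p.1 p.2 : ℕ) ≤ C0 := fun p hp => not_lt.mp (Finset.mem_filter.mp hp).2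
  have b2 := d.part2
  have b3 := d.part3 P3 s3 (fun p hp => i2 p (Finset.mem_filter.mp hp).1) (fun p hp => (Finset.mem_filter.mp hp).2)
  have b4 := d.part4 P4 s4 (by
    intro p hp
    refine le_trans ?_ (Finset.mem_filter.mp hp).2
    norm_cast
    exact Finset.card_le_card (Finset.filter_subset_filter _ (Finset.filter_subset _ _)))
  have h5a : ∀ p ∈ P4', ((φ p).den : ℝ) ≤ C0 ^ 3 * Y ^ 4 * ((p.1 - p.2 : ℕ) : ℝ) := by
    intro p hp
    obtain ⟨hp3, hp4⟩ := Finset.mem_filter.mp hp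
    obtain ⟨hp2, hp3'⟩ := Finset.mem_filter.mp hp3
    exact d.part5a (s4' hp) (grp p) ((Finset.filter_subset _ _).trans s3') (fun p' hp' => (Finset.mem_filter.mp hp').2)
      (not_le.mp hp4) (i2 p hp2) (not_le.mp hp3')
  have b6 := d.part6 P4' s4' (fun p hp p' hp' => d.part5b (s4' hp) (s4' hp') (h5a p hp) (h5a p' hp') h5b)
    X1 Q4 B hQ4 hX1 hB hα hB1 hB2 (T.filter (fun t => t.2 ∈ P4')) (by
      intro t ht
      obtain ⟨ht, htE⟩ := Finset.mem_filter.mp ht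
      have hh := hT t ht
      refine ⟨htE, by omega, hh.2.1, ?_⟩
      exact (hφc t.2 (s4' htE)).2.2.2.2.1 t.1 (Finset.mem_image.mpr ⟨t, Finset.mem_filter.mpr ⟨ht, rfl⟩, rfl⟩))
  have hT1 : (T.card : ℝ) = ∑ p ∈ Pr, ((T.filter (fun t => t.2 = p)).card : ℝ) := by
    rw [Finset.card_eq_sum_card_fiberwise (fun t ht => Finset.mem_image_of_mem (fun t => t.2) ht)]
    push_cast; rfl
  have hT4 : ((T.filter (fun t => t.2 ∈ P4')).card : ℝ) = ∑ p ∈ P4', ((T.filter (fun t => t.2 = p)).card : ℝ) := by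
    rw [Finset.card_eq_sum_card_fiberwise (s := T.filter (fun t => t.2 ∈ P4')) (f := fun t => t.2) (t := P4')
      (fun t ht => (Finset.mem_filter.mp (Finset.mem_coe.mp ht)).2)]
    push_cast
    apply Finset.sum_congr rfl
    intro p hp
    congr 2
    ext t
    simp only [Finset.mem_filter]
    constructor
    · rintro ⟨⟨h1, h2⟩, h3⟩; exact ⟨h1, h3⟩
    · rintro ⟨h1, h3⟩; exact ⟨⟨h1, h3 ▸ hp⟩, h3⟩
  rw [hT1, ← Finset.sum_filter_add_sum_filter_not Pr (fun p => C0 < c p * (Nat.gcd p.1 p.2 : ℕ)), ← hP2, ← hP2',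
    ← Finset.sum_filter_add_sum_filter_not P2' (fun p => ((p.1 - p.2 : ℕ) : ℝ) * (Hh : ℝ) ^ 3 ≤ (c p : ℝ) ^ 3 * s ^ 3),
    ← hP3, ← hP3', ← Finset.sum_filter_add_sum_filter_not P3' (fun p => ((grp p).card : ℝ) ≤ (2 * W) ^ 3), ← hP4, ← hP4', ← hT4]
  have c2 : ∑ p ∈ P2, ((T.filter (fun t => t.2 = p)).card : ℝ) ≤ ∑ p ∈ P2, (2 * Hh : ℝ) / c p :=
    Finset.sum_le_sum (fun p hp => hfib p ((Finset.filter_subset _ _) hp))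
  have c3 : ∑ p ∈ P3, ((T.filter (fun t => t.2 = p)).card : ℝ) ≤ ∑ p ∈ P3, (2 * Hh : ℝ) / c p :=
    Finset.sum_le_sum (fun p hp => hfib p (s3 hp))
  have c4 : ∑ p ∈ P4, ((T.filter (fun t => t.2 = p)).card : ℝ) ≤ ∑ p ∈ P4, (2 * Hh : ℝ) / c p :=
    Finset.sum_le_sum (fun p hp => hfib p (s4 hp))
  linarith


/-- The standing parameters. -/
structure Par (P M H Q X1 W : ℝ) : Prop where
  hP : 2 ≤ P
  hM : 1 ≤ M
  hH : 1 ≤ H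
  hQ : 2 ≤ Q
  hX1 : 1 ≤ X1
  hW : 1 ≤ W
  eQ : M * Q = P
  eH : H * M ^ 4 = P
  eX : X1 * M ^ 13 = Q ^ 4
  hMX : M ^ 4 ≤ X1
  hXP : X1 ≤ P
  c1 : 64 * Real.sqrt M * H ^ 3 < P
  c2 : 8 * M ^ 8 * W ^ 9 * Real.sqrt M < H ^ 3 * P
  c3 : M ^ 9 ≤ H ^ 3 * P
  c4 : ∃ S0 : ℝ, 0 ≤ S0 ∧ S0 ^ 3 * P = M ^ 8 ∧ M ^ 3 * S0 ^ 4 ≤ H ^ 4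
  hd : ∀ n : ℕ, 0 < n → (n : ℝ) ≤ P ^ 20 → (n.divisors.card : ℝ) ≤ W
  hlog : ∀ x : ℝ, 1 ≤ x → x ≤ P ^ 20 → 1 + Real.log x ≤ W
  hWP : W ≤ P
  hP8 : 8 ≤ P

namespace Par
variable {P M H Q X1 W : ℝ}

lemma MleP (p : Par P M H Q X1 W) : M ≤ P := by
  have h1 := p.eQ; have h2 := p.hQ; have h3 := p.hM; nlinarith

lemma HleP (p : Par P M H Q X1 W) : H ≤ P := by
  have h1 := p.eH; have h2 := p.hH
  have h3 : 1 ≤ M ^ 4 := one_le_pow₀ p.hM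
  nlinarith

set_option maxHeartbeats 1000000 in
/-- one dyadic block -/
lemma block (p : Par P M H Q X1 W) (α v : ℝ) (Hh Y : ℕ) (hHh : 1 ≤ Hh) (hHH : (Hh : ℝ) ≤ H)
    (hY : (Y : ℝ) ≤ M * W) (hY1 : 1 ≤ Y) (hv : 1 ≤ v) (hvM : v ^ 4 ≤ 16 * M)
    (hα : ∀ (q : ℕ) (a : ℤ), 1 ≤ q → (q : ℝ) ≤ X1 → X1 / Q ^ 4 < |q * α - a|)
    (T : Finset (ℕ × ℕ × ℕ)) (hT : ∀ t ∈ T, Hh ≤ t.1 ∧ t.1 ≤ 2 * Hh ∧ M ≤ t.2.2 ∧ t.2.2 < t.2.1 ∧ t.2.1 ≤ Y ∧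
      dn (α * ((t.1 ^ 3 * (t.2.1 ^ 8 - t.2.2 ^ 8) : ℕ) : ℝ)) ≤ v ^ 2 / P) :
    (T.card : ℝ) ≤ 100 * W ^ 13 * (H * M * v ^ 4) := by
  obtain ⟨S0, hS0, hS3, hS4⟩ := p.c4
  have hP := p.hP
  have hM := p.hM
  have hH := p.hH
  have hW := p.hW
  have hX1 := p.hX1
  have hQ := p.hQ
  have hP0 : 0 < P := by linarith
  have hHR : (1 : ℝ) ≤ Hh := by exact_mod_cast hHh
  have hYR : (1 : ℝ) ≤ Y := by exact_mod_cast hY1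
  have hv2 : v ^ 2 ≤ 4 * Real.sqrt M := by
    apply le_of_pow_le_pow_left₀ (show 2 ≠ 0 by norm_num) (by positivity)
    rw [mul_pow, Real.sq_sqrt (by linarith)]
    calc (v ^ 2) ^ 2 = v ^ 4 := by ring
      _ ≤ _ := hvM
      _ = _ := by ring
  have hsM : 1 ≤ Real.sqrt M := Real.one_le_sqrt.mpr hM
  set τ := v ^ 2 / P with hτ
  have hτ0 : 0 ≤ τ := by positivity
  have hτP : τ * P = v ^ 2 := by rw [hτ]; field_simp
  set s := (2 * τ * (Y : ℝ) ^ 8) ^ ((1 : ℝ) / 3) with hs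
  have hs0 : 0 ≤ s := by positivity
  have hs3 : s ^ 3 = 2 * τ * (Y : ℝ) ^ 8 := by
    rw [hs, ← Real.rpow_natCast, ← Real.rpow_mul (by positivity)]; norm_num
  set C0 := Hh * M / H with hC0
  have hC0H : C0 * H = Hh * M := by rw [hC0]; field_simp
  have hC0p : 0 < C0 := by positivity
  have hMP := p.MleP
  have hHP := p.HleP
  have hWP := p.hWP
  have hP8 := p.hP8
  have hYP : (Y : ℝ) ≤ P ^ 2 := by
    calc (Y : ℝ) ≤ M * W := hY
      _ ≤ P * P := by gcongr
      _ = _ := by ring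
  set B := W + W * v ^ 2 * H / Hh with hB
  have hB0 : 0 ≤ B := by positivity
  have hBW : W ≤ B := by rw [hB]; have : 0 ≤ W * v ^ 2 * H / Hh := by positivity
                         linarith
  have hBV : W * v ^ 2 * H / Hh ≤ B := by rw [hB]; linarith
  have hv21 : 1 ≤ v ^ 2 := one_le_pow₀ hv
  have main := E_count α τ M C0 W X1 (Q ^ 4) B Hh Y hHh hM hC0p hτ0 hW
    (by
      intro n hn hn2
      apply p.hd n hn
      calc (n : ℝ) ≤ ((8 * Hh ^ 3 * Y ^ 8 : ℕ) : ℝ) := by exact_mod_cast hn2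
        _ = 8 * (Hh : ℝ) ^ 3 * (Y : ℝ) ^ 8 := by push_cast; ring
        _ ≤ P * P ^ 3 * (P ^ 2) ^ 8 := by gcongr; linarith
        _ = P ^ 20 := by ring)
    (p.hlog _ hYR (hYP.trans (pow_le_pow_right₀ (by linarith) (by norm_num))))
    (p.hlog _ (by push_cast; linarith) (by
      push_cast
      calc (2 * (Hh : ℝ)) ≤ P * P := by gcongr; linarith
        _ = P ^ 2 := by ring
        _ ≤ _ := pow_le_pow_right₀ (by linarith) (by norm_num)))
    (by
      have h1 := p.c1
      have : 16 * τ * (Hh : ℝ) ^ 3 * P < 1 * P := by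
        calc 16 * τ * (Hh : ℝ) ^ 3 * P = 16 * (τ * P) * (Hh : ℝ) ^ 3 := by ring
          _ ≤ 16 * (4 * Real.sqrt M) * H ^ 3 := by rw [hτP]; gcongr
          _ = 64 * Real.sqrt M * H ^ 3 := by ring
          _ < 1 * P := by linarith
      exact lt_of_mul_lt_mul_right this hP0.le)
    (by
      have h1 := p.c2
      have h2 : (2 * C0 ^ 6 * Y ^ 9 * τ) * (H ^ 6 * P) < (Hh ^ 3 * M ^ 7) * (H ^ 6 * P) := by
        calc (2 * C0 ^ 6 * Y ^ 9 * τ) * (H ^ 6 * P) = 2 * (C0 * H) ^ 6 * Y ^ 9 * (τ * P) := by ring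
          _ ≤ 2 * (Hh * M) ^ 6 * (M * W) ^ 9 * (4 * Real.sqrt M) := by rw [hC0H, hτP]; gcongr
          _ = (Hh ^ 3 * M ^ 7) * (Hh ^ 3 * (8 * M ^ 8 * W ^ 9 * Real.sqrt M)) := by ring
          _ ≤ (Hh ^ 3 * M ^ 7) * (H ^ 3 * (8 * M ^ 8 * W ^ 9 * Real.sqrt M)) := by gcongr
          _ < (Hh ^ 3 * M ^ 7) * (H ^ 3 * (H ^ 3 * P)) := by gcongr
          _ = _ := by ring
      exact lt_of_mul_lt_mul_right h2 (by positivity))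
    (by positivity) (by linarith) hB0 hα
    (by
      calc (Y : ℝ) ^ 4 ≤ (M * W) ^ 4 := by gcongr
        _ = W ^ 4 * M ^ 4 := by ring
        _ ≤ B ^ 4 * X1 := by gcongr; exact p.hMX)
    (by
      have e1 : (Y : ℝ) ^ 3 * τ * Q ^ 4 * (P * Hh) ≤ (W * v ^ 2 * H) ^ 4 * (X1 * M ^ 7) * P := by
        have h3 := p.c3
        calc (Y : ℝ) ^ 3 * τ * Q ^ 4 * (P * Hh) = (Y : ℝ) ^ 3 * (τ * P) * Q ^ 4 * Hh := by ring
          _ ≤ (M * W) ^ 3 * v ^ 2 * (X1 * M ^ 13) * Hh := by rw [hτP, p.eX]; gcongr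
          _ = (W ^ 3 * X1 * M ^ 7 * v ^ 2 * Hh) * M ^ 9 := by ring
          _ ≤ (W ^ 3 * X1 * M ^ 7 * v ^ 2 * Hh) * (H ^ 3 * P) := by gcongr
          _ ≤ (W ^ 4 * X1 * M ^ 7 * (v ^ 2) ^ 4 * H) * (H ^ 3 * P) := by
              gcongr ?_ * X1 * M ^ 7 * ?_ * ?_ * _
              · exact pow_le_pow_right₀ hW (by norm_num)
              · exact le_self_pow₀ hv21 (by norm_num)
          _ = _ := by ring
      have hpos : 0 < P * Hh := by positivity
      refine le_of_mul_le_mul_right (e1.trans ?_) hpos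
      calc (W * v ^ 2 * H) ^ 4 * (X1 * M ^ 7) * P = (W * v ^ 2 * H / Hh) ^ 4 * (X1 * (Hh ^ 3 * M ^ 7)) * (P * Hh) := by
            field_simp
        _ ≤ B ^ 4 * (X1 * (Hh ^ 3 * M ^ 7)) * (P * Hh) := by gcongr)
    T hT s hs0 hs3
  refine main.trans ?_
  have hW0 : 0 < W := by linarith
  have pw : ∀ k, k ≤ 13 → W ^ k ≤ W ^ 13 := fun k hk => pow_le_pow_right₀ hW hk
  have hG : 0 ≤ H * M * v ^ 4 := by positivity
  have HM : H * M ≤ H * M * v ^ 4 := le_mul_of_one_le_right (by positivity) (one_le_pow₀ hv)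
  have t1 : 2 * Hh * (W * Y ^ 2) / C0 ≤ 2 * W ^ 13 * (H * M * v ^ 4) := by
    rw [div_le_iff₀ hC0p]
    calc 2 * Hh * (W * Y ^ 2) ≤ 2 * Hh * (W * (M * W) ^ 2) := by gcongr
      _ = 2 * W ^ 3 * M * (Hh * M) := by ring
      _ = 2 * W ^ 3 * (H * M) * C0 := by rw [← hC0H]; ring
      _ ≤ 2 * W ^ 13 * (H * M * v ^ 4) * C0 := by gcongr ?_ * ?_ * ?_ * _; exact pw 3 (by norm_num)
  have hs4 : s ≤ 2 * W ^ 3 * v * S0 := by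
    apply le_of_pow_le_pow_left₀ (show 3 ≠ 0 by norm_num) (by positivity)
    rw [hs3]
    refine le_of_mul_le_mul_right ?_ hP0
    calc 2 * τ * (Y : ℝ) ^ 8 * P = 2 * (τ * P) * (Y : ℝ) ^ 8 := by ring
      _ ≤ 2 * v ^ 2 * (M * W) ^ 8 := by rw [hτP]; gcongr
      _ = 2 * v ^ 2 * W ^ 8 * M ^ 8 := by ring
      _ ≤ 8 * v ^ 3 * W ^ 9 * M ^ 8 := by
          gcongr ?_ * ?_ * ?_ * _
          · norm_num
          · exact pow_le_pow_right₀ hv (by norm_num)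
          · exact pow_le_pow_right₀ hW (by norm_num)
      _ = (2 * W ^ 3 * v * S0) ^ 3 * P := by rw [← hS3]; ring
  have t2 : 2 * s * (Y * (C0 ^ 3 * s ^ 3 / Hh ^ 3)) ≤ 32 * W ^ 13 * (H * M * v ^ 4) := by
    have e1 : C0 ^ 3 / Hh ^ 3 = M ^ 3 / H ^ 3 := by rw [hC0]; field_simp
    calc 2 * s * (Y * (C0 ^ 3 * s ^ 3 / Hh ^ 3)) = 2 * Y * s ^ 4 * (C0 ^ 3 / Hh ^ 3) := by ring
      _ = 2 * Y * s ^ 4 * (M ^ 3 / H ^ 3) := by rw [e1]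
      _ ≤ 2 * (M * W) * (2 * W ^ 3 * v * S0) ^ 4 * (M ^ 3 / H ^ 3) := by gcongr
      _ = 32 * W ^ 13 * M * v ^ 4 * (M ^ 3 * S0 ^ 4) / H ^ 3 := by ring
      _ ≤ 32 * W ^ 13 * M * v ^ 4 * H ^ 4 / H ^ 3 := by gcongr
      _ = 32 * W ^ 13 * (H * M * v ^ 4) := by field_simp
  have t3 : 16 * W ^ 5 * Hh * Y ≤ 16 * W ^ 13 * (H * M * v ^ 4) := by
    calc 16 * W ^ 5 * Hh * Y ≤ 16 * W ^ 5 * H * (M * W) := by gcongr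
      _ = 16 * W ^ 6 * (H * M) := by ring
      _ ≤ _ := by gcongr ?_ * ?_ * ?_; exact pw 6 (by norm_num)
  have t4 : 16 * W ^ 6 * Hh * Y * (1 + B) ≤ 48 * W ^ 13 * (H * M * v ^ 4) := by
    have e1 : Hh * (1 + B) ≤ 3 * W * (H * v ^ 2) := by
      have : Hh * (1 + B) = Hh + Hh * W + W * v ^ 2 * H := by rw [hB]; field_simp; ring
      rw [this]
      have a1 : (Hh : ℝ) ≤ W * (H * v ^ 2) := by
        calc (Hh : ℝ) ≤ 1 * (H * 1) := by linarith
          _ ≤ _ := by gcongr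
      have a2 : (Hh : ℝ) * W ≤ W * (H * v ^ 2) := by
        calc (Hh : ℝ) * W ≤ H * W := by gcongr
          _ = W * (H * 1) := by ring
          _ ≤ _ := by gcongr
      linarith
    calc 16 * W ^ 6 * Hh * Y * (1 + B) = 16 * W ^ 6 * Y * (Hh * (1 + B)) := by ring
      _ ≤ 16 * W ^ 6 * (M * W) * (3 * W * (H * v ^ 2)) := by gcongr
      _ = 48 * W ^ 8 * (H * M * v ^ 2) := by ring
      _ ≤ _ := by
          gcongr ?_ * ?_ * (_ * ?_)
          · exact pw 8 (by norm_num)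
          · exact pow_le_pow_right₀ hv (by norm_num)
  have : 2 * W ^ 13 * (H * M * v ^ 4) + 32 * W ^ 13 * (H * M * v ^ 4) + 16 * W ^ 13 * (H * M * v ^ 4)
      + 48 * W ^ 13 * (H * M * v ^ 4) ≤ 100 * W ^ 13 * (H * M * v ^ 4) := by
    have : 0 ≤ W ^ 13 * (H * M * v ^ 4) := by positivity
    linarith
  linarith

end Par


/-- expanding a square -/
lemma normSq_sum_eC {ι : Type*} (s : Finset ι) (f : ι → ℝ) :
    ((‖∑ i ∈ s, eC (f i)‖ ^ 2 : ℝ) : ℂ) = ∑ i ∈ s, ∑ j ∈ s, eC (f i - f j) := by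
  have h : ∀ z : ℂ, ((‖z‖ ^ 2 : ℝ) : ℂ) = z * starRingEnd ℂ z := by
    intro z; rw [Complex.mul_conj, Complex.normSq_eq_norm_sq]
  rw [h, map_sum, Finset.sum_mul_sum]
  simp_rw [eC_sub]

lemma lag_sum (N : ℕ) (b : ℤ → ℝ) (hb : ∀ j, 0 ≤ b j) :
    N * ∑ j ∈ Finset.Ioo (-(N : ℤ)) N, b j ≤
      ∑ k ∈ Finset.range (2 * N), ∑ k' ∈ Finset.range (2 * N), b ((k : ℤ) - k') := by
  have e1 : N * ∑ j ∈ Finset.Ioo (-(N : ℤ)) N, b j = ∑ x ∈ Finset.Ioo (-(N : ℤ)) N ×ˢ Finset.range N, b x.1 := by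
    rw [Finset.sum_product, Finset.mul_sum]
    simp
  rw [e1, ← Finset.sum_product']
  set F : ℤ × ℕ → ℕ × ℕ := fun x => (x.2 + x.1.toNat, x.2 + (-x.1).toNat) with hF
  have hinj : Set.InjOn F (Finset.Ioo (-(N : ℤ)) N ×ˢ Finset.range N : Finset (ℤ × ℕ)) := by
    intro x _ y _ h
    simp only [hF, Prod.mk.injEq] at h
    apply Prod.ext <;> omega
  have e2 : ∑ x ∈ Finset.Ioo (-(N : ℤ)) N ×ˢ Finset.range N, b x.1 =
      ∑ y ∈ (Finset.Ioo (-(N : ℤ)) N ×ˢ Finset.range N).image F, b ((y.1 : ℤ) - y.2) := by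
    rw [Finset.sum_image hinj]
    apply Finset.sum_congr rfl
    intro x _
    congr 1
    simp only [hF]
    push_cast
    omega
  rw [e2]
  apply Finset.sum_le_sum_of_subset_of_nonneg
  · intro y hy
    obtain ⟨x, hx, rfl⟩ := Finset.mem_image.mp hy
    simp only [Finset.mem_product, Finset.mem_Ioo, Finset.mem_range, hF] at hx ⊢
    omega
  · intros; exact hb _

lemma geom_range_le (N : ℕ) (y : ℝ) : ‖∑ k ∈ Finset.range N, eC (y * k)‖ ≤ mn N y := by
  apply le_mn
  · calc _ ≤ ∑ k ∈ Finset.range N, ‖eC (y * k)‖ := norm_sum_le _ _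
      _ = N := by simp [norm_eC]
  · have h := geom_sum_bound y 0 0 N
    have e : ∑ z ∈ Finset.Ico (0 : ℤ) N, eC (y * z + 0) = ∑ k ∈ Finset.range N, eC (y * k) := by
      rw [Finset.range_eq_Ico]
      symm
      apply Finset.sum_nbij (fun k : ℕ => (k : ℤ))
      · intro k hk; simp only [Finset.mem_Ico] at hk ⊢; omega
      · intro a _ b _ h; simpa using h
      · intro z hz
        simp only [Finset.coe_Ico, Set.mem_Ico] at hz
        refine ⟨z.toNat, ?_, ?_⟩
        · simp only [Finset.coe_Ico, Set.mem_Ico]; omega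
        · simp only; omega
      · intro k _; simp
    rw [e] at h
    exact h

lemma sum4_comm {A B C D : Type*} (a : Finset A) (b : Finset B) (c : Finset C) (d : Finset D)
    (f : A → B → C → D → ℂ) :
    ∑ i ∈ a, ∑ j ∈ b, ∑ k ∈ c, ∑ l ∈ d, f i j k l = ∑ k ∈ c, ∑ l ∈ d, ∑ i ∈ a, ∑ j ∈ b, f i j k l := by
  calc _ = ∑ i ∈ a, ∑ k ∈ c, ∑ j ∈ b, ∑ l ∈ d, f i j k l :=
        Finset.sum_congr rfl (fun i _ => Finset.sum_comm)
    _ = ∑ k ∈ c, ∑ i ∈ a, ∑ j ∈ b, ∑ l ∈ d, f i j k l := Finset.sum_comm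
    _ = ∑ k ∈ c, ∑ i ∈ a, ∑ l ∈ d, ∑ j ∈ b, f i j k l :=
        Finset.sum_congr rfl (fun k _ => Finset.sum_congr rfl (fun i _ => Finset.sum_comm))
    _ = _ := Finset.sum_congr rfl (fun k _ => Finset.sum_comm)

lemma lag_dual (N : ℕ) (Ms : Finset ℕ) (x : ℕ → ℝ) :
    N * ∑ j ∈ Finset.Ioo (-(N : ℤ)) N, ‖∑ m ∈ Ms, eC (x m * j)‖ ^ 2 ≤
      ∑ m₁ ∈ Ms, ∑ m₂ ∈ Ms, (mn (2 * N : ℕ) (x m₁ - x m₂)) ^ 2 := by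
  refine (lag_sum N (fun j => ‖∑ m ∈ Ms, eC (x m * j)‖ ^ 2) (fun _ => by positivity)).trans ?_
  have e : ∑ k ∈ Finset.range (2 * N), ∑ k' ∈ Finset.range (2 * N), ‖∑ m ∈ Ms, eC (x m * (((k : ℤ) - k' : ℤ) : ℝ))‖ ^ 2
      = ∑ m₁ ∈ Ms, ∑ m₂ ∈ Ms, ‖∑ k ∈ Finset.range (2 * N), eC ((x m₁ - x m₂) * k)‖ ^ 2 := by
    have : ∀ a b : ℝ, (a : ℂ) = b → a = b := fun a b h => by exact_mod_cast h
    apply this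
    rw [Complex.ofReal_sum, Complex.ofReal_sum]
    simp_rw [Complex.ofReal_sum, normSq_sum_eC]
    rw [sum4_comm]
    apply Finset.sum_congr rfl
    intro m _
    apply Finset.sum_congr rfl
    intro m' _
    apply Finset.sum_congr rfl
    intro k _
    apply Finset.sum_congr rfl
    intro k' _
    congr 1
    push_cast
    ring
  rw [e]
  apply Finset.sum_le_sum
  intro m₁ _
  apply Finset.sum_le_sum
  intro m₂ _
  gcongr
  exact geom_range_le _ _

/-- dyadic majorant -/
lemma mn_dyadic (L y P : ℝ) (hL : 0 ≤ L) (hP : 0 < P) (K : ℕ) :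
    mn L y ^ 2 ≤ L ^ 2 * (if dn y ≤ 1 / P then 1 else 0) +
      ∑ i ∈ Finset.range K, (P / (2 * 4 ^ i)) ^ 2 * (if dn y ≤ 4 ^ (i + 1) / P then 1 else 0) +
      (P / (2 * 4 ^ K)) ^ 2 := by
  have h0 := mn_nonneg L y hL
  have hm := mn_mul_le L y
  by_cases h1 : dn y ≤ 1 / P
  · rw [if_pos h1]
    have a1 : mn L y ^ 2 ≤ L ^ 2 := by gcongr; exact mn_le L y
    have a2 : 0 ≤ ∑ i ∈ Finset.range K, (P / (2 * 4 ^ i)) ^ 2 * (if dn y ≤ 4 ^ (i + 1) / P then (1:ℝ) else 0) :=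
      Finset.sum_nonneg (fun i _ => by split_ifs <;> positivity)
    have a3 : 0 ≤ (P / (2 * 4 ^ K)) ^ 2 := by positivity
    linarith
  · rw [if_neg h1, mul_zero, zero_add]
    push Not at h1
    have hgen : ∀ j : ℕ, 4 ^ j / P < dn y → mn L y ^ 2 ≤ (P / (2 * 4 ^ j)) ^ 2 := by
      intro j hj
      gcongr
      rw [le_div_iff₀ (by positivity)]
      rw [div_lt_iff₀ hP] at hj
      have h4 : (0 : ℝ) < 4 ^ j := by positivity
      have : mn L y * (2 * 4 ^ j) ≤ mn L y * (2 * (dn y * P)) := by gcongr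
      calc _ ≤ _ := this
        _ = mn L y * (2 * dn y) * P := by ring
        _ ≤ 1 * P := by gcongr
        _ = P := one_mul P
    induction K with
    | zero =>
      simp only [Finset.range_zero, Finset.sum_empty, zero_add]
      exact hgen 0 (by simpa using h1)
    | succ K ih =>
      by_cases h2 : dn y ≤ 4 ^ (K + 1) / P
      · rw [Finset.sum_range_succ, if_pos h2, mul_one]
        have : 0 ≤ (P / (2 * 4 ^ (K + 1))) ^ 2 := by positivity
        linarith
      · push Not at h2
        have := hgen (K + 1) h2
        have a2 : 0 ≤ ∑ i ∈ Finset.range (K + 1), (P / (2 * 4 ^ i)) ^ 2 * (if dn y ≤ 4 ^ (i + 1) / P then (1:ℝ) else 0) :=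
          Finset.sum_nonneg (fun i _ => by split_ifs <;> positivity)
        linarith

namespace Par
variable {P M H Q X1 W : ℝ}

lemma log_count (p : Par P M H Q X1 W) (x : ℝ) (hx : 1 ≤ x) (hxP : x ≤ P ^ 20) (k : ℕ) (hk : (2 : ℝ) ^ k ≤ x) :
    (k : ℝ) + 1 ≤ 2 * W := by
  have h1 := p.hlog x hx hxP
  have h2 : Real.log (2 ^ k) ≤ Real.log x := Real.log_le_log (by positivity) hk
  rw [Real.log_pow] at h2
  have h3 := Real.log_two_gt_d9
  have h4 : (0 : ℝ) ≤ k := by positivity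
  have h5 := p.hW
  nlinarith

lemma PleP20 (p : Par P M H Q X1 W) : P ≤ P ^ 20 := le_self_pow₀ (by have := p.hP; linarith) (by norm_num)

/-- all `h` -/
lemma blocks (p : Par P M H Q X1 W) (α v : ℝ) (Y : ℕ)
    (hY : (Y : ℝ) ≤ M * W) (hY1 : 1 ≤ Y) (hv : 1 ≤ v) (hvM : v ^ 4 ≤ 16 * M)
    (hα : ∀ (q : ℕ) (a : ℤ), 1 ≤ q → (q : ℝ) ≤ X1 → X1 / Q ^ 4 < |q * α - a|)
    (T : Finset (ℕ × ℕ × ℕ)) (hT : ∀ t ∈ T, 1 ≤ t.1 ∧ (t.1 : ℝ) ≤ H ∧ M ≤ t.2.2 ∧ t.2.2 < t.2.1 ∧ t.2.1 ≤ Y ∧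
      dn (α * ((t.1 ^ 3 * (t.2.1 ^ 8 - t.2.2 ^ 8) : ℕ) : ℝ)) ≤ v ^ 2 / P) :
    (T.card : ℝ) ≤ 200 * W ^ 14 * (H * M * v ^ 4) := by
  have hH := p.hH
  have hfl : ⌊H⌋₊ ≠ 0 := by
    have := Nat.floor_pos.mpr hH; omega
  have hmaps : ∀ t ∈ T, Nat.log 2 t.1 ∈ Finset.range (Nat.log 2 ⌊H⌋₊ + 1) := by
    intro t ht
    rw [Finset.mem_range, Nat.lt_succ_iff]
    exact Nat.log_mono_right (Nat.le_floor (hT t ht).2.1)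
  rw [Finset.card_eq_sum_card_fiberwise hmaps]
  push_cast
  have hcount : ((Nat.log 2 ⌊H⌋₊ : ℕ) : ℝ) + 1 ≤ 2 * W := by
    apply p.log_count H hH (p.HleP.trans p.PleP20)
    have := Nat.pow_log_le_self 2 hfl
    calc (2 : ℝ) ^ (Nat.log 2 ⌊H⌋₊) = ((2 ^ (Nat.log 2 ⌊H⌋₊) : ℕ) : ℝ) := by push_cast; ring
      _ ≤ (⌊H⌋₊ : ℝ) := by exact_mod_cast this
      _ ≤ H := Nat.floor_le (by linarith)
  have hM := p.hM
  have hW := p.hW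
  calc _ ≤ ∑ i ∈ Finset.range (Nat.log 2 ⌊H⌋₊ + 1), 100 * W ^ 13 * (H * M * v ^ 4) := by
        apply Finset.sum_le_sum
        intro i hi
        rw [Finset.mem_range, Nat.lt_succ_iff] at hi
        apply p.block α v (2 ^ i) Y Nat.one_le_two_pow _ hY hY1 hv hvM hα
        · intro t ht
          obtain ⟨ht, hti⟩ := Finset.mem_filter.mp ht
          obtain ⟨e1, e2, e3⟩ := hT t ht
          refine ⟨?_, ?_, e3⟩
          · rw [← hti]; exact Nat.pow_log_le_self 2 (by omega)
          · have := Nat.lt_pow_succ_log_self (b := 2) (by norm_num) t.1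
            rw [← hti]; rw [pow_succ] at this; omega
        · calc ((2 ^ i : ℕ) : ℝ) ≤ ((2 ^ (Nat.log 2 ⌊H⌋₊) : ℕ) : ℝ) := by
                exact_mod_cast Nat.pow_le_pow_right (by norm_num) hi
            _ ≤ (⌊H⌋₊ : ℝ) := by exact_mod_cast Nat.pow_log_le_self 2 hfl
            _ ≤ H := Nat.floor_le (by linarith)
    _ = (((Nat.log 2 ⌊H⌋₊ : ℕ) : ℝ) + 1) * (100 * W ^ 13 * (H * M * v ^ 4)) := by simp
    _ ≤ 2 * W * (100 * W ^ 13 * (H * M * v ^ 4)) := by gcongr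
    _ = _ := by ring

lemma blocks_sym (p : Par P M H Q X1 W) (α v : ℝ) (Y : ℕ)
    (hY : (Y : ℝ) ≤ M * W) (hY1 : 1 ≤ Y) (hv : 1 ≤ v) (hvM : v ^ 4 ≤ 16 * M)
    (hα : ∀ (q : ℕ) (a : ℤ), 1 ≤ q → (q : ℝ) ≤ X1 → X1 / Q ^ 4 < |q * α - a|)
    (T : Finset (ℕ × ℕ × ℕ)) (hT : ∀ t ∈ T, 1 ≤ t.1 ∧ (t.1 : ℝ) ≤ H ∧ (M ≤ t.2.1 ∧ t.2.1 ≤ Y) ∧ (M ≤ t.2.2 ∧ t.2.2 ≤ Y) ∧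
      t.2.1 ≠ t.2.2 ∧ dn (α * (t.1 : ℝ) ^ 3 * (t.2.1 : ℝ) ^ 8 - α * (t.1 : ℝ) ^ 3 * (t.2.2 : ℝ) ^ 8) ≤ v ^ 2 / P) :
    (T.card : ℝ) ≤ 400 * W ^ 14 * (H * M * v ^ 4) := by
  have hcast : ∀ h a b : ℕ, b < a → α * ((h ^ 3 * (a ^ 8 - b ^ 8) : ℕ) : ℝ) = α * (h : ℝ) ^ 3 * (a : ℝ) ^ 8 - α * (h : ℝ) ^ 3 * (b : ℝ) ^ 8 := by
    intro h a b hab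
    rw [Nat.cast_mul, Nat.cast_sub (Nat.pow_le_pow_left hab.le 8)]
    push_cast; ring
  have h1 := p.blocks α v Y hY hY1 hv hvM hα (T.filter (fun t => t.2.2 < t.2.1)) (by
    intro t ht
    obtain ⟨ht, hlt⟩ := Finset.mem_filter.mp ht
    obtain ⟨e1, e2, e3, e4, e5, e6⟩ := hT t ht
    refine ⟨e1, e2, e4.1, hlt, e3.2, ?_⟩
    rw [hcast _ _ _ hlt]; exact e6)
  have h2 := p.blocks α v Y hY hY1 hv hvM hα ((T.filter (fun t => ¬ t.2.2 < t.2.1)).image (fun t => (t.1, t.2.2, t.2.1))) (by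
    intro t' ht'
    obtain ⟨t, ht, rfl⟩ := Finset.mem_image.mp ht'
    obtain ⟨ht, hlt⟩ := Finset.mem_filter.mp ht
    obtain ⟨e1, e2, e3, e4, e5, e6⟩ := hT t ht
    have hlt' : t.2.1 < t.2.2 := by omega
    refine ⟨e1, e2, e3.1, hlt', e4.2, ?_⟩
    simp only
    rw [hcast _ _ _ hlt', ← dn_neg, neg_sub]; exact e6)
  rw [Finset.card_image_of_injective] at h2
  · have h3 := Finset.card_filter_add_card_filter_not (s := T) (fun t => t.2.2 < t.2.1)
    rw [← h3]
    push_cast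
    linarith
  · rintro ⟨a, b, c⟩ ⟨a', b', c'⟩ h
    simp only [Prod.mk.injEq] at h ⊢
    tauto

end Par


namespace Par
variable {P M H Q X1 W : ℝ}

lemma exists_K (p : Par P M H Q X1 W) : ∃ K : ℕ, M ≤ 16 ^ K ∧ (∀ i < K, (16 : ℝ) ^ i ≤ M) ∧ (K : ℝ) ≤ 2 * W := by
  have hex : ∃ k : ℕ, M ≤ 16 ^ k := by
    obtain ⟨k, hk⟩ := pow_unbounded_of_one_lt M (show (1 : ℝ) < 16 by norm_num)
    exact ⟨k, hk.le⟩
  have hlt : ∀ i < Nat.find hex, (16 : ℝ) ^ i ≤ M := by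
    intro i hi
    have := Nat.find_min hex hi
    push Not at this
    exact this.le
  refine ⟨Nat.find hex, Nat.find_spec hex, hlt, ?_⟩
  have hW := p.hW
  rcases Nat.eq_zero_or_pos (Nat.find hex) with h | h
  · rw [h]; push_cast; linarith
  · obtain ⟨k, hk⟩ : ∃ k, Nat.find hex = k + 1 := ⟨Nat.find hex - 1, by omega⟩
    have h1 := hlt k (by omega)
    rw [hk]
    push_cast
    apply p.log_count M p.hM (p.MleP.trans p.PleP20)
    refine le_trans ?_ h1
    gcongr
    norm_num

lemma E_bound (p : Par P M H Q X1 W) (α : ℝ) (Y : ℕ) (hY : (Y : ℝ) ≤ M * W) (hY1 : 1 ≤ Y)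
    (Ms : Finset ℕ) (hMs : ∀ m ∈ Ms, M ≤ m ∧ m ≤ Y) (Hn : ℕ) (hHn : (Hn : ℝ) ≤ H) (N : ℕ)
    (hN1 : P ≤ N) (hN2 : (N : ℝ) ≤ 2 * P)
    (hα : ∀ (q : ℕ) (a : ℤ), 1 ≤ q → (q : ℝ) ≤ X1 → X1 / Q ^ 4 < |q * α - a|) :
    ∑ h ∈ Finset.Icc 1 Hn, ∑ j ∈ Finset.Ioo (-(N : ℤ)) N, ‖∑ m ∈ Ms, eC (α * (h : ℝ) ^ 3 * (m : ℝ) ^ 8 * j)‖ ^ 2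
      ≤ 20000 * W ^ 15 * (H * M * P) := by
  have hP := p.hP
  have hM := p.hM
  have hH := p.hH
  have hW := p.hW
  obtain ⟨K, hK1, hK2, hK3⟩ := p.exists_K
  have hP0 : 0 < P := by linarith
  have hN0 : (0 : ℝ) < N := by linarith
  set x : ℕ → ℕ → ℝ := fun h m => α * (h : ℝ) ^ 3 * (m : ℝ) ^ 8 with hx
  set A := Finset.Icc 1 Hn ×ˢ (Ms ×ˢ Ms) with hA
  have step1 : N * ∑ h ∈ Finset.Icc 1 Hn, ∑ j ∈ Finset.Ioo (-(N : ℤ)) N, ‖∑ m ∈ Ms, eC (α * (h : ℝ) ^ 3 * (m : ℝ) ^ 8 * j)‖ ^ 2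
      ≤ ∑ t ∈ A, (mn (2 * N : ℕ) (x t.1 t.2.1 - x t.1 t.2.2)) ^ 2 := by
    rw [hA, Finset.sum_product, Finset.mul_sum]
    apply Finset.sum_le_sum
    intro h _
    rw [Finset.sum_product]
    exact lag_dual N Ms (x h)
  have hMsY : (Ms.card : ℝ) ≤ Y := by
    have : Ms ⊆ Finset.Icc 1 Y := by
      intro m hm
      have := hMs m hm
      rw [Finset.mem_Icc]
      refine ⟨?_, this.2⟩
      have h1 : (1 : ℝ) ≤ m := hM.trans this.1
      exact_mod_cast h1
    have := Finset.card_le_card this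
    rw [Nat.card_Icc, Nat.add_sub_cancel] at this
    exact_mod_cast this
  have hAcard : (A.card : ℝ) ≤ H * (M * W) ^ 2 := by
    rw [hA, Finset.card_product, Finset.card_product, Nat.card_Icc, Nat.add_sub_cancel]
    push_cast
    calc (Hn : ℝ) * (Ms.card * Ms.card) ≤ H * ((M * W) * (M * W)) := by
          gcongr <;> linarith
      _ = _ := by ring
  have h2N : ((2 * N : ℕ) : ℝ) ≤ 4 * P := by push_cast; linarith
  have hdiag : ∑ t ∈ A.filter (fun t => t.2.1 = t.2.2), (mn (2 * N : ℕ) (x t.1 t.2.1 - x t.1 t.2.2)) ^ 2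
      ≤ 16 * W ^ 15 * (H * M * P ^ 2) := by
    have hc : ((A.filter (fun t => t.2.1 = t.2.2)).card : ℝ) ≤ H * (M * W) := by
      have : (A.filter (fun t => t.2.1 = t.2.2)).card ≤ (Finset.Icc 1 Hn ×ˢ Ms).card := by
        apply Finset.card_le_card_of_injOn (fun t => (t.1, t.2.1))
        · intro t ht
          have := (Finset.mem_filter.mp (Finset.mem_coe.mp ht)).1
          simp only [hA, Finset.mem_product] at this
          simp only [Finset.coe_product, Set.mem_prod, Finset.mem_coe]
          exact ⟨this.1, this.2.1⟩
        · rintro ⟨a, b, c⟩ ht ⟨a', b', c'⟩ ht' h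
          have h1 := (Finset.mem_filter.mp (Finset.mem_coe.mp ht)).2
          have h2 := (Finset.mem_filter.mp (Finset.mem_coe.mp ht')).2
          simp only [Prod.mk.injEq] at h h1 h2 ⊢
          exact ⟨h.1, h.2, by omega⟩
      rw [Finset.card_product, Nat.card_Icc, Nat.add_sub_cancel] at this
      calc _ ≤ ((Hn * Ms.card : ℕ) : ℝ) := by exact_mod_cast this
        _ = Hn * (Ms.card : ℝ) := by push_cast; ring
        _ ≤ _ := by gcongr; linarith
    calc _ ≤ ∑ t ∈ A.filter (fun t => t.2.1 = t.2.2), (4 * P) ^ 2 := by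
          apply Finset.sum_le_sum
          intro t _
          have h0 := mn_nonneg ((2 * N : ℕ) : ℝ) (x t.1 t.2.1 - x t.1 t.2.2) (by positivity)
          gcongr
          exact (mn_le _ _).trans h2N
      _ = (A.filter (fun t => t.2.1 = t.2.2)).card * (4 * P) ^ 2 := by simp
      _ ≤ H * (M * W) * (4 * P) ^ 2 := by gcongr
      _ = 16 * W ^ 1 * (H * M * P ^ 2) := by ring
      _ ≤ _ := by
          gcongr ?_ * ?_ * _
          exact pow_le_pow_right₀ hW (by norm_num)
  set A' := A.filter (fun t => ¬ t.2.1 = t.2.2) with hA'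
  have hcnt : ∀ v : ℝ, 1 ≤ v → v ^ 4 ≤ 16 * M →
      ((A'.filter (fun t => dn (x t.1 t.2.1 - x t.1 t.2.2) ≤ v ^ 2 / P)).card : ℝ) ≤ 400 * W ^ 14 * (H * M * v ^ 4) := by
    intro v hv hvM
    apply p.blocks_sym α v Y hY hY1 hv hvM hα
    intro t ht
    obtain ⟨ht, hd⟩ := Finset.mem_filter.mp ht
    obtain ⟨ht, hne⟩ := Finset.mem_filter.mp ht
    simp only [hA, Finset.mem_product, Finset.mem_Icc] at ht
    refine ⟨ht.1.1, ?_, hMs _ ht.2.1, hMs _ ht.2.2, hne, hd⟩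
    exact le_trans (by exact_mod_cast ht.1.2) hHn
  have hoff : ∑ t ∈ A', (mn (2 * N : ℕ) (x t.1 t.2.1 - x t.1 t.2.2)) ^ 2
      ≤ 6400 * W ^ 15 * (H * M * P ^ 2) + 3200 * W ^ 15 * (H * M * P ^ 2) + W ^ 15 * (H * M * P ^ 2) := by
    calc _ ≤ ∑ t ∈ A', ((((2 * N : ℕ) : ℝ)) ^ 2 * (if dn (x t.1 t.2.1 - x t.1 t.2.2) ≤ 1 / P then 1 else 0) +
          ∑ i ∈ Finset.range K, (P / (2 * 4 ^ i)) ^ 2 * (if dn (x t.1 t.2.1 - x t.1 t.2.2) ≤ 4 ^ (i + 1) / P then 1 else 0) +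
          (P / (2 * 4 ^ K)) ^ 2) := by
          apply Finset.sum_le_sum
          intro t _
          exact mn_dyadic _ _ P (by positivity) hP0 K
      _ = (((2 * N : ℕ) : ℝ)) ^ 2 * ((A'.filter (fun t => dn (x t.1 t.2.1 - x t.1 t.2.2) ≤ 1 / P)).card : ℝ)
          + ∑ i ∈ Finset.range K, (P / (2 * 4 ^ i)) ^ 2 *
            ((A'.filter (fun t => dn (x t.1 t.2.1 - x t.1 t.2.2) ≤ 4 ^ (i + 1) / P)).card : ℝ)
          + A'.card * (P / (2 * 4 ^ K)) ^ 2 := by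
          rw [Finset.sum_add_distrib, Finset.sum_add_distrib, Finset.sum_comm]
          simp_rw [← Finset.mul_sum]
          simp
      _ ≤ _ := by
          have q1 : (((2 * N : ℕ) : ℝ)) ^ 2 * ((A'.filter (fun t => dn (x t.1 t.2.1 - x t.1 t.2.2) ≤ 1 / P)).card : ℝ)
              ≤ 6400 * W ^ 15 * (H * M * P ^ 2) := by
            have h1 := hcnt 1 le_rfl (by linarith)
            rw [one_pow, one_pow] at h1
            calc _ ≤ (4 * P) ^ 2 * (400 * W ^ 14 * (H * M * 1)) := by gcongr
              _ = 6400 * W ^ 14 * (H * M * P ^ 2) := by ring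
              _ ≤ _ := by
                  gcongr ?_ * ?_ * _
                  exact pow_le_pow_right₀ hW (by norm_num)
          have q2 : ∑ i ∈ Finset.range K, (P / (2 * 4 ^ i)) ^ 2 *
            ((A'.filter (fun t => dn (x t.1 t.2.1 - x t.1 t.2.2) ≤ 4 ^ (i + 1) / P)).card : ℝ)
              ≤ 3200 * W ^ 15 * (H * M * P ^ 2) := by
            calc _ ≤ ∑ i ∈ Finset.range K, 1600 * W ^ 14 * (H * M * P ^ 2) := by
                  apply Finset.sum_le_sum
                  intro i hi
                  rw [Finset.mem_range] at hi
                  have h16 : (16 : ℝ) ^ i = (2 ^ i) ^ 4 := by rw [← pow_mul, mul_comm, pow_mul]; norm_num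
                  have h4 : (4 : ℝ) ^ i = (2 ^ i) ^ 2 := by rw [← pow_mul, mul_comm, pow_mul]; norm_num
                  have h2i : (0 : ℝ) < 2 ^ i := by positivity
                  have h1 := hcnt (2 ^ (i + 1)) (one_le_pow₀ (by norm_num)) (by
                    have := hK2 i hi
                    calc ((2 : ℝ) ^ (i + 1)) ^ 4 = 16 * 16 ^ i := by rw [h16]; ring
                      _ ≤ _ := by gcongr)
                  have e4 : ((2 : ℝ) ^ (i + 1)) ^ 2 = 4 ^ (i + 1) := by rw [← pow_mul, mul_comm, pow_mul]; norm_num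
                  rw [e4] at h1
                  calc _ ≤ (P / (2 * 4 ^ i)) ^ 2 * (400 * W ^ 14 * (H * M * (2 ^ (i + 1)) ^ 4)) := by gcongr
                    _ = _ := by rw [h4]; field_simp; ring
              _ = K * (1600 * W ^ 14 * (H * M * P ^ 2)) := by simp
              _ ≤ (2 * W) * (1600 * W ^ 14 * (H * M * P ^ 2)) := by gcongr
              _ = _ := by ring
          have q3 : A'.card * (P / (2 * 4 ^ K)) ^ 2 ≤ W ^ 15 * (H * M * P ^ 2) := by
            have h4 : ((4 : ℝ) ^ K) ^ 2 = 16 ^ K := by rw [← pow_mul, mul_comm, pow_mul]; norm_num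
            have e1 : (P / (2 * 4 ^ K)) ^ 2 ≤ P ^ 2 / M := by
              rw [div_pow, mul_pow, h4]
              gcongr
              linarith
            have e2 : (A'.card : ℝ) ≤ H * (M * W) ^ 2 := by
              refine le_trans ?_ hAcard
              exact_mod_cast Finset.card_le_card (Finset.filter_subset _ _)
            calc _ ≤ H * (M * W) ^ 2 * (P ^ 2 / M) := by gcongr
              _ = W ^ 2 * (H * M * P ^ 2) := by field_simp
              _ ≤ _ := by
                  gcongr ?_ * _
                  exact pow_le_pow_right₀ hW (by norm_num)
          linarith
  have htot : N * ∑ h ∈ Finset.Icc 1 Hn, ∑ j ∈ Finset.Ioo (-(N : ℤ)) N, ‖∑ m ∈ Ms, eC (α * (h : ℝ) ^ 3 * (m : ℝ) ^ 8 * j)‖ ^ 2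
      ≤ 20000 * W ^ 15 * (H * M * P ^ 2) := by
    refine step1.trans ?_
    rw [← Finset.sum_filter_add_sum_filter_not A (fun t => t.2.1 = t.2.2)]
    have : 0 ≤ W ^ 15 * (H * M * P ^ 2) := by positivity
    linarith
  set S := ∑ h ∈ Finset.Icc 1 Hn, ∑ j ∈ Finset.Ioo (-(N : ℤ)) N, ‖∑ m ∈ Ms, eC (α * (h : ℝ) ^ 3 * (m : ℝ) ^ 8 * j)‖ ^ 2
  have hS0 : 0 ≤ S := Finset.sum_nonneg (fun _ _ => Finset.sum_nonneg (fun _ _ => by positivity))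
  refine le_of_mul_le_mul_right ?_ hP0
  calc S * P ≤ N * S := by rw [mul_comm]; gcongr
    _ ≤ _ := htot
    _ = _ := by ring

end Par


lemma lag_reindex (a b N : ℤ) (hN : b - a ≤ N) (F : ℤ → ℤ → ℂ) :
    ∑ x ∈ Finset.Ico a b, ∑ y ∈ Finset.Ico a b, F x y =
      ∑ l ∈ Finset.Ioo (-N) N, ∑ z ∈ Finset.Ico (max a (a - l)) (min b (b - l)), F (z + l) z := by
  rw [← Finset.sum_product', Finset.sum_sigma']
  refine Finset.sum_bij' (fun t _ => ⟨t.1 - t.2, t.2⟩) (fun t _ => (t.2 + t.1, t.2)) ?_ ?_ ?_ ?_ ?_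
  · rintro ⟨x, y⟩ h
    simp only [Finset.mem_product, Finset.mem_Ico, Finset.mem_sigma, Finset.mem_Ioo] at h ⊢
    omega
  · rintro ⟨x, y⟩ h
    simp only [Finset.mem_product, Finset.mem_Ico, Finset.mem_sigma, Finset.mem_Ioo] at h ⊢
    omega
  · rintro ⟨x, y⟩ h
    simp
  · rintro ⟨x, y⟩ h
    simp
  · rintro ⟨x, y⟩ h
    simp

lemma even_sum (N : ℕ) (f : ℤ → ℝ) (h0 : ∀ j, 0 ≤ f j) (he : ∀ j, f (-j) = f j) :
    ∑ j ∈ Finset.Ioo (-(N : ℤ)) N, f j ≤ f 0 + 2 * ∑ j ∈ Finset.Icc 1 N, f (j : ℕ) := by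
  have h1 : Finset.Ioo (-(N : ℤ)) N ⊆ insert 0 ((Finset.Icc 1 N).image (fun j : ℕ => (j : ℤ)) ∪
      (Finset.Icc 1 N).image (fun j : ℕ => -(j : ℤ))) := by
    intro j hj
    simp only [Finset.mem_Ioo, Finset.mem_insert, Finset.mem_union, Finset.mem_image, Finset.mem_Icc] at hj ⊢
    rcases lt_trichotomy j 0 with h | h | h
    · right; right; exact ⟨j.natAbs, by omega, by omega⟩
    · left; exact h
    · right; left; exact ⟨j.natAbs, by omega, by omega⟩
  refine (Finset.sum_le_sum_of_subset_of_nonneg h1 (fun i _ _ => h0 i)).trans ?_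
  have h2 : ∀ s : Finset ℤ, ∑ j ∈ insert 0 s, f j ≤ f 0 + ∑ j ∈ s, f j := by
    intro s
    by_cases h : (0 : ℤ) ∈ s
    · rw [Finset.insert_eq_of_mem h]; linarith [h0 0]
    · rw [Finset.sum_insert h]
  refine (h2 _).trans ?_
  have h3 : ∀ s t : Finset ℤ, ∑ j ∈ s ∪ t, f j ≤ ∑ j ∈ s, f j + ∑ j ∈ t, f j := by
    intro s t
    rw [← Finset.sum_union_inter]
    linarith [Finset.sum_nonneg (s := s ∩ t) (fun i _ => h0 i)]
  have h4 := h3 ((Finset.Icc 1 N).image (fun j : ℕ => (j : ℤ))) ((Finset.Icc 1 N).image (fun j : ℕ => -(j : ℤ)))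
  rw [Finset.sum_image (by intro a _ b _ h; simpa using h),
    Finset.sum_image (by intro a _ b _ h; simpa using h)] at h4
  simp only [he] at h4
  linarith

/-- the differenced sum -/
noncomputable def Adif (N : ℕ) (y : ℝ) (j : ℤ) : ℂ :=
  ∑ z ∈ Finset.Ico (max (1 : ℤ) (1 - j)) (min ((N : ℤ) + 1) ((N : ℤ) + 1 - j)),
    eC (y * (((z : ℝ) + j) ^ 3 - (z : ℝ) ^ 3))

/-- the cubic sum -/
noncomputable def Phi (N : ℕ) (α : ℝ) (h m : ℕ) : ℂ :=
  ∑ z ∈ Finset.Icc 1 N, eC (α * ((h * z ^ 3 + h ^ 3 * m ^ 8 * z : ℕ) : ℝ))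

lemma Phi_eq (N : ℕ) (α : ℝ) (h m : ℕ) :
    Phi N α h m = ∑ z ∈ Finset.Ico (1 : ℤ) (N + 1), eC (α * h * (z : ℝ) ^ 3 + α * (h : ℝ) ^ 3 * (m : ℝ) ^ 8 * z) := by
  unfold Phi
  refine Finset.sum_bij' (fun z _ => (z : ℤ)) (fun z _ => z.natAbs) ?_ ?_ ?_ ?_ ?_
  · intro z hz; simp only [Finset.mem_Icc, Finset.mem_Ico] at hz ⊢; omega
  · intro z hz; simp only [Finset.mem_Icc, Finset.mem_Ico] at hz ⊢; omega
  · intro z hz; simp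
  · intro z hz; simp only [Finset.mem_Ico] at hz; omega
  · intro z hz; congr 1; push_cast; ring

lemma Phi_sq (N : ℕ) (α : ℝ) (h m : ℕ) :
    ((‖Phi N α h m‖ ^ 2 : ℝ) : ℂ) = ∑ j ∈ Finset.Ioo (-(N : ℤ)) N,
      Adif N (α * h) j * eC (α * (h : ℝ) ^ 3 * (m : ℝ) ^ 8 * j) := by
  rw [Phi_eq, normSq_sum_eC, lag_reindex 1 (N + 1) N (by omega)]
  apply Finset.sum_congr rfl
  intro j _
  unfold Adif
  rw [Finset.sum_mul]
  apply Finset.sum_congr rfl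
  intro z _
  rw [← eC_add]
  congr 1; push_cast; ring

lemma Adif_sq (N : ℕ) (y : ℝ) (j : ℤ) :
    ‖Adif N y j‖ ^ 2 ≤ ∑ l ∈ Finset.Ioo (-(N : ℤ)) N, mn N (6 * y * j * l) := by
  have h1 := normSq_sum_eC (Finset.Ico (max (1 : ℤ) (1 - j)) (min ((N : ℤ) + 1) ((N : ℤ) + 1 - j)))
    (fun z => y * (((z : ℝ) + j) ^ 3 - (z : ℝ) ^ 3))
  rw [lag_reindex _ _ (N : ℤ) (by omega)] at h1
  have h2 : ‖Adif N y j‖ ^ 2 = ‖((‖Adif N y j‖ ^ 2 : ℝ) : ℂ)‖ := by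
    rw [Complex.norm_real, Real.norm_of_nonneg (by positivity)]
  rw [h2]
  unfold Adif
  rw [h1]
  refine (norm_sum_le _ _).trans (Finset.sum_le_sum ?_)
  intro l hl
  apply le_mn
  · refine (norm_sum_le _ _).trans ?_
    simp only [norm_eC, Finset.sum_const, nsmul_eq_mul, mul_one, Int.card_Ico]
    have : (min (min ((N : ℤ) + 1) ((N : ℤ) + 1 - j)) (min ((N : ℤ) + 1) ((N : ℤ) + 1 - j) - l) -
      max (max (1 : ℤ) (1 - j)) (max (1 : ℤ) (1 - j) - l)).toNat ≤ N := by omega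
    exact_mod_cast this
  · refine le_trans (le_of_eq ?_) (geom_sum_bound (6 * y * j * l)
      (y * (3 * j * l ^ 2 + 3 * j ^ 2 * l)) (max (max (1 : ℤ) (1 - j)) (max (1 : ℤ) (1 - j) - l))
      (min (min ((N : ℤ) + 1) ((N : ℤ) + 1 - j)) (min ((N : ℤ) + 1) ((N : ℤ) + 1 - j) - l)))
    congr 2
    apply Finset.sum_congr rfl
    intro z _
    congr 1; push_cast; ring

namespace Par
variable {P M H Q X1 W : ℝ}

lemma HP3 (p : Par P M H Q X1 W) : H * P ^ 3 = Q ^ 4 := by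
  have h1 := p.eQ; have h2 := p.eH; have hM := p.hM
  have : M ^ 4 * (H * P ^ 3) = M ^ 4 * Q ^ 4 := by
    calc M ^ 4 * (H * P ^ 3) = (H * M ^ 4) * P ^ 3 := by ring
      _ = (M * Q) ^ 4 := by rw [h2, h1]; ring
      _ = _ := by ring
  exact mul_left_cancel₀ (by positivity) this

lemma X1M (p : Par P M H Q X1 W) : X1 * M = H ^ 4 := by
  have h1 := p.HP3; have h2 := p.eH; have hM := p.hM; have h3 := p.eX
  have : M ^ 12 * (X1 * M) = M ^ 12 * H ^ 4 := by
    calc M ^ 12 * (X1 * M) = X1 * M ^ 13 := by ring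
      _ = H * (H * M ^ 4) ^ 3 := by rw [h3, h2, h1]
      _ = _ := by ring
  exact mul_left_cancel₀ (by positivity) this

lemma triple_count (p : Par P M H Q X1 W) (Hn N : ℕ) (hHn : (Hn : ℝ) ≤ H) (hN2 : (N : ℝ) ≤ 2 * P)
    (f : ℕ → ℝ) (hf : ∀ n, 0 ≤ f n) :
    ∑ h ∈ Finset.Icc 1 Hn, ∑ j ∈ Finset.Icc 1 N, ∑ l ∈ Finset.Icc 1 N, f (6 * h * j * l) ≤
      W ^ 2 * ∑ n ∈ Finset.range (6 * Hn * N * N + 1), f n := by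
  set T := Finset.Icc 1 Hn ×ˢ Finset.Icc 1 N ×ˢ Finset.Icc 1 N with hT
  have e1 : ∑ h ∈ Finset.Icc 1 Hn, ∑ j ∈ Finset.Icc 1 N, ∑ l ∈ Finset.Icc 1 N, f (6 * h * j * l) =
      ∑ t ∈ T, f (6 * t.1 * t.2.1 * t.2.2) := by
    rw [hT, Finset.sum_product]
    apply Finset.sum_congr rfl; intro h _
    rw [Finset.sum_product]
  have hmap : ∀ t ∈ T, 6 * t.1 * t.2.1 * t.2.2 ∈ Finset.range (6 * Hn * N * N + 1) := by
    rintro ⟨h, j, l⟩ ht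
    simp only [hT, Finset.mem_product, Finset.mem_Icc] at ht
    rw [Finset.mem_range, Nat.lt_succ_iff]
    obtain ⟨⟨_, h1⟩, ⟨_, h2⟩, ⟨_, h3⟩⟩ := ht
    dsimp only
    gcongr
  rw [e1, ← Finset.sum_fiberwise_of_maps_to hmap, Finset.mul_sum]
  apply Finset.sum_le_sum
  intro n hn
  have e2 : ∑ t ∈ T with 6 * t.1 * t.2.1 * t.2.2 = n, f (6 * t.1 * t.2.1 * t.2.2) =
      ((T.filter (fun t => 6 * t.1 * t.2.1 * t.2.2 = n)).card : ℝ) * f n := by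
    rw [← nsmul_eq_mul, ← Finset.sum_const]
    apply Finset.sum_congr rfl
    intro t ht
    rw [(Finset.mem_filter.1 ht).2]
  rw [e2]
  apply mul_le_mul_of_nonneg_right _ (hf n)
  rcases Nat.eq_zero_or_pos n with h0 | hpos
  · have : T.filter (fun t => 6 * t.1 * t.2.1 * t.2.2 = n) = ∅ := by
      apply Finset.filter_eq_empty_iff.2
      rintro ⟨h, j, l⟩ ht
      simp only [hT, Finset.mem_product, Finset.mem_Icc] at ht
      obtain ⟨⟨a1, h1⟩, ⟨a2, h2⟩, ⟨a3, h3⟩⟩ := ht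
      dsimp only
      have : 0 < 6 * h * j * l := by positivity
      omega
    rw [this]; have := p.hW; simp; positivity
  · have hle : (T.filter (fun t => 6 * t.1 * t.2.1 * t.2.2 = n)).card ≤ (n.divisors ×ˢ n.divisors).card := by
      apply Finset.card_le_card_of_injOn (fun t => (t.1, t.2.1))
      · rintro ⟨h, j, l⟩ ht
        have ht2 := (Finset.mem_filter.1 ht).2
        simp only [Finset.coe_product, Set.mem_prod, Finset.mem_coe, Nat.mem_divisors] at ht2 ⊢
        refine ⟨⟨⟨6 * j * l, by rw [← ht2]; ring⟩, by omega⟩, ⟨⟨6 * h * l, by rw [← ht2]; ring⟩, by omega⟩⟩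
      · rintro ⟨h, j, l⟩ ht ⟨h', j', l'⟩ ht' heq
        have ht2 := (Finset.mem_filter.1 ht).2
        have ht2' := (Finset.mem_filter.1 ht').2
        simp only [Prod.mk.injEq] at ht2 ht2' heq ⊢
        obtain ⟨rfl, rfl⟩ := heq
        refine ⟨rfl, rfl, ?_⟩
        have hp : 0 < 6 * h * j := by
          by_contra hc
          have : 6 * h * j = 0 := by omega
          rw [this] at ht2; omega
        exact Nat.eq_of_mul_eq_mul_left hp (ht2.trans ht2'.symm)
    have hn' : (n : ℝ) ≤ P ^ 20 := by
      have h1 : (n : ℝ) ≤ 6 * Hn * N * N := by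
        rw [Finset.mem_range, Nat.lt_succ_iff] at hn
        exact_mod_cast hn
      have hP8 := p.hP8
      have hH := p.HleP
      calc (n : ℝ) ≤ 6 * Hn * N * N := h1
        _ ≤ 6 * P * (2 * P) * (2 * P) := by
            gcongr
            linarith
        _ = 24 * P ^ 3 := by ring
        _ ≤ P ^ 17 * P ^ 3 := by
            gcongr
            calc (24 : ℝ) ≤ 8 ^ 17 := by norm_num
              _ ≤ _ := by gcongr
        _ = _ := by ring
    have hd := p.hd n hpos hn'
    calc ((T.filter (fun t => 6 * t.1 * t.2.1 * t.2.2 = n)).card : ℝ)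
        ≤ ((n.divisors ×ˢ n.divisors).card : ℝ) := by exact_mod_cast hle
      _ = (n.divisors.card : ℝ) ^ 2 := by rw [Finset.card_product]; push_cast; ring
      _ ≤ _ := by gcongr

lemma D_pre (p : Par P M H Q X1 W) (α : ℝ) (Hn N : ℕ) (hHn : (Hn : ℝ) ≤ H) (hN2 : (N : ℝ) ≤ 2 * P) :
    ∑ h ∈ Finset.Icc 1 Hn, ∑ j ∈ Finset.Ioo (-(N : ℤ)) N, ‖Adif N (α * h) j‖ ^ 2 ≤
      Hn * (5 * N ^ 2) + 4 * W ^ 2 * ∑ n ∈ Finset.range (6 * Hn * N * N + 1), mn N (α * n) := by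
  have hN0 : (0 : ℝ) ≤ N := Nat.cast_nonneg _
  have key : ∀ h ∈ Finset.Icc 1 Hn, ∑ j ∈ Finset.Ioo (-(N : ℤ)) N, ‖Adif N (α * h) j‖ ^ 2 ≤
      5 * N ^ 2 + 4 * ∑ j ∈ Finset.Icc 1 N, ∑ l ∈ Finset.Icc 1 N, mn N (α * ((6 * h * j * l : ℕ) : ℝ)) := by
    intro h hh
    have hsym : ∀ x : ℝ, mn N (-x) = mn N x := fun x => by rw [← mn_abs, abs_neg, mn_abs]
    set G : ℤ → ℝ := fun j => ∑ l ∈ Finset.Ioo (-(N : ℤ)) N, mn N (6 * (α * h) * j * l) with hG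
    have h1 : ∑ j ∈ Finset.Ioo (-(N : ℤ)) N, ‖Adif N (α * h) j‖ ^ 2 ≤ ∑ j ∈ Finset.Ioo (-(N : ℤ)) N, G j :=
      Finset.sum_le_sum (fun j _ => Adif_sq N _ j)
    have h2 := even_sum N G (fun j => Finset.sum_nonneg (fun l _ => mn_nonneg _ _ hN0)) (by
      intro j
      apply Finset.sum_congr rfl
      intro l _
      rw [← hsym]; congr 1; push_cast; ring)
    have h3 : G 0 ≤ 2 * N * N := by
      calc G 0 ≤ ∑ l ∈ Finset.Ioo (-(N : ℤ)) N, (N : ℝ) := Finset.sum_le_sum (fun l _ => mn_le _ _)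
        _ = ((N - -(N : ℤ) - 1).toNat : ℝ) * N := by simp
        _ ≤ _ := by
            gcongr
            have : ((N - -(N : ℤ) - 1).toNat) ≤ 2 * N := by omega
            exact_mod_cast this
    have h4 : ∀ j : ℕ, G (j : ℕ) ≤ N + 2 * ∑ l ∈ Finset.Icc 1 N, mn N (α * ((6 * h * j * l : ℕ) : ℝ)) := by
      intro j
      have h5 := even_sum N (fun l => mn N (6 * (α * h) * ((j : ℕ) : ℤ) * l)) (fun l => mn_nonneg _ _ hN0) (by
        intro l
        show mn _ _ = mn _ _
        rw [← hsym]; congr 1; push_cast; ring)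
      have h6 : ∑ l ∈ Finset.Icc 1 N, mn N (6 * (α * h) * ((j : ℕ) : ℤ) * ((l : ℕ) : ℤ)) =
          ∑ l ∈ Finset.Icc 1 N, mn N (α * ((6 * h * j * l : ℕ) : ℝ)) := by
        apply Finset.sum_congr rfl
        intro l _
        congr 1; push_cast; ring
      have h7 : mn N (6 * (α * h) * ((j : ℕ) : ℤ) * ((0 : ℤ) : ℝ)) ≤ N := mn_le _ _
      simp only [hG]
      linarith
    have h8 : ∑ j ∈ Finset.Icc 1 N, G (j : ℕ) ≤ N * N + 2 * ∑ j ∈ Finset.Icc 1 N, ∑ l ∈ Finset.Icc 1 N, mn N (α * ((6 * h * j * l : ℕ) : ℝ)) := by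
      calc _ ≤ ∑ j ∈ Finset.Icc 1 N, (N + 2 * ∑ l ∈ Finset.Icc 1 N, mn N (α * ((6 * h * j * l : ℕ) : ℝ))) :=
            Finset.sum_le_sum (fun j _ => h4 j)
        _ = _ := by rw [Finset.sum_add_distrib, ← Finset.mul_sum]; simp
    nlinarith
  have h9 := p.triple_count Hn N hHn hN2 (fun n => mn N (α * n)) (fun n => mn_nonneg _ _ hN0)
  calc _ ≤ ∑ h ∈ Finset.Icc 1 Hn, (5 * (N : ℝ) ^ 2 + 4 * ∑ j ∈ Finset.Icc 1 N, ∑ l ∈ Finset.Icc 1 N, mn N (α * ((6 * h * j * l : ℕ) : ℝ))) :=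
        Finset.sum_le_sum key
    _ = Hn * (5 * N ^ 2) + 4 * ∑ h ∈ Finset.Icc 1 Hn, ∑ j ∈ Finset.Icc 1 N, ∑ l ∈ Finset.Icc 1 N, mn N (α * ((6 * h * j * l : ℕ) : ℝ)) := by
        rw [Finset.sum_add_distrib, Finset.mul_sum, Finset.sum_const, Nat.card_Icc, Nat.add_sub_cancel, nsmul_eq_mul]
    _ ≤ _ := by linarith

set_option maxHeartbeats 1000000 in
lemma D_bound (p : Par P M H Q X1 W) (α X : ℝ) (hX : 1 ≤ X) (hXP : X ≤ P) (Hn N : ℕ) (hHn : (Hn : ℝ) ≤ H)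
    (hN1 : P ≤ N) (hN2 : (N : ℝ) ≤ 2 * P)
    (hα : ∀ (q : ℕ) (a : ℤ), 1 ≤ q → (q : ℝ) ≤ X → X / Q ^ 4 < |q * α - a|) :
    ∑ h ∈ Finset.Icc 1 Hn, ∑ j ∈ Finset.Ioo (-(N : ℤ)) N, ‖Adif N (α * h) j‖ ^ 2 ≤
      1300 * W ^ 3 * (H * P ^ 3 / X) := by
  have hP := p.hP
  have hH := p.hH
  have hW := p.hW
  have hQ := p.hQ
  have hP0 : 0 < P := by linarith
  have hX0 : 0 < X := by linarith
  have hN0 : (0 : ℝ) ≤ N := Nat.cast_nonneg _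
  refine (p.D_pre α Hn N hHn hN2).trans ?_
  have hQX : X ≤ Q ^ 4 := by
    rw [← p.HP3]
    have : P ≤ P ^ 3 := le_self_pow₀ (by linarith) (by norm_num)
    nlinarith
  have hn1 : 1 ≤ Q ^ 4 / X := by rw [le_div_iff₀ hX0]; linarith
  have hnpos : 0 < ⌊Q ^ 4 / X⌋₊ := Nat.floor_pos.2 hn1
  obtain ⟨r, hr1, hr2⟩ := Real.exists_rat_abs_sub_le_and_den_le α hnpos
  set n := ⌊Q ^ 4 / X⌋₊ with hn
  have hq1 : 1 ≤ r.den := r.den_pos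
  have hqR : (1 : ℝ) ≤ r.den := by exact_mod_cast hq1
  have hnR : (n : ℝ) ≤ Q ^ 4 / X := Nat.floor_le (by positivity)
  have hnR2 : Q ^ 4 / X < n + 1 := Nat.lt_floor_add_one _
  have hrR : (r.den : ℝ) ≤ n := by exact_mod_cast hr2
  have hrc : (r : ℝ) = r.num / r.den := by exact_mod_cast (Rat.cast_def (K := ℝ) r)
  rw [hrc] at hr1
  have hbig : X < r.den := by
    by_contra hc
    push Not at hc
    have h1 := hα r.den r.num hq1 hc
    have h2 : |r.den * α - r.num| = r.den * |α - r.num / r.den| := by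
      rw [← abs_of_pos (show (0 : ℝ) < r.den by linarith), ← abs_mul, abs_of_pos (show (0 : ℝ) < r.den by linarith)]
      congr 1; field_simp
    rw [h2] at h1
    have h3 : (r.den : ℝ) * |α - r.num / r.den| ≤ 1 / (n + 1) := by
      calc _ ≤ (r.den : ℝ) * (1 / ((n + 1) * r.den)) := by gcongr
        _ = _ := by field_simp
    have h4 : 1 / ((n : ℝ) + 1) ≤ X / Q ^ 4 := by
      rw [div_le_div_iff₀ (by positivity) (by positivity)]
      rw [div_lt_iff₀ hX0] at hnR2
      linarith
    linarith
  have hrs := recip_sum α N hN0 r.num r.den hq1 (by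
    have := r.reduced
    rw [Int.isCoprime_iff_gcd_eq_one]; exact this) (by
      refine hr1.trans ?_
      apply one_div_le_one_div_of_le (by positivity)
      nlinarith) (6 * Hn * N * N)
  set q : ℝ := (r.den : ℝ) with hqdef
  have hqle : q ≤ H * P ^ 3 / X := by rw [p.HP3]; linarith
  have hlogq : 1 + Real.log q ≤ W := by
    apply p.hlog q hqR
    calc q ≤ H * P ^ 3 / X := hqle
      _ ≤ H * P ^ 3 := div_le_self (by positivity) hX
      _ ≤ P * P ^ 3 := by gcongr; exact p.HleP
      _ = P ^ 4 := by ring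
      _ ≤ P ^ 20 := pow_le_pow_right₀ (by linarith) (by norm_num)
  have hT : ((6 * Hn * N * N : ℕ) : ℝ) ≤ 24 * (H * P ^ 2) := by
    push_cast
    calc 6 * (Hn : ℝ) * N * N ≤ 6 * H * (2 * P) * (2 * P) := by gcongr
      _ = _ := by ring
  set T : ℝ := ((6 * Hn * N * N : ℕ) : ℝ) with hTd
  have hT0 : 0 ≤ T := Nat.cast_nonneg _
  set B := H * P ^ 3 / X with hB
  have hB1 : H * P ^ 2 ≤ B := by
    rw [hB, le_div_iff₀ hX0]
    calc H * P ^ 2 * X ≤ H * P ^ 2 * P := by gcongr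
      _ = _ := by ring
  have hB0 : 0 < B := by positivity
  have hsum : (2 * T / q + 1) * (2 * (N + q * (1 + Real.log q))) ≤ 300 * W * B := by
    have hq0 : 0 < q := by linarith
    calc (2 * T / q + 1) * (2 * (N + q * (1 + Real.log q))) ≤ (2 * T / q + 1) * (2 * (N + q * W)) := by gcongr
      _ = 4 * (T / q * N) + 4 * T * W + 2 * N + 2 * q * W := by field_simp; ring
      _ ≤ 4 * (24 * (H * P ^ 2) / X * (2 * P)) + 4 * (24 * (H * P ^ 2)) * W + 2 * (2 * P) + 2 * B * W := by
          gcongr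
      _ = 192 * B + 96 * (H * P ^ 2) * W + 4 * P + 2 * B * W := by rw [hB]; field_simp; ring
      _ ≤ 192 * (B * W) + 96 * B * W + 4 * (B * W) + 2 * B * W := by
          have e1 : B ≤ B * W := by nlinarith
          have e2 : P ≤ B := by
            refine le_trans ?_ hB1
            nlinarith
          gcongr
          linarith
      _ ≤ _ := by nlinarith
  have e3 : (Hn : ℝ) * (5 * N ^ 2) ≤ 20 * B := by
    calc (Hn : ℝ) * (5 * N ^ 2) ≤ H * (5 * (2 * P) ^ 2) := by gcongr
      _ = 20 * (H * P ^ 2) := by ring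
      _ ≤ _ := by gcongr
  have e4 : B ≤ W ^ 3 * B := by
    have : 1 ≤ W ^ 3 := one_le_pow₀ hW
    nlinarith
  calc _ ≤ 20 * B + 4 * W ^ 2 * (300 * W * B) := by
        gcongr
        exact hrs.trans hsum
    _ = 20 * B + 1200 * (W ^ 3 * B) := by ring
    _ ≤ 1300 * (W ^ 3 * B) := by linarith [show 0 ≤ W ^ 3 * B by positivity]
    _ = _ := by ring

/-- the sum F -/
noncomputable def _root_.Fsum (Ms : Finset ℕ) (Hn N : ℕ) (α : ℝ) : ℝ :=
  ∑ h ∈ Finset.Icc 1 Hn, ∑ m ∈ Ms, ‖Phi N α h m‖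

lemma F_pre (α : ℝ) (Ms : Finset ℕ) (Hn N : ℕ) :
    Fsum Ms Hn N α ^ 4 ≤ (Ms.card * Hn : ℝ) ^ 2 *
      ((∑ h ∈ Finset.Icc 1 Hn, ∑ j ∈ Finset.Ioo (-(N : ℤ)) N, ‖Adif N (α * h) j‖ ^ 2) *
       (∑ h ∈ Finset.Icc 1 Hn, ∑ j ∈ Finset.Ioo (-(N : ℤ)) N, ‖∑ m ∈ Ms, eC (α * (h : ℝ) ^ 3 * (m : ℝ) ^ 8 * j)‖ ^ 2)) := by
  set S := ∑ h ∈ Finset.Icc 1 Hn, ∑ m ∈ Ms, ‖Phi N α h m‖ ^ 2 with hS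
  have hS0 : 0 ≤ S := Finset.sum_nonneg (fun _ _ => Finset.sum_nonneg (fun _ _ => by positivity))
  have h1 : Fsum Ms Hn N α ^ 2 ≤ (Ms.card * Hn : ℝ) * S := by
    unfold Fsum
    rw [hS, ← Finset.sum_product', ← Finset.sum_product']
    refine sq_sum_le_card_mul_sum_sq.trans (le_of_eq ?_)
    rw [Finset.card_product, Nat.card_Icc, Nat.add_sub_cancel]; push_cast; ring
  have h2 : S ^ 2 ≤ (∑ h ∈ Finset.Icc 1 Hn, ∑ j ∈ Finset.Ioo (-(N : ℤ)) N, ‖Adif N (α * h) j‖ ^ 2) *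
       (∑ h ∈ Finset.Icc 1 Hn, ∑ j ∈ Finset.Ioo (-(N : ℤ)) N, ‖∑ m ∈ Ms, eC (α * (h : ℝ) ^ 3 * (m : ℝ) ^ 8 * j)‖ ^ 2) := by
    have h3 : (S : ℂ) = ∑ h ∈ Finset.Icc 1 Hn, ∑ j ∈ Finset.Ioo (-(N : ℤ)) N, Adif N (α * h) j * ∑ m ∈ Ms, eC (α * (h : ℝ) ^ 3 * (m : ℝ) ^ 8 * j) := by
      rw [hS, Complex.ofReal_sum]
      apply Finset.sum_congr rfl
      intro h _
      rw [Complex.ofReal_sum]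
      simp_rw [Phi_sq]
      rw [Finset.sum_comm]
      apply Finset.sum_congr rfl
      intro j _
      rw [Finset.mul_sum]
    have h4 : S ≤ ∑ h ∈ Finset.Icc 1 Hn, ∑ j ∈ Finset.Ioo (-(N : ℤ)) N, ‖Adif N (α * h) j‖ * ‖∑ m ∈ Ms, eC (α * (h : ℝ) ^ 3 * (m : ℝ) ^ 8 * j)‖ := by
      have : S = ‖(S : ℂ)‖ := by rw [Complex.norm_real, Real.norm_of_nonneg hS0]
      rw [this, h3]
      refine (norm_sum_le _ _).trans (Finset.sum_le_sum ?_)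
      intro h _
      refine (norm_sum_le _ _).trans (Finset.sum_le_sum ?_)
      intro j _
      rw [norm_mul]
    calc S ^ 2 ≤ (∑ h ∈ Finset.Icc 1 Hn, ∑ j ∈ Finset.Ioo (-(N : ℤ)) N, ‖Adif N (α * h) j‖ * ‖∑ m ∈ Ms, eC (α * (h : ℝ) ^ 3 * (m : ℝ) ^ 8 * j)‖) ^ 2 := by gcongr
      _ ≤ _ := by
        rw [← Finset.sum_product', ← Finset.sum_product', ← Finset.sum_product']
        exact Finset.sum_mul_sq_le_sq_mul_sq _ _ _
  have hF0 : 0 ≤ Fsum Ms Hn N α := Finset.sum_nonneg (fun _ _ => Finset.sum_nonneg (fun _ _ => by positivity))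
  calc Fsum Ms Hn N α ^ 4 = (Fsum Ms Hn N α ^ 2) ^ 2 := by ring
    _ ≤ ((Ms.card * Hn : ℝ) * S) ^ 2 := by gcongr
    _ = (Ms.card * Hn : ℝ) ^ 2 * S ^ 2 := by ring
    _ ≤ _ := by gcongr

/-- bound from Weyl differencing alone -/
lemma F_weyl (p : Par P M H Q X1 W) (α X : ℝ) (hX : 1 ≤ X) (hXP : X ≤ P) (Ms : Finset ℕ)
    (hMs : (Ms.card : ℝ) ≤ M * W) (Hn N : ℕ) (hHn : (Hn : ℝ) ≤ H)
    (hN1 : P ≤ N) (hN2 : (N : ℝ) ≤ 2 * P)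
    (hα : ∀ (q : ℕ) (a : ℤ), 1 ≤ q → (q : ℝ) ≤ X → X / Q ^ 4 < |q * α - a|) :
    Fsum Ms Hn N α ^ 4 ≤ 5200 * W ^ 7 * ((H * M * P) ^ 4 / X) := by
  have hP := p.hP
  have hH := p.hH
  have hW := p.hW
  have hM := p.hM
  have hX0 : 0 < X := by linarith
  have hE : ∑ h ∈ Finset.Icc 1 Hn, ∑ j ∈ Finset.Ioo (-(N : ℤ)) N, ‖∑ m ∈ Ms, eC (α * (h : ℝ) ^ 3 * (m : ℝ) ^ 8 * j)‖ ^ 2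
      ≤ 4 * H * P * (M * W) ^ 2 := by
    have h1 : ∀ (h : ℕ) (j : ℤ), ‖∑ m ∈ Ms, eC (α * (h : ℝ) ^ 3 * (m : ℝ) ^ 8 * j)‖ ^ 2 ≤ (M * W) ^ 2 := by
      intro h j
      gcongr
      refine (norm_sum_le _ _).trans ?_
      simpa [norm_eC] using hMs
    calc _ ≤ ∑ h ∈ Finset.Icc 1 Hn, ∑ j ∈ Finset.Ioo (-(N : ℤ)) N, (M * W) ^ 2 :=
          Finset.sum_le_sum (fun h _ => Finset.sum_le_sum (fun j _ => h1 h j))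
      _ = Hn * (((N - -(N : ℤ) - 1).toNat : ℝ) * (M * W) ^ 2) := by simp
      _ ≤ H * ((2 * (2 * P)) * (M * W) ^ 2) := by
          gcongr
          have : ((N - -(N : ℤ) - 1).toNat) ≤ 2 * N := by omega
          have : (((N - -(N : ℤ) - 1).toNat : ℕ) : ℝ) ≤ 2 * N := by exact_mod_cast this
          linarith
      _ = _ := by ring
  have hD := p.D_bound α X hX hXP Hn N hHn hN1 hN2 hα
  calc _ ≤ _ := F_pre α Ms Hn N
    _ ≤ (M * W * H) ^ 2 * ((1300 * W ^ 3 * (H * P ^ 3 / X)) * (4 * H * P * (M * W) ^ 2)) := by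
        gcongr
    _ = _ := by field_simp; ring

/-- the minor arc bound -/
lemma F_minor (p : Par P M H Q X1 W) (α : ℝ) (Y : ℕ) (hY : (Y : ℝ) ≤ M * W) (hY1 : 1 ≤ Y) (Ms : Finset ℕ)
    (hMs : ∀ m ∈ Ms, M ≤ m ∧ m ≤ Y) (hMc : (Ms.card : ℝ) ≤ M * W) (Hn N : ℕ) (hHn : (Hn : ℝ) ≤ H)
    (hN1 : P ≤ N) (hN2 : (N : ℝ) ≤ 2 * P)
    (hα : ∀ (q : ℕ) (a : ℤ), 1 ≤ q → (q : ℝ) ≤ X1 → X1 / Q ^ 4 < |q * α - a|) :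
    Fsum Ms Hn N α ^ 4 ≤ 26000000 * W ^ 20 * (M * P) ^ 4 := by
  have hP := p.hP
  have hH := p.hH
  have hW := p.hW
  have hM := p.hM
  have hX0 : 0 < X1 := by linarith [p.hX1]
  have hE := p.E_bound α Y hY hY1 Ms hMs Hn hHn N hN1 hN2 hα
  have hD := p.D_bound α X1 p.hX1 p.hXP Hn N hHn hN1 hN2 hα
  calc _ ≤ _ := F_pre α Ms Hn N
    _ ≤ (M * W * H) ^ 2 * ((1300 * W ^ 3 * (H * P ^ 3 / X1)) * (20000 * W ^ 15 * (H * M * P))) := by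
        gcongr
    _ = 26000000 * W ^ 20 * (H ^ 4 * (M ^ 3 * P ^ 4) / X1) := by field_simp; ring
    _ = _ := by rw [← p.X1M]; field_simp

end Par


/-- `F` is the exponential sum with phases `φ` over `s`. -/
def ExpRep {ι : Type*} (F : ℝ → ℂ) (s : Finset ι) (φ : ι → ℤ) : Prop :=
  ∀ α : ℝ, F α = ∑ i ∈ s, eC (α * φ i)

lemma ExpRep.mul {ι κ : Type*} {F G : ℝ → ℂ} {s : Finset ι} {t : Finset κ} {φ : ι → ℤ} {ψ : κ → ℤ}
    (h1 : ExpRep F s φ) (h2 : ExpRep G t ψ) :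
    ExpRep (fun α => F α * G α) (s ×ˢ t) (fun i => φ i.1 + ψ i.2) := by
  intro α
  show F α * G α = _
  rw [h1 α, h2 α, Finset.sum_mul_sum, ← Finset.sum_product']
  apply Finset.sum_congr rfl
  intro i _
  rw [← eC_add]; congr 1; push_cast; ring

lemma ExpRep.normSq {ι : Type*} {F : ℝ → ℂ} {s : Finset ι} {φ : ι → ℤ} (h1 : ExpRep F s φ) :
    ExpRep (fun α => ((‖F α‖ ^ 2 : ℝ) : ℂ)) (s ×ˢ s) (fun i => φ i.1 - φ i.2) := by
  intro α
  show ((‖F α‖ ^ 2 : ℝ) : ℂ) = _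
  rw [h1 α, normSq_sum_eC, ← Finset.sum_product']
  apply Finset.sum_congr rfl
  intro i _
  congr 1; push_cast; ring

lemma ExpRep.norm4 {ι : Type*} {F : ℝ → ℂ} {s : Finset ι} {φ : ι → ℤ} (h1 : ExpRep F s φ) :
    ExpRep (fun α => ((‖F α‖ ^ 4 : ℝ) : ℂ)) ((s ×ˢ s) ×ˢ (s ×ˢ s))
      (fun i => (φ i.1.1 + φ i.1.2) - (φ i.2.1 + φ i.2.2)) := by
  have h2 := (h1.mul h1).normSq
  intro α
  have := h2 α
  rw [← this]
  show ((‖F α‖ ^ 4 : ℝ) : ℂ) = ((‖F α * F α‖ ^ 2 : ℝ) : ℂ)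
  rw [norm_mul]; congr 1; ring

lemma ExpRep.continuous {ι : Type*} {F : ℝ → ℂ} {s : Finset ι} {φ : ι → ℤ} (h1 : ExpRep F s φ) :
    Continuous F := by
  have : F = fun α => ∑ i ∈ s, eC (α * φ i) := funext h1
  rw [this]
  apply continuous_finsetSum
  intro i _
  exact continuous_eC.comp (by fun_prop)

lemma ExpRep.card {ι : Type*} {F : ℝ → ℝ} {s : Finset ι} {φ : ι → ℤ} (h1 : ExpRep (fun α => (F α : ℂ)) s φ) :
    ∫ α in (0 : ℝ)..1, F α = ((s.filter (fun i => φ i = 0)).card : ℝ) :=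
  card_eq_integral s φ F h1

/-- the sum `∑ e(2 α x^4)` over `A`. -/
noncomputable def GA (A : Finset ℕ) (α : ℝ) : ℂ := ∑ x ∈ A, eC (α * ((2 * x ^ 4 : ℕ) : ℝ))

lemma GA_rep (A : Finset ℕ) : ExpRep (GA A) A (fun x => 2 * (x : ℤ) ^ 4) := by
  intro α; unfold GA; apply Finset.sum_congr rfl; intro i _; congr 1

/-- the Fejer-type majorant of the arcs -/
noncomputable def Nmaj (L K : ℕ) (α : ℝ) : ℝ :=
  ∑ q ∈ Finset.Icc 1 K, 4 / (L : ℝ) ^ 2 * ‖∑ k ∈ Finset.range L, eC (α * ((q * k : ℕ) : ℝ))‖ ^ 2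

lemma Nmaj_nonneg (L K : ℕ) (α : ℝ) : 0 ≤ Nmaj L K α := by
  unfold Nmaj; positivity

lemma range_rep (L q : ℕ) : ExpRep (fun α => ∑ k ∈ Finset.range L, eC (α * ((q * k : ℕ) : ℝ))) (Finset.range L)
    (fun k => (q : ℤ) * k) := by
  intro α; apply Finset.sum_congr rfl; intro i _; congr 1

lemma Nmaj_cont (L K : ℕ) : Continuous (Nmaj L K) := by
  unfold Nmaj
  apply continuous_finsetSum
  intro q _
  exact continuous_const.mul ((range_rep L q).continuous.norm.pow 2)

lemma eC_re (x : ℝ) : (eC x).re = Real.cos (2 * Real.pi * x) := by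
  unfold eC
  rw [show (2 * (Real.pi : ℂ) * Complex.I * x) = ((2 * Real.pi * x : ℝ) : ℂ) * Complex.I by push_cast; ring]
  rw [Complex.exp_ofReal_mul_I_re]

lemma Nmaj_ge (L K : ℕ) (hL : 1 ≤ L) (α δ : ℝ) (hδ : L * δ ≤ 1 / 8) (q : ℕ) (a : ℤ) (hq : 1 ≤ q) (hqK : q ≤ K)
    (h : |q * α - a| ≤ δ) : 1 ≤ Nmaj L K α := by
  have hLR : (1 : ℝ) ≤ L := by exact_mod_cast hL
  have h1 : 4 / (L : ℝ) ^ 2 * ‖∑ k ∈ Finset.range L, eC (α * ((q * k : ℕ) : ℝ))‖ ^ 2 ≤ Nmaj L K α := by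
    unfold Nmaj
    exact Finset.single_le_sum (f := fun q => 4 / (L : ℝ) ^ 2 * ‖∑ k ∈ Finset.range L, eC (α * ((q * k : ℕ) : ℝ))‖ ^ 2)
      (fun i _ => by positivity) (Finset.mem_Icc.2 ⟨hq, hqK⟩)
  refine le_trans ?_ h1
  have h2 : (L : ℝ) / 2 ≤ ‖∑ k ∈ Finset.range L, eC (α * ((q * k : ℕ) : ℝ))‖ := by
    refine le_trans ?_ (Complex.re_le_norm _)
    rw [Complex.re_sum]
    calc (L : ℝ) / 2 = ∑ k ∈ Finset.range L, (1 / 2 : ℝ) := by simp; ring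
      _ ≤ _ := by
        apply Finset.sum_le_sum
        intro k hk
        rw [Finset.mem_range] at hk
        have hkR : (k : ℝ) ≤ L := by exact_mod_cast hk.le
        have e1 : eC (α * ((q * k : ℕ) : ℝ)) = eC (k * (q * α - a)) := by
          have : α * ((q * k : ℕ) : ℝ) = k * (q * α - a) + ((k * a : ℤ) : ℝ) := by push_cast; ring
          rw [this, eC_add, eC_int, mul_one]
        rw [e1, eC_re]
        have e2 : |(k : ℝ) * (q * α - a)| ≤ 1 / 8 := by
          rw [abs_mul, Nat.abs_cast]
          calc (k : ℝ) * |q * α - a| ≤ L * δ := by gcongr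
            _ ≤ _ := hδ
        have hpi := Real.pi_pos
        rw [← Real.cos_abs, abs_mul, abs_of_pos (by positivity : 0 < 2 * Real.pi)]
        have : Real.cos (Real.pi / 3) ≤ Real.cos (2 * Real.pi * |(k : ℝ) * (q * α - a)|) := by
          apply Real.cos_le_cos_of_nonneg_of_le_pi (by positivity) (by linarith)
          nlinarith
        rw [Real.cos_pi_div_three] at this
        exact this
  calc (1 : ℝ) = 4 / (L : ℝ) ^ 2 * (L / 2) ^ 2 := by field_simp; norm_num
    _ ≤ _ := by gcongr

/-- the phase of the quadruple -/
def ph4 (y : (ℕ × ℕ) × (ℕ × ℕ)) : ℤ :=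
  (2 * (y.1.1 : ℤ) ^ 4 + 2 * (y.1.2 : ℤ) ^ 4) - (2 * (y.2.1 : ℤ) ^ 4 + 2 * (y.2.2 : ℤ) ^ 4)

lemma arc_one (A : Finset ℕ) (L q : ℕ) (hq : 1 ≤ q) :
    ∫ α in (0 : ℝ)..1, ‖∑ k ∈ Finset.range L, eC (α * ((q * k : ℕ) : ℝ))‖ ^ 2 * ‖GA A α‖ ^ 4 ≤
      L * ((((A ×ˢ A) ×ˢ (A ×ˢ A)).filter (fun y => (q : ℤ) ∣ ph4 y)).card : ℝ) := by
  have h1 := ((range_rep L q).normSq).mul ((GA_rep A).norm4)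
  have h2 := ExpRep.card (F := fun α => ‖∑ k ∈ Finset.range L, eC (α * ((q * k : ℕ) : ℝ))‖ ^ 2 * ‖GA A α‖ ^ 4) (by
    intro α
    rw [← h1 α]
    show ((_ : ℝ) : ℂ) = _
    push_cast; rfl)
  rw [h2]
  have : (((Finset.range L ×ˢ Finset.range L) ×ˢ ((A ×ˢ A) ×ˢ (A ×ˢ A))).filter (fun i => (q : ℤ) * i.1.1 - q * i.1.2 +
    (2 * (i.2.1.1 : ℤ) ^ 4 + 2 * (i.2.1.2 : ℤ) ^ 4 - (2 * (i.2.2.1 : ℤ) ^ 4 + 2 * (i.2.2.2 : ℤ) ^ 4)) = 0)).card ≤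
    (Finset.range L ×ˢ (((A ×ˢ A) ×ˢ (A ×ˢ A)).filter (fun y => (q : ℤ) ∣ ph4 y))).card := by
    apply Finset.card_le_card_of_injOn (fun i => (i.1.2, i.2))
    · rintro ⟨⟨k, k'⟩, y⟩ h
      simp only [Finset.coe_filter, Finset.mem_product, Set.mem_ofPred_eq, Finset.coe_product, Set.mem_prod, Finset.mem_coe, Finset.mem_range] at h ⊢
      refine ⟨h.1.1.2, h.1.2, ⟨(k' : ℤ) - k, ?_⟩⟩
      unfold ph4
      linarith [h.2]
    · rintro ⟨⟨k, k'⟩, y⟩ h ⟨⟨l, l'⟩, y'⟩ h' heq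
      simp only [Finset.coe_filter, Finset.mem_product, Set.mem_ofPred_eq] at h h'
      simp only [Prod.mk.injEq] at heq ⊢
      obtain ⟨rfl, rfl⟩ := heq
      refine ⟨⟨?_, rfl⟩, rfl⟩
      have h3 : (q : ℤ) * k = q * l := by linarith [h.2, h'.2]
      have hq0 : (q : ℤ) ≠ 0 := by omega
      have := mul_left_cancel₀ hq0 h3
      exact_mod_cast this
  rw [Finset.card_product, Finset.card_range] at this
  exact_mod_cast this

lemma pairs_diff (A : Finset ℕ) (D : ℤ) (hD : D ≠ 0) :
    ((A ×ˢ A).filter (fun t => 2 * (t.1 : ℤ) ^ 4 - 2 * (t.2 : ℤ) ^ 4 = D)).card ≤ D.natAbs.divisors.card ^ 2 := by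
  rw [sq, ← Finset.card_product]
  apply Finset.card_le_card_of_injOn (fun t => (((t.1 : ℤ) - t.2).natAbs, t.1 + t.2))
  · rintro ⟨x, y⟩ h
    simp only [Finset.coe_filter, Finset.mem_product, Set.mem_ofPred_eq, Finset.coe_product, Set.mem_prod, Finset.mem_coe, Nat.mem_divisors] at h ⊢
    have hD0 : D.natAbs ≠ 0 := Int.natAbs_ne_zero.2 hD
    refine ⟨⟨?_, hD0⟩, ⟨?_, hD0⟩⟩
    · rw [Int.natAbs_dvd_natAbs, ← h.2]
      exact ⟨2 * ((x : ℤ) + y) * (x ^ 2 + y ^ 2), by ring⟩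
    · rw [← Int.natCast_dvd_natCast, Int.dvd_natAbs, ← h.2]
      exact ⟨2 * ((x : ℤ) - y) * (x ^ 2 + y ^ 2), by push_cast; ring⟩
  · rintro ⟨x, y⟩ h ⟨x', y'⟩ h' heq
    simp only [Finset.coe_filter, Finset.mem_product, Set.mem_ofPred_eq] at h h'
    simp only [Prod.mk.injEq] at heq ⊢
    have h2 := h.2
    have h2' := h'.2
    by_cases hc : (x : ℤ) - y = x' - y'
    · omega
    · exfalso
      have e1 : (x' : ℤ) = y := by omega
      have e2 : (y' : ℤ) = x := by omega
      rw [e1, e2] at h2'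
      have : D = 0 := by linarith
      exact hD this

lemma card_floor (Q : ℝ) (hQ : 0 ≤ Q) (A : Finset ℕ) (hA : ∀ x ∈ A, 1 ≤ x ∧ (x : ℝ) ≤ Q) : (A.card : ℝ) ≤ Q := by
  have h1 : A ⊆ Finset.Icc 1 ⌊Q⌋₊ := by
    intro x hx
    rw [Finset.mem_Icc]
    exact ⟨(hA x hx).1, Nat.le_floor (hA x hx).2⟩
  have h2 := Finset.card_le_card h1
  rw [Nat.card_Icc, Nat.add_sub_cancel] at h2
  calc (A.card : ℝ) ≤ (⌊Q⌋₊ : ℝ) := by exact_mod_cast h2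
    _ ≤ Q := Nat.floor_le (by linarith)

lemma U4_raw (Q W : ℝ) (hQ : 0 ≤ Q) (hW : 1 ≤ W)
    (hd : ∀ n : ℕ, 0 < n → (n : ℝ) ≤ 4 * Q ^ 4 → (n.divisors.card : ℝ) ≤ W) (A : Finset ℕ) (hA : ∀ x ∈ A, 1 ≤ x ∧ (x : ℝ) ≤ Q) :
    ((((A ×ˢ A) ×ˢ (A ×ˢ A)).filter (fun y => ph4 y = 0)).card : ℝ) ≤ 2 * W ^ 2 * Q ^ 2 := by
  have hAc := card_floor Q hQ A hA
  -- map to (y.1.2, y.2.2)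
  set T := ((A ×ˢ A) ×ˢ (A ×ˢ A)).filter (fun y => ph4 y = 0) with hT
  have hmap : ∀ y ∈ T, ((y.2.2, y.1.2) : ℕ × ℕ) ∈ A ×ˢ A := by
    rintro ⟨⟨a, b⟩, ⟨c, d⟩⟩ hy
    simp only [hT, Finset.mem_filter, Finset.mem_product] at hy ⊢
    exact ⟨hy.1.2.2, hy.1.1.2⟩
  rw [Finset.card_eq_sum_card_fiberwise hmap]
  push_cast
  have key : ∀ t ∈ A ×ˢ A, ((T.filter (fun y => (y.2.2, y.1.2) = t)).card : ℝ) ≤ (if t.1 = t.2 then Q else 0) + W ^ 2 := by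
    rintro ⟨d, b⟩ ht
    rw [Finset.mem_product] at ht
    have hle : (T.filter (fun y => (y.2.2, y.1.2) = (d, b))).card ≤
        ((A ×ˢ A).filter (fun t => 2 * (t.1 : ℤ) ^ 4 - 2 * (t.2 : ℤ) ^ 4 = 2 * (d : ℤ) ^ 4 - 2 * (b : ℤ) ^ 4)).card := by
      apply Finset.card_le_card_of_injOn (fun y => (y.1.1, y.2.1))
      · rintro ⟨⟨a, b'⟩, ⟨c, d'⟩⟩ hy
        rw [Finset.mem_coe, Finset.mem_filter, hT, Finset.mem_filter] at hy
        simp only [Finset.coe_filter, Finset.mem_product, Set.mem_ofPred_eq, Prod.mk.injEq, ph4] at hy ⊢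
        obtain ⟨⟨hy1, hy2⟩, rfl, rfl⟩ := hy
        refine ⟨⟨hy1.1.1, hy1.2.1⟩, by linarith⟩
      · rintro ⟨⟨a, b'⟩, ⟨c, d'⟩⟩ hy ⟨⟨a2, b2⟩, ⟨c2, d2⟩⟩ hy2 heq
        simp only [hT, Finset.coe_filter, Finset.mem_filter, Set.mem_ofPred_eq, Prod.mk.injEq] at hy hy2 heq ⊢
        obtain ⟨_, rfl, rfl⟩ := hy
        obtain ⟨_, rfl, rfl⟩ := hy2
        exact ⟨⟨heq.1, rfl⟩, heq.2, rfl⟩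
    have hleR : ((T.filter (fun y => (y.2.2, y.1.2) = (d, b))).card : ℝ) ≤
        (((A ×ˢ A).filter (fun t => 2 * (t.1 : ℤ) ^ 4 - 2 * (t.2 : ℤ) ^ 4 = 2 * (d : ℤ) ^ 4 - 2 * (b : ℤ) ^ 4)).card : ℝ) := by
      exact_mod_cast hle
    refine hleR.trans ?_
    by_cases hdb : d = b
    · subst hdb
      simp only [if_true]
      have h1 : ((A ×ˢ A).filter (fun t => 2 * (t.1 : ℤ) ^ 4 - 2 * (t.2 : ℤ) ^ 4 = 2 * (d : ℤ) ^ 4 - 2 * (d : ℤ) ^ 4)).card ≤ A.card := by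
        apply Finset.card_le_card_of_injOn (fun t => t.1)
        · rintro ⟨x, y⟩ h
          simp only [Finset.coe_filter, Finset.mem_product, Set.mem_ofPred_eq] at h
          exact h.1.1
        · rintro ⟨x, y⟩ h ⟨x', y'⟩ h' heq
          simp only [Finset.coe_filter, Finset.mem_product, Set.mem_ofPred_eq] at h h' heq
          subst heq
          have e : (y : ℤ) ^ 4 = (y' : ℤ) ^ 4 := by linarith [h.2, h'.2]
          have e' : y ^ 4 = y' ^ 4 := by exact_mod_cast e
          have : y = y' := Nat.pow_left_injective (show 4 ≠ 0 by norm_num) e'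
          rw [this]
      have h1R : (((A ×ˢ A).filter (fun t => 2 * (t.1 : ℤ) ^ 4 - 2 * (t.2 : ℤ) ^ 4 = 2 * (d : ℤ) ^ 4 - 2 * (d : ℤ) ^ 4)).card : ℝ) ≤ A.card := by
        exact_mod_cast h1
      have : 0 ≤ W ^ 2 := by positivity
      linarith
    · simp only [hdb, if_false, zero_add]
      have hD : 2 * (d : ℤ) ^ 4 - 2 * (b : ℤ) ^ 4 ≠ 0 := by
        intro hc
        have e : (d : ℤ) ^ 4 = (b : ℤ) ^ 4 := by linarith
        have e' : d ^ 4 = b ^ 4 := by exact_mod_cast e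
        exact hdb (Nat.pow_left_injective (show 4 ≠ 0 by norm_num) e')
      have h1 := pairs_diff A _ hD
      have h2 := hd _ (Int.natAbs_pos.2 hD) (by
        rw [Nat.cast_natAbs, Int.cast_abs]
        push_cast
        have d4 : (d : ℝ) ^ 4 ≤ Q ^ 4 := by gcongr; exact (hA d ht.1).2
        have b4 : (b : ℝ) ^ 4 ≤ Q ^ 4 := by gcongr; exact (hA b ht.2).2
        have d0 : 0 ≤ (d : ℝ) ^ 4 := by positivity
        have b0 : 0 ≤ (b : ℝ) ^ 4 := by positivity
        rw [abs_le]; constructor <;> linarith)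
      calc _ ≤ (((2 * (d : ℤ) ^ 4 - 2 * (b : ℤ) ^ 4).natAbs.divisors.card : ℝ)) ^ 2 := by exact_mod_cast h1
        _ ≤ _ := by gcongr
  refine (Finset.sum_le_sum key).trans ?_
  rw [Finset.sum_add_distrib, Finset.sum_product]
  simp only [Finset.sum_ite_eq, Finset.sum_const, nsmul_eq_mul, Finset.card_product]
  have h1 : ∑ x ∈ A, (if x ∈ A then Q else 0) ≤ A.card * Q := by
    rw [← nsmul_eq_mul, ← Finset.sum_const]
    apply Finset.sum_le_sum
    intro x hx; rw [if_pos hx]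
  push_cast
  have hc0 : (0 : ℝ) ≤ A.card := Nat.cast_nonneg _
  have hW2 : 1 ≤ W ^ 2 := one_le_pow₀ hW
  calc _ ≤ A.card * Q + A.card * A.card * W ^ 2 := by linarith
    _ ≤ Q * Q + Q * Q * W ^ 2 := by gcongr
    _ ≤ _ := by nlinarith [show 0 ≤ Q * Q by positivity]

namespace Par
variable {P M H Q X1 W : ℝ}

lemma QleP (p : Par P M H Q X1 W) : Q ≤ P := by
  have h1 := p.eQ; have h2 := p.hQ; have h3 := p.hM; nlinarith

lemma PleQ2 (p : Par P M H Q X1 W) : P ≤ Q ^ 2 := by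
  have h1 := p.eQ; have h2 := p.eH; have hM := p.hM; have hH := p.hH; have hP := p.hP
  have hM2 : 1 ≤ M ^ 2 := one_le_pow₀ hM
  have h3 : M ^ 2 ≤ P := by
    have e1 : M ^ 2 ≤ M ^ 4 := pow_le_pow_right₀ hM (by norm_num)
    have e2 : 1 * M ^ 4 ≤ H * M ^ 4 := by gcongr
    linarith
  have h4 : M ^ 2 * P ≤ M ^ 2 * Q ^ 2 := by
    calc M ^ 2 * P ≤ P * P := by gcongr
      _ = _ := by rw [← h1]; ring
  exact le_of_mul_le_mul_left h4 (by positivity)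

lemma Acard (p : Par P M H Q X1 W) (A : Finset ℕ) (hA : ∀ x ∈ A, 1 ≤ x ∧ (x : ℝ) ≤ Q) : (A.card : ℝ) ≤ Q :=
  card_floor Q (by linarith [p.hQ]) A hA

lemma ph_div (p : Par P M H Q X1 W) (D : ℤ) (hD : D ≠ 0) (h : |(D : ℝ)| ≤ 4 * Q ^ 4) :
    (D.natAbs.divisors.card : ℝ) ≤ W := by
  apply p.hd _ (Int.natAbs_pos.2 hD)
  rw [Nat.cast_natAbs, Int.cast_abs]
  have hP8 := p.hP8
  have hQP := p.QleP
  have hQ := p.hQ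
  calc |(D : ℝ)| ≤ 4 * Q ^ 4 := h
    _ ≤ P ^ 16 * P ^ 4 := by
        gcongr
        calc (4 : ℝ) ≤ 8 ^ 16 := by norm_num
          _ ≤ _ := by gcongr
    _ = _ := by ring

lemma U4 (p : Par P M H Q X1 W) (A : Finset ℕ) (hA : ∀ x ∈ A, 1 ≤ x ∧ (x : ℝ) ≤ Q) :
    ((((A ×ˢ A) ×ˢ (A ×ˢ A)).filter (fun y => ph4 y = 0)).card : ℝ) ≤ 2 * W ^ 2 * Q ^ 2 := by
  have hQ := p.hQ
  have hP8 := p.hP8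
  have hQP := p.QleP
  apply U4_raw Q W (by linarith) p.hW _ A hA
  intro n hn h
  apply p.hd n hn (h.trans _)
  calc 4 * Q ^ 4 ≤ P ^ 16 * P ^ 4 := by
        gcongr
        calc (4 : ℝ) ≤ 8 ^ 16 := by norm_num
          _ ≤ _ := by gcongr
    _ = _ := by ring

lemma arc_moment (p : Par P M H Q X1 W) (A : Finset ℕ) (hA : ∀ x ∈ A, 1 ≤ x ∧ (x : ℝ) ≤ Q)
    (X : ℝ) (hX : 1 ≤ X) (hXP : X ≤ P) :
    ∃ L K : ℕ, (∀ (α : ℝ) (q : ℕ) (a : ℤ), 1 ≤ q → (q : ℝ) ≤ X → |q * α - a| ≤ X / Q ^ 4 → 1 ≤ Nmaj L K α) ∧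
      ∫ α in (0 : ℝ)..1, Nmaj L K α * ‖GA A α‖ ^ 4 ≤ 192 * W ^ 2 * X := by
  have hQ := p.hQ
  have hW := p.hW
  have hP8 := p.hP8
  have hPQ := p.PleQ2
  have hX0 : 0 < X := by linarith
  have hAc := p.Acard A hA
  set T := (A ×ˢ A) ×ˢ (A ×ˢ A) with hT
  have hX8 : 8 * X ≤ Q ^ 4 := by
    calc 8 * X ≤ P * P := by gcongr
      _ ≤ Q ^ 2 * Q ^ 2 := by gcongr
      _ = _ := by ring
  set L := ⌊Q ^ 4 / (8 * X)⌋₊ with hL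
  have hL1 : 1 ≤ L := Nat.floor_pos.2 (by rw [le_div_iff₀ (by positivity)]; linarith)
  have hLR : (1 : ℝ) ≤ L := by exact_mod_cast hL1
  have hLle : (L : ℝ) ≤ Q ^ 4 / (8 * X) := Nat.floor_le (by positivity)
  have hLgt : Q ^ 4 / (8 * X) < L + 1 := Nat.lt_floor_add_one _
  have hQ4 : 0 < Q ^ 4 := by positivity
  refine ⟨L, ⌊X⌋₊, ?_, ?_⟩
  · intro α q a hq hqX h
    apply Nmaj_ge L ⌊X⌋₊ hL1 α (X / Q ^ 4) _ q a hq (Nat.le_floor hqX) h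
    calc (L : ℝ) * (X / Q ^ 4) ≤ Q ^ 4 / (8 * X) * (X / Q ^ 4) := by gcongr
      _ = _ := by field_simp
  · have e1 : ∫ α in (0 : ℝ)..1, Nmaj L ⌊X⌋₊ α * ‖GA A α‖ ^ 4 = ∑ q ∈ Finset.Icc 1 ⌊X⌋₊, 4 / (L : ℝ) ^ 2 *
        ∫ α in (0 : ℝ)..1, ‖∑ k ∈ Finset.range L, eC (α * ((q * k : ℕ) : ℝ))‖ ^ 2 * ‖GA A α‖ ^ 4 := by
      simp_rw [← intervalIntegral.integral_const_mul]
      rw [← intervalIntegral.integral_finsetSum]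
      · congr 1; ext α; unfold Nmaj; rw [Finset.sum_mul]
        apply Finset.sum_congr rfl; intro q _; ring
      · intro q _
        apply Continuous.intervalIntegrable
        exact continuous_const.mul (((range_rep L q).continuous.norm.pow 2).mul ((GA_rep A).continuous.norm.pow 4))
    rw [e1]
    have e2 : ∑ q ∈ Finset.Icc 1 ⌊X⌋₊, 4 / (L : ℝ) ^ 2 *
        ∫ α in (0 : ℝ)..1, ‖∑ k ∈ Finset.range L, eC (α * ((q * k : ℕ) : ℝ))‖ ^ 2 * ‖GA A α‖ ^ 4 ≤
        4 / (L : ℝ) * ∑ q ∈ Finset.Icc 1 ⌊X⌋₊, ((T.filter (fun y => (q : ℤ) ∣ ph4 y)).card : ℝ) := by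
      rw [Finset.mul_sum]
      apply Finset.sum_le_sum
      intro q hq
      rw [Finset.mem_Icc] at hq
      calc _ ≤ 4 / (L : ℝ) ^ 2 * (L * ((T.filter (fun y => (q : ℤ) ∣ ph4 y)).card : ℝ)) := by
            gcongr
            exact arc_one A L q hq.1
        _ = _ := by field_simp
    refine e2.trans ?_
    have e3 : ∑ q ∈ Finset.Icc 1 ⌊X⌋₊, ((T.filter (fun y => (q : ℤ) ∣ ph4 y)).card : ℝ) ≤
        X * (2 * W ^ 2 * Q ^ 2) + Q ^ 4 * W := by
      have f1 : ∑ q ∈ Finset.Icc 1 ⌊X⌋₊, ((T.filter (fun y => (q : ℤ) ∣ ph4 y)).card : ℝ) =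
          ∑ y ∈ T, (((Finset.Icc 1 ⌊X⌋₊).filter (fun q : ℕ => (q : ℤ) ∣ ph4 y)).card : ℝ) := by
        simp_rw [Finset.card_filter]
        push_cast
        rw [Finset.sum_comm]
      rw [f1]
      have f2 : ∀ y ∈ T, (((Finset.Icc 1 ⌊X⌋₊).filter (fun q : ℕ => (q : ℤ) ∣ ph4 y)).card : ℝ) ≤
          (if ph4 y = 0 then X else 0) + W := by
        rintro ⟨⟨a, b⟩, ⟨c, d⟩⟩ hy
        by_cases h0 : ph4 ((a, b), (c, d)) = 0
        · rw [if_pos h0]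
          have g1 := Finset.card_filter_le (Finset.Icc 1 ⌊X⌋₊) (fun q : ℕ => (q : ℤ) ∣ ph4 ((a, b), (c, d)))
          rw [Nat.card_Icc, Nat.add_sub_cancel] at g1
          have g2 : (((Finset.Icc 1 ⌊X⌋₊).filter (fun q : ℕ => (q : ℤ) ∣ ph4 ((a, b), (c, d)))).card : ℝ) ≤ (⌊X⌋₊ : ℝ) := by
            exact_mod_cast g1
          have := Nat.floor_le hX0.le
          linarith
        · rw [if_neg h0, zero_add]
          have g1 : ((Finset.Icc 1 ⌊X⌋₊).filter (fun q : ℕ => (q : ℤ) ∣ ph4 ((a, b), (c, d)))) ⊆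
              (ph4 ((a, b), (c, d))).natAbs.divisors := by
            intro q hq
            rw [Finset.mem_filter] at hq
            rw [Nat.mem_divisors]
            refine ⟨?_, Int.natAbs_ne_zero.2 h0⟩
            rw [← Int.natCast_dvd_natCast, Int.dvd_natAbs]; exact hq.2
          have g2 := Finset.card_le_card g1
          simp only [hT, Finset.mem_product] at hy
          have g3 := p.ph_div _ h0 (by
            unfold ph4
            push_cast
            have a4 : (a : ℝ) ^ 4 ≤ Q ^ 4 := by gcongr; exact (hA a hy.1.1).2
            have b4 : (b : ℝ) ^ 4 ≤ Q ^ 4 := by gcongr; exact (hA b hy.1.2).2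
            have c4 : (c : ℝ) ^ 4 ≤ Q ^ 4 := by gcongr; exact (hA c hy.2.1).2
            have d4 : (d : ℝ) ^ 4 ≤ Q ^ 4 := by gcongr; exact (hA d hy.2.2).2
            have a0 : 0 ≤ (a : ℝ) ^ 4 := by positivity
            have b0 : 0 ≤ (b : ℝ) ^ 4 := by positivity
            have c0 : 0 ≤ (c : ℝ) ^ 4 := by positivity
            have d0 : 0 ≤ (d : ℝ) ^ 4 := by positivity
            rw [abs_le]; constructor <;> linarith)
          refine le_trans ?_ g3
          exact_mod_cast g2
      refine (Finset.sum_le_sum f2).trans ?_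
      rw [Finset.sum_add_distrib, ← Finset.sum_filter, Finset.sum_const, Finset.sum_const, nsmul_eq_mul, nsmul_eq_mul]
      have hU := p.U4 A hA
      have hTc : (T.card : ℝ) ≤ Q ^ 4 := by
        rw [hT, Finset.card_product, Finset.card_product]
        push_cast
        calc (A.card : ℝ) * A.card * (A.card * A.card) = (A.card : ℝ) ^ 4 := by ring
          _ ≤ _ := by gcongr
      rw [mul_comm X]
      gcongr
    calc _ ≤ 4 / (L : ℝ) * (X * (2 * W ^ 2 * Q ^ 2) + Q ^ 4 * W) := by gcongr
      _ ≤ (64 * X / Q ^ 4) * (3 * W ^ 2 * Q ^ 4) := by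
          gcongr ?_ * ?_
          · rw [div_le_div_iff₀ (by positivity) (by positivity)]
            rw [div_lt_iff₀ (by positivity)] at hLgt
            nlinarith
          · have g1 : X * (2 * W ^ 2 * Q ^ 2) ≤ Q ^ 2 * (2 * W ^ 2 * Q ^ 2) := by gcongr; linarith
            have g2 : Q ^ 4 * W ≤ Q ^ 4 * W ^ 2 := by
              gcongr
              exact le_self_pow₀ hW (by norm_num)
            nlinarith
      _ = _ := by field_simp; ring

end Par


lemma Phi_cont (N h m : ℕ) : Continuous (fun α => Phi N α h m) := by
  unfold Phi
  apply continuous_finsetSum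
  intro i _
  exact continuous_eC.comp (by fun_prop)

lemma Fsum_cont (Ms : Finset ℕ) (Hn N : ℕ) : Continuous (Fsum Ms Hn N) := by
  unfold Fsum
  apply continuous_finsetSum
  intro h _
  apply continuous_finsetSum
  intro m _
  exact (Phi_cont N h m).norm

lemma GA_cont (A : Finset ℕ) : Continuous (GA A) := (GA_rep A).continuous

lemma interp8 (n w t : ℝ) (hn : 0 ≤ n) (hn1 : n ≤ 1) (hw : 0 ≤ w) (ht : 0 < t) :
    n * w ^ 8 ≤ t ^ 2 * (n * w ^ 4) + t⁻¹ * w ^ 10 := by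
  by_cases h : w ^ 2 ≤ t
  · have h1 : w ^ 8 ≤ t ^ 2 * w ^ 4 := by
      calc w ^ 8 = (w ^ 2) ^ 2 * w ^ 4 := by ring
        _ ≤ _ := by gcongr
    have h2 : 0 ≤ t⁻¹ * w ^ 10 := by positivity
    nlinarith
  · push Not at h
    have h1 : w ^ 8 ≤ t⁻¹ * w ^ 10 := by
      rw [inv_mul_eq_div, le_div_iff₀ ht]
      calc w ^ 8 * t ≤ w ^ 8 * w ^ 2 := by gcongr
        _ = _ := by ring
    have h2 : 0 ≤ t ^ 2 * (n * w ^ 4) := by positivity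
    have h3 : n * w ^ 8 ≤ 1 * w ^ 8 := by gcongr
    linarith

namespace Par
variable {P M H Q X1 W : ℝ}

lemma F_triv (p : Par P M H Q X1 W) (α : ℝ) (Ms : Finset ℕ)
    (hMc : (Ms.card : ℝ) ≤ M * W) (Hn N : ℕ) (hHn : (Hn : ℝ) ≤ H) (hN2 : (N : ℝ) ≤ 2 * P) :
    Fsum Ms Hn N α ≤ 2 * W * (H * M * P) := by
  have hH := p.hH
  have hMW : 0 ≤ M * W := (Nat.cast_nonneg _).trans hMc
  unfold Fsum
  have h1 : ∀ h m : ℕ, ‖Phi N α h m‖ ≤ N := by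
    intro h m
    unfold Phi
    refine (norm_sum_le _ _).trans ?_
    simp [norm_eC]
  calc _ ≤ ∑ h ∈ Finset.Icc 1 Hn, ∑ m ∈ Ms, (N : ℝ) :=
        Finset.sum_le_sum (fun h _ => Finset.sum_le_sum (fun m _ => h1 h m))
    _ = Hn * (Ms.card * N) := by simp
    _ ≤ H * (M * W * (2 * P)) := by gcongr
    _ = _ := by ring

lemma arc8 (p : Par P M H Q X1 W) (A : Finset ℕ) (B X : ℝ) (hB : 0 < B) (hX : 1 ≤ X) (L K : ℕ)
    (hB10 : ∫ α in (0 : ℝ)..1, ‖GA A α‖ ^ 10 ≤ B)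
    (h4 : ∫ α in (0 : ℝ)..1, Nmaj L K α * ‖GA A α‖ ^ 4 ≤ 192 * W ^ 2 * X) :
    ∫ α in (0 : ℝ)..1, min 1 (Nmaj L K α) * ‖GA A α‖ ^ 8 ≤ 193 * W ^ 2 * (X ^ (1 / 3 : ℝ) * B ^ (2 / 3 : ℝ)) := by
  have hW := p.hW
  have hX0 : 0 < X := by linarith
  set t : ℝ := (B / X) ^ (1 / 3 : ℝ) with ht
  have ht0 : 0 < t := by positivity
  have cG := (GA_cont A).norm
  have cN := Nmaj_cont L K
  have h1 : ∫ α in (0 : ℝ)..1, min 1 (Nmaj L K α) * ‖GA A α‖ ^ 8 ≤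
      ∫ α in (0 : ℝ)..1, (t ^ 2 * (Nmaj L K α * ‖GA A α‖ ^ 4) + t⁻¹ * ‖GA A α‖ ^ 10) := by
    apply intervalIntegral.integral_mono_on (by norm_num)
    · exact ((continuous_const.min cN).mul (cG.pow 8)).intervalIntegrable _ _
    · exact ((continuous_const.mul (cN.mul (cG.pow 4))).add (continuous_const.mul (cG.pow 10))).intervalIntegrable _ _
    · intro α _
      refine (interp8 _ _ t (le_min zero_le_one (Nmaj_nonneg _ _ _)) (min_le_left _ _) (norm_nonneg _) ht0).trans ?_
      gcongr
      exact min_le_right _ _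
  have i1 : IntervalIntegrable (fun α => t ^ 2 * (Nmaj L K α * ‖GA A α‖ ^ 4)) volume 0 1 :=
    (continuous_const.mul (cN.mul (cG.pow 4))).intervalIntegrable _ _
  have i2 : IntervalIntegrable (fun α => t⁻¹ * ‖GA A α‖ ^ 10) volume 0 1 :=
    (continuous_const.mul (cG.pow 10)).intervalIntegrable _ _
  rw [intervalIntegral.integral_add i1 i2, intervalIntegral.integral_const_mul,
    intervalIntegral.integral_const_mul] at h1
  have e1 : t ^ 2 * X = X ^ (1 / 3 : ℝ) * B ^ (2 / 3 : ℝ) := by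
    rw [ht, ← Real.rpow_natCast, ← Real.rpow_mul (by positivity), Real.div_rpow hB.le hX0.le]
    rw [div_mul_eq_mul_div, mul_comm, div_eq_iff (by positivity)]
    have : X = X ^ (1 / 3 : ℝ) * X ^ (1 / 3 * ((2 : ℕ) : ℝ)) := by
      rw [← Real.rpow_add hX0]; norm_num
    nth_rewrite 1 [this]
    rw [show (1 / 3 * ((2 : ℕ) : ℝ)) = 2 / 3 by norm_num]
    ring
  have e2 : t⁻¹ * B = X ^ (1 / 3 : ℝ) * B ^ (2 / 3 : ℝ) := by
    rw [ht, Real.div_rpow hB.le hX0.le, inv_div, div_mul_eq_mul_div, div_eq_iff (by positivity), mul_assoc,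
      ← Real.rpow_add hB]
    norm_num
  have hW2 : 1 ≤ W ^ 2 := one_le_pow₀ hW
  calc _ ≤ t ^ 2 * (192 * W ^ 2 * X) + t⁻¹ * B := by
        refine h1.trans ?_
        gcongr
    _ = 192 * W ^ 2 * (t ^ 2 * X) + t⁻¹ * B := by ring
    _ = 192 * W ^ 2 * (X ^ (1 / 3 : ℝ) * B ^ (2 / 3 : ℝ)) + (X ^ (1 / 3 : ℝ) * B ^ (2 / 3 : ℝ)) := by rw [e1, e2]
    _ ≤ _ := by nlinarith [show 0 ≤ X ^ (1 / 3 : ℝ) * B ^ (2 / 3 : ℝ) by positivity]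

set_option maxHeartbeats 1000000 in
lemma FG_bound (p : Par P M H Q X1 W) (Y : ℕ) (hY : (Y : ℝ) ≤ M * W) (hY1 : 1 ≤ Y) (Ms : Finset ℕ)
    (hMs : ∀ m ∈ Ms, M ≤ m ∧ m ≤ Y) (hMc : (Ms.card : ℝ) ≤ M * W) (Hn N : ℕ) (hHn : (Hn : ℝ) ≤ H)
    (hN1 : P ≤ N) (hN2 : (N : ℝ) ≤ 2 * P) (A : Finset ℕ) (hA : ∀ x ∈ A, 1 ≤ x ∧ (x : ℝ) ≤ Q)
    (B : ℝ) (hB : 0 < B) (hB10 : ∫ α in (0 : ℝ)..1, ‖GA A α‖ ^ 10 ≤ B) :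
    ∫ α in (0 : ℝ)..1, Fsum Ms Hn N α * ‖GA A α‖ ^ 8 ≤
      72 * W ^ 5 * (M * P) * (∫ α in (0 : ℝ)..1, ‖GA A α‖ ^ 8) +
        12000 * W ^ 5 * (H * M * P) * (X1 ^ (1 / 12 : ℝ) * B ^ (2 / 3 : ℝ)) := by
  have hP := p.hP
  have hH := p.hH
  have hW := p.hW
  have hM := p.hM
  have hX1 := p.hX1
  have hX0 : 0 < X1 := by linarith
  obtain ⟨K, hK1, hK2⟩ := exists_nat_pow_near hX1 (show (1 : ℝ) < 16 by norm_num)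
  set X : ℕ → ℝ := fun i => min (16 ^ i) X1 with hX
  have hXi1 : ∀ i, 1 ≤ X i := fun i => le_min (one_le_pow₀ (by norm_num)) hX1
  have hXiP : ∀ i, X i ≤ P := fun i => (min_le_right _ _).trans p.hXP
  choose L Kq hmaj hmom using fun i => p.arc_moment A hA (X i) (hXi1 i) (hXiP i)
  set n : ℕ → ℝ → ℝ := fun i α => min 1 (Nmaj (L i) (Kq i) α) with hn
  have hn0 : ∀ i α, 0 ≤ n i α := fun i α => le_min zero_le_one (Nmaj_nonneg _ _ _)
  have hF0 : ∀ α, 0 ≤ Fsum Ms Hn N α :=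
    fun α => Finset.sum_nonneg (fun _ _ => Finset.sum_nonneg (fun _ _ => by positivity))
  set Z := H * M * P with hZ
  have hZ0 : 0 < Z := by positivity
  have point : ∀ α, Fsum Ms Hn N α ≤ 72 * W ^ 5 * (M * P) + ∑ i ∈ Finset.range (K + 2), 18 * W ^ 2 * Z / 2 ^ i * n i α := by
    intro α
    have hsum0 : 0 ≤ ∑ i ∈ Finset.range (K + 2), 18 * W ^ 2 * Z / 2 ^ i * n i α :=
      Finset.sum_nonneg (fun i _ => mul_nonneg (by positivity) (hn0 i α))
    by_cases hex : ∃ i, i < K + 2 ∧ ∃ (q : ℕ) (a : ℤ), 1 ≤ q ∧ (q : ℝ) ≤ X i ∧ |q * α - a| ≤ X i / Q ^ 4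
    · obtain ⟨hiK, q, a, hq1, hq2, hq3⟩ := Nat.find_spec hex
      have hmin := fun j => Nat.find_min hex (m := j)
      set i := Nat.find hex with hi
      have hni : n i α = 1 := min_eq_left (hmaj i α q a hq1 hq2 hq3)
      have hs := Finset.single_le_sum (f := fun i => 18 * W ^ 2 * Z / 2 ^ i * n i α)
        (fun j _ => mul_nonneg (by positivity) (hn0 j α)) (Finset.mem_range.2 hiK)
      simp only [hni, mul_one] at hs
      have h72 : 0 ≤ 72 * W ^ 5 * (M * P) := by positivity
      suffices Fsum Ms Hn N α ≤ 18 * W ^ 2 * Z / 2 ^ i by linarith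
      rcases Nat.eq_zero_or_pos i with h0 | hpos
      · rw [h0, pow_zero, div_one]
        refine (p.F_triv α Ms hMc Hn N hHn hN2).trans ?_
        have : W ≤ W ^ 2 := le_self_pow₀ hW (by norm_num)
        gcongr
        norm_num
      · obtain ⟨j, hj⟩ : ∃ j, i = j + 1 := ⟨i - 1, by omega⟩
        have hm := hmin j (by omega)
        push Not at hm
        have hXj : X j = 16 ^ j := by
          apply min_eq_left
          refine le_trans ?_ hK1
          exact pow_le_pow_right₀ (by norm_num) (by omega)
        have hm' := hm (by omega)
        rw [hXj] at hm'
        have hw := p.F_weyl α (16 ^ j) (one_le_pow₀ (by norm_num)) (by rw [← hXj]; exact hXiP j) Ms hMc Hn N hHn hN1 hN2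
          (fun q a h1 h2 => hm' q a h1 h2)
        have h16 : (16 : ℝ) ^ j = (2 ^ j) ^ 4 := by rw [← pow_mul, mul_comm, pow_mul]; norm_num
        have : Fsum Ms Hn N α ≤ 9 * W ^ 2 * Z / 2 ^ j := by
          apply le_of_pow_le_pow_left₀ (show 4 ≠ 0 by norm_num) (by positivity)
          refine hw.trans ?_
          rw [h16]
          have hWW : W ^ 7 ≤ W ^ 8 := pow_le_pow_right₀ hW (by norm_num)
          calc 5200 * W ^ 7 * (Z ^ 4 / (2 ^ j) ^ 4) ≤ 6561 * W ^ 8 * (Z ^ 4 / (2 ^ j) ^ 4) := by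
                gcongr
                norm_num
            _ = _ := by field_simp; ring
        rw [hj, pow_succ]
        calc _ ≤ 9 * W ^ 2 * Z / 2 ^ j := this
          _ = _ := by field_simp; ring
    · push Not at hex
      have hm := hex (K + 1) (by omega)
      have hXK : X (K + 1) = X1 := min_eq_right hK2.le
      rw [hXK] at hm
      have hw := p.F_minor α Y hY hY1 Ms hMs hMc Hn N hHn hN1 hN2 (fun q a h1 h2 => hm q a h1 h2)
      have : Fsum Ms Hn N α ≤ 72 * W ^ 5 * (M * P) := by
        apply le_of_pow_le_pow_left₀ (show 4 ≠ 0 by norm_num) (by positivity)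
        refine hw.trans ?_
        calc 26000000 * W ^ 20 * (M * P) ^ 4 ≤ 26873856 * W ^ 20 * (M * P) ^ 4 := by gcongr; norm_num
          _ = _ := by ring
      linarith
  have cG := (GA_cont A).norm
  have cn : ∀ i, Continuous (n i) := fun i => continuous_const.min (Nmaj_cont (L i) (Kq i))
  have h1 : ∫ α in (0 : ℝ)..1, Fsum Ms Hn N α * ‖GA A α‖ ^ 8 ≤
      ∫ α in (0 : ℝ)..1, (72 * W ^ 5 * (M * P) * ‖GA A α‖ ^ 8 + ∑ i ∈ Finset.range (K + 2), 18 * W ^ 2 * Z / 2 ^ i * (n i α * ‖GA A α‖ ^ 8)) := by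
    apply intervalIntegral.integral_mono_on (by norm_num)
    · exact ((Fsum_cont Ms Hn N).mul (cG.pow 8)).intervalIntegrable _ _
    · refine Continuous.intervalIntegrable ?_ _ _
      refine (continuous_const.mul (cG.pow 8)).add (continuous_finsetSum _ (fun i _ => ?_))
      exact continuous_const.mul ((cn i).mul (cG.pow 8))
    · intro α _
      calc _ ≤ (72 * W ^ 5 * (M * P) + ∑ i ∈ Finset.range (K + 2), 18 * W ^ 2 * Z / 2 ^ i * n i α) * ‖GA A α‖ ^ 8 := by
            gcongr; exact point α
        _ = _ := by
            rw [add_mul, Finset.sum_mul]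
            congr 1
            apply Finset.sum_congr rfl
            intro i _; ring
  have i1 : IntervalIntegrable (fun α => 72 * W ^ 5 * (M * P) * ‖GA A α‖ ^ 8) volume 0 1 :=
    (continuous_const.mul (cG.pow 8)).intervalIntegrable _ _
  have i2 : ∀ i ∈ Finset.range (K + 2), IntervalIntegrable (fun α => 18 * W ^ 2 * Z / 2 ^ i * (n i α * ‖GA A α‖ ^ 8)) volume 0 1 :=
    fun i _ => (continuous_const.mul ((cn i).mul (cG.pow 8))).intervalIntegrable _ _
  have i3 : IntervalIntegrable (fun α => ∑ i ∈ Finset.range (K + 2), 18 * W ^ 2 * Z / 2 ^ i * (n i α * ‖GA A α‖ ^ 8)) volume 0 1 := by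
    refine Continuous.intervalIntegrable (continuous_finsetSum _ (fun i _ => ?_)) _ _
    exact continuous_const.mul ((cn i).mul (cG.pow 8))
  rw [intervalIntegral.integral_add i1 i3,
    intervalIntegral.integral_const_mul, intervalIntegral.integral_finsetSum i2] at h1
  simp_rw [intervalIntegral.integral_const_mul] at h1
  refine h1.trans ?_
  gcongr ?_ + ?_
  · exact le_rfl
  have hterm : ∀ i ∈ Finset.range (K + 2), 18 * W ^ 2 * Z / 2 ^ i * (∫ α in (0 : ℝ)..1, n i α * ‖GA A α‖ ^ 8) ≤
      3474 * W ^ 4 * Z * (X1 ^ (1 / 12 : ℝ) * B ^ (2 / 3 : ℝ)) := by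
    intro i hi
    have ha := p.arc8 A B (X i) hB (hXi1 i) (L i) (Kq i) hB10 (hmom i)
    have hXi0 : 0 < X i := by linarith [hXi1 i]
    have hx : X i ^ (1 / 3 : ℝ) ≤ X1 ^ (1 / 12 : ℝ) * 2 ^ i := by
      calc X i ^ (1 / 3 : ℝ) = X i ^ (1 / 12 : ℝ) * X i ^ (1 / 4 : ℝ) := by
            rw [← Real.rpow_add hXi0]; norm_num
        _ ≤ X1 ^ (1 / 12 : ℝ) * (16 ^ i) ^ (1 / 4 : ℝ) := by
            gcongr
            · exact min_le_right _ _
            · exact min_le_left _ _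
        _ = _ := by
            congr 1
            have h16 : (16 : ℝ) ^ i = (2 ^ i) ^ 4 := by rw [← pow_mul, mul_comm, pow_mul]; norm_num
            rw [h16, ← Real.rpow_natCast (2 ^ i) 4, ← Real.rpow_mul (by positivity)]
            norm_num
    calc _ ≤ 18 * W ^ 2 * Z / 2 ^ i * (193 * W ^ 2 * (X i ^ (1 / 3 : ℝ) * B ^ (2 / 3 : ℝ))) := by gcongr
      _ ≤ 18 * W ^ 2 * Z / 2 ^ i * (193 * W ^ 2 * ((X1 ^ (1 / 12 : ℝ) * 2 ^ i) * B ^ (2 / 3 : ℝ))) := by gcongr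
      _ = _ := by field_simp; ring
  have hKW : (K : ℝ) + 1 ≤ 2 * W := by
    apply p.log_count X1 hX1 (p.hXP.trans p.PleP20)
    refine le_trans ?_ hK1
    gcongr
    norm_num
  calc _ ≤ ∑ i ∈ Finset.range (K + 2), 3474 * W ^ 4 * Z * (X1 ^ (1 / 12 : ℝ) * B ^ (2 / 3 : ℝ)) := Finset.sum_le_sum hterm
    _ = (K + 2) * (3474 * W ^ 4 * Z * (X1 ^ (1 / 12 : ℝ) * B ^ (2 / 3 : ℝ))) := by simp
    _ ≤ (3 * W) * (3474 * W ^ 4 * Z * (X1 ^ (1 / 12 : ℝ) * B ^ (2 / 3 : ℝ))) := by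
        gcongr
        linarith
    _ = 10422 * W ^ 5 * Z * (X1 ^ (1 / 12 : ℝ) * B ^ (2 / 3 : ℝ)) := by ring
    _ ≤ _ := by
        gcongr
        norm_num

end Par


/-! ### Tools: eighth moments as counts -/

/-- the signs of the eight variables -/
def sgn8 (i : Fin 8) : ℤ := if i.val < 4 then 1 else -1

lemma sgn8_cases (i : Fin 8) : sgn8 i = 1 ∨ sgn8 i = -1 := by
  unfold sgn8; split_ifs <;> simp

lemma norm_sum_sign {ι : Type*} (s : Finset ι) (φ : ι → ℤ) (σ : ℤ) (hσ : σ = 1 ∨ σ = -1) (α : ℝ) :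
    ‖∑ x ∈ s, eC (α * ((σ * φ x : ℤ) : ℝ))‖ = ‖∑ x ∈ s, eC (α * (φ x : ℝ))‖ := by
  rcases hσ with h | h
  · subst h; simp
  · subst h
    rw [← Complex.norm_conj, map_sum]
    congr 1
    apply Finset.sum_congr rfl
    intro x _
    rw [← eC_neg]; congr 1; push_cast; ring

lemma prod_eC {n : ℕ} (A : Fin n → Finset ℕ) (φ : Fin n → ℕ → ℤ) (α : ℝ) :
    ∑ u ∈ Fintype.piFinset A, eC (α * ((∑ i, φ i (u i) : ℤ) : ℝ)) = ∏ i, ∑ x ∈ A i, eC (α * (φ i x : ℝ)) := by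
  rw [Finset.prod_univ_sum]
  apply Finset.sum_congr rfl
  intro u _
  rw [← eC_sum]; congr 1; push_cast; rw [Finset.mul_sum]

lemma prod_sgn8 (F : ℂ) (G : Fin 8 → ℂ) (h1 : ∀ i : Fin 8, i.val < 4 → G i = F)
    (h2 : ∀ i : Fin 8, ¬ i.val < 4 → G i = starRingEnd ℂ F) : ∏ i, G i = ((‖F‖ ^ 8 : ℝ) : ℂ) := by
  rw [Fin.prod_univ_eight, h1 0 (by decide), h1 1 (by decide), h1 2 (by decide), h1 3 (by decide),
    h2 4 (by decide), h2 5 (by decide), h2 6 (by decide), h2 7 (by decide)]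
  have h : F * starRingEnd ℂ F = ((‖F‖ ^ 2 : ℝ) : ℂ) := by
    rw [Complex.mul_conj, Complex.normSq_eq_norm_sq]
  calc F * F * F * F * (starRingEnd ℂ) F * (starRingEnd ℂ) F * (starRingEnd ℂ) F * (starRingEnd ℂ) F
      = (F * starRingEnd ℂ F) ^ 4 := by ring
    _ = _ := by rw [h]; push_cast; ring

lemma rep8 (F : ℝ → ℂ) (A : Finset ℕ) (φ : ℕ → ℤ) (hF : ExpRep F A φ) :
    ExpRep (fun α => ((‖F α‖ ^ 8 : ℝ) : ℂ)) (Fintype.piFinset (fun _ : Fin 8 => A))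
      (fun u => ∑ i, sgn8 i * φ (u i)) := by
  intro α
  have h := prod_eC (fun _ : Fin 8 => A) (fun i x => sgn8 i * φ x) α
  rw [h]
  symm
  apply prod_sgn8
  · intro i hi
    rw [hF α]
    apply Finset.sum_congr rfl
    intro x _
    simp [sgn8, hi]
  · intro i hi
    rw [hF α, map_sum]
    apply Finset.sum_congr rfl
    intro x _
    rw [← eC_neg]; congr 1; simp [sgn8, hi]

/-! ### Splitting into classes -/

lemma classSq_rep {ι κ : Type*} [DecidableEq κ] (X : Finset ι) (φ : ι → ℤ) (c : ι → κ) :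
    ExpRep (fun α => ((∑ r ∈ X.image c, ‖∑ x ∈ X.filter (fun x => c x = r), eC (α * (φ x : ℝ))‖ ^ 2 : ℝ) : ℂ))
      ((X ×ˢ X).filter (fun p => c p.1 = c p.2)) (fun p => φ p.1 - φ p.2) := by
  intro α
  show ((∑ r ∈ X.image c, ‖∑ x ∈ X.filter (fun x => c x = r), eC (α * (φ x : ℝ))‖ ^ 2 : ℝ) : ℂ) = _
  rw [Complex.ofReal_sum]
  have h : ∀ r ∈ X.image c, ((‖∑ x ∈ X.filter (fun x => c x = r), eC (α * (φ x : ℝ))‖ ^ 2 : ℝ) : ℂ) =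
      ∑ p ∈ ((X ×ˢ X).filter (fun p => c p.1 = c p.2)).filter (fun p => c p.1 = r), eC (α * ((φ p.1 - φ p.2 : ℤ) : ℝ)) := by
    intro r _
    have h0 : ExpRep (fun α => ∑ x ∈ X.filter (fun x => c x = r), eC (α * (φ x : ℝ))) (X.filter (fun x => c x = r)) φ :=
      fun α => rfl
    have h1 := h0.normSq α
    refine h1.trans ?_
    apply Finset.sum_congr _ (fun _ _ => rfl)
    ext p
    simp only [Finset.mem_product, Finset.mem_filter]
    constructor
    · rintro ⟨⟨a, b⟩, c, d⟩; exact ⟨⟨⟨a, c⟩, b.trans d.symm⟩, b⟩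
    · rintro ⟨⟨⟨a, c⟩, b⟩, d⟩; exact ⟨⟨a, d⟩, c, b ▸ d⟩
  rw [Finset.sum_congr rfl h]
  apply Finset.sum_fiberwise_of_maps_to
  intro p hp
  simp only [Finset.mem_filter, Finset.mem_product] at hp
  exact Finset.mem_image_of_mem _ hp.1.1

lemma class_kappa {ι κ μ : Type*} [DecidableEq κ] [DecidableEq μ] (X : Finset ι) (f : ι → ℂ) (c : ι → κ) (h : κ → μ) (k : ℝ)
    (hk0 : 0 ≤ k) (hk : ∀ s, (((X.image c).filter (fun r => h r = s)).card : ℝ) ≤ k) :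
    ∑ s ∈ X.image (fun x => h (c x)), ‖∑ x ∈ X.filter (fun x => h (c x) = s), f x‖ ^ 2 ≤
      k * ∑ r ∈ X.image c, ‖∑ x ∈ X.filter (fun x => c x = r), f x‖ ^ 2 := by
  have h1 : ∀ s ∈ X.image (fun x => h (c x)), ‖∑ x ∈ X.filter (fun x => h (c x) = s), f x‖ ^ 2 ≤
      k * ∑ r ∈ (X.image c).filter (fun r => h r = s), ‖∑ x ∈ X.filter (fun x => c x = r), f x‖ ^ 2 := by
    intro s _
    have e : ∑ x ∈ X.filter (fun x => h (c x) = s), f x =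
        ∑ r ∈ (X.image c).filter (fun r => h r = s), ∑ x ∈ X.filter (fun x => c x = r), f x := by
      rw [← Finset.sum_fiberwise_of_maps_to (s := X.filter (fun x => h (c x) = s)) (t := (X.image c).filter (fun r => h r = s)) (g := c)]
      · apply Finset.sum_congr rfl
        intro r hr
        rw [Finset.mem_filter] at hr
        apply Finset.sum_congr _ (fun _ _ => rfl)
        ext x
        simp only [Finset.mem_filter]
        constructor
        · rintro ⟨⟨a, b⟩, c⟩; exact ⟨a, c⟩
        · rintro ⟨a, b⟩; exact ⟨⟨a, by rw [b]; exact hr.2⟩, b⟩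
      · intro x hx
        rw [Finset.mem_filter] at hx ⊢
        exact ⟨Finset.mem_image_of_mem _ hx.1, hx.2⟩
    rw [e]
    calc _ ≤ (∑ r ∈ (X.image c).filter (fun r => h r = s), ‖∑ x ∈ X.filter (fun x => c x = r), f x‖) ^ 2 := by
          gcongr; exact norm_sum_le _ _
      _ ≤ (((X.image c).filter (fun r => h r = s)).card : ℝ) *
          ∑ r ∈ (X.image c).filter (fun r => h r = s), ‖∑ x ∈ X.filter (fun x => c x = r), f x‖ ^ 2 :=
          sq_sum_le_card_mul_sum_sq
      _ ≤ _ := by gcongr; exact hk s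
  refine (Finset.sum_le_sum h1).trans ?_
  rw [← Finset.mul_sum]
  apply mul_le_mul_of_nonneg_left _ hk0
  apply le_of_eq
  apply Finset.sum_fiberwise_of_maps_to
  intro r hr
  rw [Finset.mem_image] at hr ⊢
  obtain ⟨x, hx, rfl⟩ := hr
  exact ⟨x, hx, rfl⟩


/-! ### The congruence step -/

lemma fibre_count (q : ℕ) [NeZero q] (X : Finset ℕ) (hX : ∀ x ∈ X, Nat.Coprime x q) (s : ZMod q) :
    ((((X.image (fun x : ℕ => (x : ZMod q))).filter (fun r => r ^ 4 = s)).card : ℕ) : ℝ) ≤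
      ((2 * q.divisors.card) ^ 2 : ℕ) := by
  have h0 := root_count_four q
  norm_cast
  by_cases hne : ((X.image (fun x : ℕ => (x : ZMod q))).filter (fun r => r ^ 4 = s)).Nonempty
  · obtain ⟨r0, hr0⟩ := hne
    rw [Finset.mem_filter, Finset.mem_image] at hr0
    obtain ⟨⟨x0, hx0, rfl⟩, h4⟩ := hr0
    refine le_trans ?_ h0
    refine le_trans (Finset.card_le_card ?_) (Finset.card_image_le (f := fun u : (ZMod q)ˣ => (u : ZMod q) * (x0 : ZMod q)))
    intro r hr
    rw [Finset.mem_filter, Finset.mem_image] at hr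
    obtain ⟨⟨x, hx, rfl⟩, h5⟩ := hr
    rw [Finset.mem_image]
    refine ⟨quoUnit q x x0, ?_, quoUnit_mul (hX x hx) (hX x0 hx0)⟩
    rw [Finset.mem_filter]
    exact ⟨Finset.mem_univ _, quoUnit_pow (hX x hx) (hX x0 hx0) 4 (h5.trans h4.symm)⟩
  · rw [Finset.not_nonempty_iff_eq_empty] at hne
    rw [hne]; simp

/-- the mean value attached to a modulus -/
noncomputable def Jm (X A : Finset ℕ) (m : ℕ) : ℝ :=
  ∫ α in (0 : ℝ)..1, ‖∑ x ∈ X, eC (α * (((x : ℤ) ^ 4 : ℤ) : ℝ))‖ ^ 2 *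
    ‖∑ w ∈ A, eC (α * (((m : ℤ) ^ 4 * (w : ℤ) ^ 4 : ℤ) : ℝ))‖ ^ 8

lemma Jm_class (X A : Finset ℕ) (m : ℕ) (hm : 1 ≤ m) (hX : ∀ x ∈ X, Nat.Coprime x m) :
    Jm X A m ≤ ((2 * (m ^ 4).divisors.card) ^ 2 : ℕ) *
      (((((X ×ˢ X).filter (fun p => (p.1 : ZMod (m ^ 4)) = (p.2 : ZMod (m ^ 4)))) ×ˢ
        (Fintype.piFinset (fun _ : Fin 8 => A))).filter (fun i => ((i.1.1 : ℤ) ^ 4 - (i.1.2 : ℤ) ^ 4) +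
          ∑ j, sgn8 j * ((m : ℤ) ^ 4 * (i.2 j : ℤ) ^ 4) = 0)).card : ℝ) := by
  have : NeZero (m ^ 4) := ⟨by positivity⟩
  set K : ℝ → ℝ := fun α => ‖∑ w ∈ A, eC (α * (((m : ℤ) ^ 4 * (w : ℤ) ^ 4 : ℤ) : ℝ))‖ ^ 8 with hK
  have repK : ExpRep (fun α => ((K α : ℝ) : ℂ)) (Fintype.piFinset (fun _ : Fin 8 => A))
      (fun u => ∑ j, sgn8 j * ((m : ℤ) ^ 4 * (u j : ℤ) ^ 4)) :=
    rep8 _ A (fun w => (m : ℤ) ^ 4 * (w : ℤ) ^ 4) (fun α => rfl)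
  have repX : ExpRep (fun α => ∑ x ∈ X, eC (α * (((x : ℤ) ^ 4 : ℤ) : ℝ))) X (fun x => (x : ℤ) ^ 4) := fun α => rfl
  have r1 := repX.normSq.mul repK
  have e1 : Jm X A m = _ := (ExpRep.card (F := fun α => ‖∑ x ∈ X, eC (α * (((x : ℤ) ^ 4 : ℤ) : ℝ))‖ ^ 2 * K α)
    (by intro α; rw [← r1 α]; push_cast; rfl))
  set c : ℕ → ZMod (m ^ 4) := fun x => (x : ZMod (m ^ 4)) with hc
  set h : ZMod (m ^ 4) → ZMod (m ^ 4) := fun r => r ^ 4 with hh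
  have r2 := (classSq_rep X (fun x => (x : ℤ) ^ 4) (fun x => h (c x))).mul repK
  have r3 := (classSq_rep X (fun x => (x : ℤ) ^ 4) c).mul repK
  have e2 := ExpRep.card (F := fun α => (∑ r ∈ X.image (fun x => h (c x)),
      ‖∑ x ∈ X.filter (fun x => h (c x) = r), eC (α * (((x : ℤ) ^ 4 : ℤ) : ℝ))‖ ^ 2) * K α)
    (by intro α; rw [← r2 α]; push_cast; rfl)
  have e3 := ExpRep.card (F := fun α => (∑ r ∈ X.image c,
      ‖∑ x ∈ X.filter (fun x => c x = r), eC (α * (((x : ℤ) ^ 4 : ℤ) : ℝ))‖ ^ 2) * K α)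
    (by intro α; rw [← r3 α]; push_cast; rfl)
  rw [← e3, e1]
  have hle : ((((X ×ˢ X) ×ˢ (Fintype.piFinset (fun _ : Fin 8 => A))).filter (fun i => ((i.1.1 : ℤ) ^ 4 - (i.1.2 : ℤ) ^ 4) +
          ∑ j, sgn8 j * ((m : ℤ) ^ 4 * (i.2 j : ℤ) ^ 4) = 0)).card : ℝ) ≤
      ((((X ×ˢ X).filter (fun p => h (c p.1) = h (c p.2)) ×ˢ (Fintype.piFinset (fun _ : Fin 8 => A))).filter
        (fun i => ((i.1.1 : ℤ) ^ 4 - (i.1.2 : ℤ) ^ 4) +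
          ∑ j, sgn8 j * ((m : ℤ) ^ 4 * (i.2 j : ℤ) ^ 4) = 0)).card : ℝ) := by
    apply Nat.cast_le.mpr
    apply Finset.card_le_card
    intro i hi
    rw [Finset.mem_filter, Finset.mem_product] at hi ⊢
    obtain ⟨⟨h1, h2⟩, h3⟩ := hi
    refine ⟨⟨?_, h2⟩, h3⟩
    rw [Finset.mem_filter]
    refine ⟨h1, ?_⟩
    have h4 : (i.1.1 : ℤ) ^ 4 - (i.1.2 : ℤ) ^ 4 = (m : ℤ) ^ 4 * (-∑ j, sgn8 j * (i.2 j : ℤ) ^ 4) := by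
      have : ∑ j, sgn8 j * ((m : ℤ) ^ 4 * (i.2 j : ℤ) ^ 4) = (m : ℤ) ^ 4 * ∑ j, sgn8 j * (i.2 j : ℤ) ^ 4 := by
        rw [Finset.mul_sum]; apply Finset.sum_congr rfl; intros; ring
      linarith
    have h5 := congrArg (fun z : ℤ => (z : ZMod (m ^ 4))) h4
    have h6 : ((m : ZMod (m ^ 4))) ^ 4 = 0 := by
      have := ZMod.natCast_self (m ^ 4)
      rwa [Nat.cast_pow] at this
    simp only [Int.cast_mul, Int.cast_pow, Int.cast_natCast, Int.cast_sub] at h5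
    rw [h6, zero_mul, sub_eq_zero] at h5
    exact h5
  refine hle.trans ?_
  rw [← e2, ← intervalIntegral.integral_const_mul]
  have cK : Continuous K := by
    have := repK.continuous
    have h2 : K = fun α => (((K α : ℝ) : ℂ)).re := by funext α; simp
    rw [h2]; exact Complex.continuous_re.comp this
  have cS : ∀ s : Finset ℕ, Continuous (fun α : ℝ => ‖∑ x ∈ s, eC (α * (((x : ℤ) ^ 4 : ℤ) : ℝ))‖ ^ 2) := by
    intro s
    have : ExpRep (fun α => ∑ x ∈ s, eC (α * (((x : ℤ) ^ 4 : ℤ) : ℝ))) s (fun x => (x : ℤ) ^ 4) := fun α => rfl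
    exact this.continuous.norm.pow 2
  apply intervalIntegral.integral_mono_on (by norm_num)
  · apply Continuous.intervalIntegrable
    exact (continuous_finsetSum _ (fun r _ => cS _)).mul cK
  · apply Continuous.intervalIntegrable
    exact continuous_const.mul ((continuous_finsetSum _ (fun r _ => cS _)).mul cK)
  · intro α _
    rw [← mul_assoc]
    apply mul_le_mul_of_nonneg_right _ (by positivity)
    apply class_kappa X _ c h _ (by positivity)
    intro s
    exact fibre_count (m ^ 4) X (fun x hx => (hX x hx).pow_right 4) s

lemma lag_count (A : Finset ℕ) (m Hn N : ℕ) (σ : ℤ) (hσ : σ = 1 ∨ σ = -1) :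
    ((((Finset.Icc 1 Hn ×ˢ Finset.Icc 1 N) ×ˢ (Fintype.piFinset (fun _ : Fin 8 => A))).filter
      (fun i => σ * ((i.1.1 * i.1.2 ^ 3 + i.1.1 ^ 3 * m ^ 8 * i.1.2 : ℕ) : ℤ) + ∑ j, sgn8 j * (2 * (i.2 j : ℤ) ^ 4) = 0)).card : ℝ)
      ≤ ∫ α in (0 : ℝ)..1, (∑ h ∈ Finset.Icc 1 Hn, ‖Phi N α h m‖) * ‖GA A α‖ ^ 8 := by
  apply card_le_integral
  · exact (continuous_finsetSum _ (fun h _ => (Phi_cont N h m).norm)).mul ((GA_cont A).norm.pow 8)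
  · intro α
    have r8 := rep8 (GA A) A (fun x => 2 * (x : ℤ) ^ 4) (GA_rep A)
    have r1 : ExpRep (fun α => ∑ q ∈ Finset.Icc 1 Hn ×ˢ Finset.Icc 1 N,
        eC (α * ((σ * ((q.1 * q.2 ^ 3 + q.1 ^ 3 * m ^ 8 * q.2 : ℕ) : ℤ) : ℤ) : ℝ)))
        (Finset.Icc 1 Hn ×ˢ Finset.Icc 1 N) (fun q => σ * ((q.1 * q.2 ^ 3 + q.1 ^ 3 * m ^ 8 * q.2 : ℕ) : ℤ)) := fun α => rfl
    have := (r1.mul r8) α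
    rw [← this, norm_mul]
    apply mul_le_mul
    · rw [Finset.sum_product]
      refine (norm_sum_le _ _).trans ?_
      apply Finset.sum_le_sum
      intro h _
      apply le_of_eq
      refine (norm_sum_sign (Finset.Icc 1 N) (fun z => ((h * z ^ 3 + h ^ 3 * m ^ 8 * z : ℕ) : ℤ)) σ hσ α).trans ?_
      unfold Phi
      congr 1
    · rw [Complex.norm_real, Real.norm_of_nonneg (by positivity)]
    · positivity
    · positivity

lemma sgn_sum_two (m : ℕ) (u : Fin 8 → ℕ) :
    2 * ∑ j, sgn8 j * ((m : ℤ) ^ 4 * (u j : ℤ) ^ 4) = (m : ℤ) ^ 4 * ∑ j, sgn8 j * (2 * (u j : ℤ) ^ 4) := by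
  rw [Finset.mul_sum, Finset.mul_sum]; apply Finset.sum_congr rfl; intros; ring

lemma diff_fact (x y m h : ℕ) (hxy : x = y + h * m ^ 4) :
    2 * ((x : ℤ) ^ 4 - (y : ℤ) ^ 4) = (m : ℤ) ^ 4 * ((h * (x + y) ^ 3 + h ^ 3 * m ^ 8 * (x + y) : ℕ) : ℤ) := by
  subst hxy; push_cast; ring

lemma zmod_lag {m x y : ℕ} (hyx : y < x) (h : (x : ZMod (m ^ 4)) = (y : ZMod (m ^ 4))) :
    ∃ k, x = y + k * m ^ 4 := by
  have h1 : (y : ℕ) ≡ x [MOD m ^ 4] := (ZMod.natCast_eq_natCast_iff _ _ _).1 h.symm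
  have h2 := (Nat.modEq_iff_dvd' hyx.le).1 h1
  obtain ⟨k, hk⟩ := h2
  exact ⟨k, by rw [mul_comm k]; omega⟩

set_option maxHeartbeats 1000000 in
lemma lag_side (X A : Finset ℕ) (m Hn N : ℕ) (hm : 1 ≤ m) (hX : ∀ x ∈ X, 1 ≤ x ∧ 2 * x ≤ N ∧ x < (Hn + 1) * m ^ 4)
    (S : Finset ((ℕ × ℕ) × (Fin 8 → ℕ))) (σ : ℤ) (hσ : σ = 1 ∨ σ = -1)
    (hS : ∀ i ∈ S, i.1.1 ∈ X ∧ i.1.2 ∈ X ∧ i.2 ∈ Fintype.piFinset (fun _ : Fin 8 => A) ∧ i.1.2 < i.1.1 ∧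
      (i.1.1 : ZMod (m ^ 4)) = (i.1.2 : ZMod (m ^ 4)) ∧
      σ * ((i.1.1 : ℤ) ^ 4 - (i.1.2 : ℤ) ^ 4) + ∑ j, sgn8 j * ((m : ℤ) ^ 4 * (i.2 j : ℤ) ^ 4) = 0) :
    (S.card : ℝ) ≤ ∫ α in (0 : ℝ)..1, (∑ h ∈ Finset.Icc 1 Hn, ‖Phi N α h m‖) * ‖GA A α‖ ^ 8 := by
  refine le_trans ?_ (lag_count A m Hn N σ hσ)
  apply Nat.cast_le.mpr
  have hm4 : 0 < m ^ 4 := by positivity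
  apply Finset.card_le_card_of_injOn (fun i => (((i.1.1 - i.1.2) / m ^ 4, i.1.1 + i.1.2), i.2))
  · intro i hi
    obtain ⟨h1, h2, h3, h4, h5, h6⟩ := hS i hi
    obtain ⟨k, hk⟩ := zmod_lag h4 h5
    have hk1 : (i.1.1 - i.1.2) / m ^ 4 = k := by
      rw [hk, Nat.add_sub_cancel_left, Nat.mul_div_cancel _ hm4]
    rw [Finset.mem_coe, Finset.mem_filter, Finset.mem_product, Finset.mem_product, Finset.mem_Icc, Finset.mem_Icc]
    simp only [hk1]
    have hk0 : 1 ≤ k := by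
      rcases Nat.eq_zero_or_pos k with h | h
      · subst h; omega
      · exact h
    have hkH : k ≤ Hn := by
      have := (hX _ h1).2.2
      have h7 : k * m ^ 4 < (Hn + 1) * m ^ 4 := by omega
      exact Nat.lt_succ_iff.1 (lt_of_mul_lt_mul_right h7 (by positivity))
    refine ⟨⟨⟨⟨hk0, hkH⟩, ?_, ?_⟩, h3⟩, ?_⟩
    · have := (hX _ h1).1; omega
    · have := (hX _ h1).2.1; omega
    · have e1 := diff_fact i.1.1 i.1.2 m k hk
      have e2 := sgn_sum_two m i.2
      have hm4' : (m : ℤ) ^ 4 ≠ 0 := by positivity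
      apply mul_left_cancel₀ hm4'
      rw [mul_add, mul_zero, ← e2, mul_left_comm, ← e1]
      linarith
  · intro i hi i' hi' heq
    obtain ⟨h1, h2, h3, h4, h5, h6⟩ := hS i hi
    obtain ⟨g1, g2, g3, g4, g5, g6⟩ := hS i' hi'
    obtain ⟨k, hk⟩ := zmod_lag h4 h5
    obtain ⟨l, hl⟩ := zmod_lag g4 g5
    have hk1 : (i.1.1 - i.1.2) / m ^ 4 = k := by
      rw [hk, Nat.add_sub_cancel_left, Nat.mul_div_cancel _ hm4]
    have hl1 : (i'.1.1 - i'.1.2) / m ^ 4 = l := by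
      rw [hl, Nat.add_sub_cancel_left, Nat.mul_div_cancel _ hm4]
    simp only [Prod.mk.injEq, hk1, hl1] at heq
    obtain ⟨⟨e1, e2⟩, e3⟩ := heq
    subst e1
    apply Prod.ext _ e3
    apply Prod.ext <;> omega

set_option maxHeartbeats 1000000 in
lemma Jm_bound (X A : Finset ℕ) (m Hn N : ℕ) (hm : 1 ≤ m)
    (hX : ∀ x ∈ X, 1 ≤ x ∧ 2 * x ≤ N ∧ x < (Hn + 1) * m ^ 4) (hco : ∀ x ∈ X, Nat.Coprime x m) :
    Jm X A m ≤ ((2 * (m ^ 4).divisors.card) ^ 2 : ℕ) * (X.card * (∫ α in (0 : ℝ)..1, ‖GA A α‖ ^ 8) +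
      2 * ∫ α in (0 : ℝ)..1, (∑ h ∈ Finset.Icc 1 Hn, ‖Phi N α h m‖) * ‖GA A α‖ ^ 8) := by
  refine (Jm_class X A m hm hco).trans ?_
  apply mul_le_mul_of_nonneg_left _ (by positivity)
  set T := ((((X ×ˢ X).filter (fun p => (p.1 : ZMod (m ^ 4)) = (p.2 : ZMod (m ^ 4)))) ×ˢ
        (Fintype.piFinset (fun _ : Fin 8 => A))).filter (fun i => ((i.1.1 : ℤ) ^ 4 - (i.1.2 : ℤ) ^ 4) +
          ∑ j, sgn8 j * ((m : ℤ) ^ 4 * (i.2 j : ℤ) ^ 4) = 0)) with hT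
  have hmem : ∀ i ∈ T, i.1.1 ∈ X ∧ i.1.2 ∈ X ∧ i.2 ∈ Fintype.piFinset (fun _ : Fin 8 => A) ∧
      (i.1.1 : ZMod (m ^ 4)) = (i.1.2 : ZMod (m ^ 4)) ∧
      ((i.1.1 : ℤ) ^ 4 - (i.1.2 : ℤ) ^ 4) + ∑ j, sgn8 j * ((m : ℤ) ^ 4 * (i.2 j : ℤ) ^ 4) = 0 := by
    intro i hi
    rw [hT, Finset.mem_filter, Finset.mem_product, Finset.mem_filter, Finset.mem_product] at hi
    obtain ⟨⟨⟨⟨a, b⟩, c⟩, d⟩, e⟩ := hi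
    exact ⟨a, b, d, c, e⟩
  have hsplit : T.card ≤ (T.filter (fun i => i.1.1 = i.1.2)).card + (T.filter (fun i => i.1.2 < i.1.1)).card +
      (T.filter (fun i => i.1.1 < i.1.2)).card := by
    have : T ⊆ (T.filter (fun i => i.1.1 = i.1.2) ∪ T.filter (fun i => i.1.2 < i.1.1)) ∪
        T.filter (fun i => i.1.1 < i.1.2) := by
      intro i hi
      simp only [Finset.mem_union, Finset.mem_filter]
      rcases lt_trichotomy i.1.1 i.1.2 with h | h | h
      · exact Or.inr ⟨hi, h⟩
      · exact Or.inl (Or.inl ⟨hi, h⟩)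
      · exact Or.inl (Or.inr ⟨hi, h⟩)
    refine (Finset.card_le_card this).trans ((Finset.card_union_le _ _).trans ?_)
    exact Nat.add_le_add_right (Finset.card_union_le _ _) _
  have b1 : ((T.filter (fun i => i.1.1 = i.1.2)).card : ℝ) ≤ X.card * (∫ α in (0 : ℝ)..1, ‖GA A α‖ ^ 8) := by
    rw [ExpRep.card (rep8 (GA A) A (fun x => 2 * (x : ℤ) ^ 4) (GA_rep A)), ← Nat.cast_mul, ← Finset.card_product]
    apply Nat.cast_le.mpr
    apply Finset.card_le_card_of_injOn (fun i => (i.1.1, i.2))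
    · intro i hi
      rw [Finset.mem_coe, Finset.mem_filter] at hi
      obtain ⟨a, b, c, d, e⟩ := hmem i hi.1
      rw [Finset.mem_coe, Finset.mem_product, Finset.mem_filter]
      refine ⟨a, c, ?_⟩
      rw [hi.2, sub_self, zero_add] at e
      have e2 := sgn_sum_two m i.2
      rw [e, mul_zero] at e2
      have hm4' : (m : ℤ) ^ 4 ≠ 0 := by positivity
      exact (mul_eq_zero.1 e2.symm).resolve_left hm4'
    · intro i hi i' hi' heq
      rw [Finset.mem_coe, Finset.mem_filter] at hi hi'
      simp only [Prod.mk.injEq] at heq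
      apply Prod.ext _ heq.2
      apply Prod.ext heq.1
      rw [← hi.2, ← hi'.2]; exact heq.1
  have b2 : ((T.filter (fun i => i.1.2 < i.1.1)).card : ℝ) ≤
      ∫ α in (0 : ℝ)..1, (∑ h ∈ Finset.Icc 1 Hn, ‖Phi N α h m‖) * ‖GA A α‖ ^ 8 := by
    apply lag_side X A m Hn N hm hX _ 1 (Or.inl rfl)
    intro i hi
    rw [Finset.mem_filter] at hi
    obtain ⟨a, b, c, d, e⟩ := hmem i hi.1
    exact ⟨a, b, c, hi.2, d, by rw [one_mul]; exact e⟩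
  have b3 : ((T.filter (fun i => i.1.1 < i.1.2)).card : ℝ) ≤
      ∫ α in (0 : ℝ)..1, (∑ h ∈ Finset.Icc 1 Hn, ‖Phi N α h m‖) * ‖GA A α‖ ^ 8 := by
    have : (T.filter (fun i => i.1.1 < i.1.2)).card =
        ((T.filter (fun i => i.1.1 < i.1.2)).image (fun i => ((i.1.2, i.1.1), i.2))).card := by
      rw [Finset.card_image_of_injective]
      intro i i' h
      simp only [Prod.mk.injEq] at h
      exact Prod.ext (Prod.ext h.1.2 h.1.1) h.2
    rw [this]
    apply lag_side X A m Hn N hm hX _ (-1) (Or.inr rfl)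
    intro i hi
    rw [Finset.mem_image] at hi
    obtain ⟨i, hi, rfl⟩ := hi
    rw [Finset.mem_filter] at hi
    obtain ⟨a, b, c, d, e⟩ := hmem i hi.1
    exact ⟨b, a, c, hi.2, d.symm, by rw [← e]; ring⟩
  have : (T.card : ℝ) ≤ (T.filter (fun i => i.1.1 = i.1.2)).card + (T.filter (fun i => i.1.2 < i.1.1)).card +
      (T.filter (fun i => i.1.1 < i.1.2)).card := by exact_mod_cast hsplit
  linarith


/-! ### Good solutions -/

lemma Jm_eq (X A : Finset ℕ) (m : ℕ) :
    Jm X A m = ((((X ×ˢ X) ×ˢ (Fintype.piFinset (fun _ : Fin 8 => A))).filter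
      (fun i => ((i.1.1 : ℤ) ^ 4 - (i.1.2 : ℤ) ^ 4) + ∑ j, sgn8 j * ((m : ℤ) ^ 4 * (i.2 j : ℤ) ^ 4) = 0)).card : ℝ) := by
  have repK : ExpRep (fun α => ((‖∑ w ∈ A, eC (α * (((m : ℤ) ^ 4 * (w : ℤ) ^ 4 : ℤ) : ℝ))‖ ^ 8 : ℝ) : ℂ))
      (Fintype.piFinset (fun _ : Fin 8 => A))
      (fun u => ∑ j, sgn8 j * ((m : ℤ) ^ 4 * (u j : ℤ) ^ 4)) :=
    rep8 _ A (fun w => (m : ℤ) ^ 4 * (w : ℤ) ^ 4) (fun α => rfl)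
  have repX : ExpRep (fun α => ∑ x ∈ X, eC (α * (((x : ℤ) ^ 4 : ℤ) : ℝ))) X (fun x => (x : ℤ) ^ 4) := fun α => rfl
  have r1 := repX.normSq.mul repK
  exact ExpRep.card (F := fun α => ‖∑ x ∈ X, eC (α * (((x : ℤ) ^ 4 : ℤ) : ℝ))‖ ^ 2 *
    ‖∑ w ∈ A, eC (α * (((m : ℤ) ^ 4 * (w : ℤ) ^ 4 : ℤ) : ℝ))‖ ^ 8)
    (by intro α; rw [← r1 α]; push_cast; rfl)

lemma Jm_mono (X X' A : Finset ℕ) (m : ℕ) (h : X ⊆ X') : Jm X A m ≤ Jm X' A m := by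
  rw [Jm_eq, Jm_eq]
  apply Nat.cast_le.mpr
  apply Finset.card_le_card
  apply Finset.filter_subset_filter
  exact Finset.product_subset_product (Finset.product_subset_product h h) (Finset.Subset.refl _)

lemma prod_le_sum8 (a : Fin 8 → ℝ) (ha : ∀ i, 0 ≤ a i) : ∏ i, a i ≤ ∑ i, a i ^ 8 := by
  obtain ⟨k, _, hk⟩ := Finset.exists_max_image Finset.univ a ⟨0, Finset.mem_univ _⟩
  calc ∏ i, a i ≤ ∏ _i : Fin 8, a k := Finset.prod_le_prod (fun i _ => ha i) (fun i hi => hk i hi)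
    _ = a k ^ 8 := by simp
    _ ≤ _ := Finset.single_le_sum (f := fun i => a i ^ 8) (fun i _ => pow_nonneg (ha i) 8) (Finset.mem_univ k)

lemma S_cont (s : Finset ℕ) (φ : ℕ → ℤ) : Continuous (fun α : ℝ => ∑ x ∈ s, eC (α * (φ x : ℝ))) :=
  ExpRep.continuous (s := s) (φ := φ) (fun _ => rfl)

lemma tuple_count (X A : Finset ℕ) (μ : Fin 8 → ℕ) :
    ((((X ×ˢ X) ×ˢ (Fintype.piFinset (fun _ : Fin 8 => A))).filter
      (fun i => ((i.1.1 : ℤ) ^ 4 - (i.1.2 : ℤ) ^ 4) + ∑ j, sgn8 j * ((μ j : ℤ) ^ 4 * (i.2 j : ℤ) ^ 4) = 0)).card : ℝ)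
      ≤ ∑ j, Jm X A (μ j) := by
  unfold Jm
  rw [← intervalIntegral.integral_finsetSum]
  · apply card_le_integral
    · apply continuous_finsetSum
      intro j _
      exact ((S_cont X (fun x => (x : ℤ) ^ 4)).norm.pow 2).mul
        ((S_cont A (fun w => (μ j : ℤ) ^ 4 * (w : ℤ) ^ 4)).norm.pow 8)
    · intro α
      have repX : ExpRep (fun α => ∑ x ∈ X, eC (α * (((x : ℤ) ^ 4 : ℤ) : ℝ))) X (fun x => (x : ℤ) ^ 4) := fun α => rfl
      have rK : ExpRep (fun α => ∏ j, ∑ w ∈ A, eC (α * ((sgn8 j * ((μ j : ℤ) ^ 4 * (w : ℤ) ^ 4) : ℤ) : ℝ)))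
          (Fintype.piFinset (fun _ : Fin 8 => A)) (fun u => ∑ j, sgn8 j * ((μ j : ℤ) ^ 4 * (u j : ℤ) ^ 4)) := by
        intro α
        exact (prod_eC (fun _ : Fin 8 => A) (fun j w => sgn8 j * ((μ j : ℤ) ^ 4 * (w : ℤ) ^ 4)) α).symm
      rw [← (repX.normSq.mul rK) α, norm_mul, Complex.norm_real, Real.norm_of_nonneg (by positivity), norm_prod,
        ← Finset.mul_sum]
      apply mul_le_mul_of_nonneg_left _ (by positivity)
      have e : ∀ j : Fin 8, ‖∑ w ∈ A, eC (α * ((sgn8 j * ((μ j : ℤ) ^ 4 * (w : ℤ) ^ 4) : ℤ) : ℝ))‖ =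
          ‖∑ w ∈ A, eC (α * (((μ j : ℤ) ^ 4 * (w : ℤ) ^ 4 : ℤ) : ℝ))‖ := fun j =>
        norm_sum_sign A (fun w => (μ j : ℤ) ^ 4 * (w : ℤ) ^ 4) (sgn8 j) (sgn8_cases j) α
      rw [Finset.prod_congr rfl (fun j _ => e j)]
      exact prod_le_sum8 _ (fun j => norm_nonneg _)
  · intro j _
    apply Continuous.intervalIntegrable
    exact ((S_cont X (fun x => (x : ℤ) ^ 4)).norm.pow 2).mul
        ((S_cont A (fun w => (μ j : ℤ) ^ 4 * (w : ℤ) ^ 4)).norm.pow 8)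

/-- the solution set of the main equation -/
def solT (X A : Finset ℕ) : Finset ((ℕ × ℕ) × (Fin 8 → ℕ)) :=
  ((X ×ˢ X) ×ˢ (Fintype.piFinset (fun _ : Fin 8 => A))).filter
      (fun i => ((i.1.1 : ℤ) ^ 4 - (i.1.2 : ℤ) ^ 4) + ∑ j, sgn8 j * (i.2 j : ℤ) ^ 4 = 0)

/-- `u` has a divisor in `Ms` coprime to `n` -/
def goodU (Ms : Finset ℕ) (n u : ℕ) : Prop := ∃ m ∈ Ms, m ∣ u ∧ Nat.Coprime n m

set_option maxHeartbeats 1000000 in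
lemma good_count (X A AQ Ms : Finset ℕ) (hAQ : ∀ u ∈ A, ∀ m ∈ Ms, m ∣ u → u / m ∈ AQ) :
    (((solT X A).filter (fun i => ∀ j, goodU Ms (i.1.1 * i.1.2) (i.2 j))).card : ℝ) ≤
      8 * (Ms.card : ℝ) ^ 7 * ∑ m ∈ Ms, Jm (X.filter (fun x => Nat.Coprime x m)) AQ m := by
  set Xm : (Fin 8 → ℕ) → Finset ℕ := fun μ => X.filter (fun x => ∀ j, Nat.Coprime x (μ j)) with hXm
  set N : (Fin 8 → ℕ) → Finset ((ℕ × ℕ) × (Fin 8 → ℕ)) := fun μ =>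
    ((Xm μ ×ˢ Xm μ) ×ˢ (Fintype.piFinset (fun _ : Fin 8 => AQ))).filter
      (fun i => ((i.1.1 : ℤ) ^ 4 - (i.1.2 : ℤ) ^ 4) + ∑ j, sgn8 j * ((μ j : ℤ) ^ 4 * (i.2 j : ℤ) ^ 4) = 0) with hN
  have hsub : (solT X A).filter (fun i => ∀ j, goodU Ms (i.1.1 * i.1.2) (i.2 j)) ⊆
      (Fintype.piFinset (fun _ : Fin 8 => Ms)).biUnion (fun μ => (N μ).image (fun i => (i.1, fun j => μ j * i.2 j))) := by
    intro i hi
    rw [Finset.mem_filter] at hi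
    obtain ⟨hi1, hg⟩ := hi
    unfold solT at hi1
    rw [Finset.mem_filter, Finset.mem_product, Finset.mem_product, Fintype.mem_piFinset] at hi1
    obtain ⟨⟨⟨hx, hy⟩, hu⟩, he⟩ := hi1
    choose μ hμ hdv hco using hg
    rw [Finset.mem_biUnion]
    refine ⟨μ, ?_, ?_⟩
    · rw [Fintype.mem_piFinset]; exact hμ
    · rw [Finset.mem_image]
      refine ⟨(i.1, fun j => i.2 j / μ j), ?_, ?_⟩
      · rw [hN]
        simp only [Finset.mem_filter, Finset.mem_product, Fintype.mem_piFinset, hXm]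
        refine ⟨⟨⟨⟨hx, fun j => (hco j).coprime_mul_right⟩, hy, fun j => (hco j).coprime_mul_left⟩, fun j => hAQ _ (hu j) _ (hμ j) (hdv j)⟩, ?_⟩
        rw [← he]
        congr 1
        apply Finset.sum_congr rfl
        intro j _
        congr 1
        have : (i.2 j : ℤ) = (μ j : ℤ) * ((i.2 j / μ j : ℕ) : ℤ) := by
          exact_mod_cast (Nat.mul_div_cancel' (hdv j)).symm
        rw [← mul_pow, ← this]
      · refine Prod.ext_iff.2 ⟨rfl, ?_⟩
        funext j
        exact Nat.mul_div_cancel' (hdv j)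
  have h1 : (((solT X A).filter (fun i => ∀ j, goodU Ms (i.1.1 * i.1.2) (i.2 j))).card : ℝ) ≤
      ∑ μ ∈ Fintype.piFinset (fun _ : Fin 8 => Ms), ((N μ).card : ℝ) := by
    rw [← Nat.cast_sum]
    apply Nat.cast_le.mpr
    refine (Finset.card_le_card hsub).trans (Finset.card_biUnion_le.trans ?_)
    exact Finset.sum_le_sum (fun μ _ => Finset.card_image_le)
  refine h1.trans ?_
  set J : ℕ → ℝ := fun m => Jm (X.filter (fun x => Nat.Coprime x m)) AQ m with hJ
  have h2 : ∀ μ ∈ Fintype.piFinset (fun _ : Fin 8 => Ms), ((N μ).card : ℝ) ≤ ∑ j, J (μ j) := by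
    intro μ _
    refine (tuple_count (Xm μ) AQ μ).trans ?_
    apply Finset.sum_le_sum
    intro j _
    apply Jm_mono
    intro x hx
    rw [hXm, Finset.mem_filter] at hx
    rw [Finset.mem_filter]
    exact ⟨hx.1, hx.2 j⟩
  refine (Finset.sum_le_sum h2).trans ?_
  rw [Finset.sum_comm]
  have h3 : ∀ j : Fin 8, ∑ μ ∈ Fintype.piFinset (fun _ : Fin 8 => Ms), J (μ j) = (Ms.card : ℝ) ^ 7 * ∑ m ∈ Ms, J m := by
    intro j
    rw [Fintype.sum_piFinset_apply J Ms j]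
    simp
  rw [Finset.sum_congr rfl (fun j _ => h3 j)]
  simp only [Finset.sum_const, Finset.card_univ, Fintype.card_fin, nsmul_eq_mul]
  apply le_of_eq
  push_cast; ring

/-! ### Bad solutions -/

/-- the negation of `goodU` -/
def badU (Ms : Finset ℕ) (n u : ℕ) : Prop := ¬ ∃ m ∈ Ms, m ∣ u ∧ Nat.Coprime n m

set_option maxHeartbeats 1000000 in
lemma bad_count (X A : Finset ℕ) (bad : ℕ → ℕ → Prop) (D : ℝ)
    (hD : ∀ x ∈ X, ∀ y ∈ X, ((A.filter (fun u => bad (x * y) u)).card : ℝ) ≤ D) (j : Fin 8) :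
    (((solT X A).filter (fun i => bad (i.1.1 * i.1.2) (i.2 j))).card : ℝ) ≤
      (X.card : ℝ) ^ 2 * D * ∫ α in (0 : ℝ)..1, ‖∑ x ∈ A, eC (α * (((x : ℤ) ^ 4 : ℤ) : ℝ))‖ ^ 7 := by
  set I := ∫ α in (0 : ℝ)..1, ‖∑ x ∈ A, eC (α * (((x : ℤ) ^ 4 : ℤ) : ℝ))‖ ^ 7 with hI
  have hI0 : 0 ≤ I := by
    rw [hI]; apply intervalIntegral.integral_nonneg (by norm_num); intros; positivity
  set Z := ((X ×ˢ X) ×ˢ A).filter (fun q => bad (q.1.1 * q.1.2) q.2) with hZ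
  have hZc : (Z.card : ℝ) ≤ (X.card : ℝ) ^ 2 * D := by
    rw [Finset.card_eq_sum_card_fiberwise (f := fun q => q.1) (t := X ×ˢ X)]
    · push_cast
      calc _ ≤ ∑ _q ∈ X ×ˢ X, D := by
            apply Finset.sum_le_sum
            intro q hq
            rw [Finset.mem_product] at hq
            refine le_trans ?_ (hD q.1 hq.1 q.2 hq.2)
            apply Nat.cast_le.mpr
            apply Finset.card_le_card_of_injOn (fun z => z.2)
            · intro z hz
              rw [Finset.mem_coe, Finset.mem_filter, hZ, Finset.mem_filter, Finset.mem_product] at hz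
              rw [Finset.mem_coe, Finset.mem_filter]
              exact ⟨hz.1.1.2, by rw [← hz.2]; exact hz.1.2⟩
            · intro z hz z' hz' h
              rw [Finset.mem_coe, Finset.mem_filter] at hz hz'
              exact Prod.ext (hz.2.trans hz'.2.symm) h
        _ = _ := by
            rw [Finset.sum_const, Finset.card_product, nsmul_eq_mul]; push_cast; ring
    · intro q hq
      rw [Finset.mem_coe, hZ, Finset.mem_filter, Finset.mem_product] at hq
      exact hq.1.1
  have hfib : (((solT X A).filter (fun i => bad (i.1.1 * i.1.2) (i.2 j))).card : ℝ) ≤ Z.card * I := by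
    rw [Finset.card_eq_sum_card_fiberwise (f := fun i => (i.1, i.2 j)) (t := Z)]
    · push_cast
      rw [← nsmul_eq_mul]
      apply Finset.sum_le_card_nsmul
      intro z hz
      have hc : ((((solT X A).filter (fun i => bad (i.1.1 * i.1.2) (i.2 j))).filter (fun i => (i.1, i.2 j) = z)).card : ℝ) ≤
          (((Fintype.piFinset (fun _ : Fin 7 => A)).filter (fun v => ((z.1.1 : ℤ) ^ 4 - (z.1.2 : ℤ) ^ 4 + sgn8 j * (z.2 : ℤ) ^ 4) +
            ∑ k, sgn8 (j.succAbove k) * (v k : ℤ) ^ 4 = 0)).card : ℝ) := by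
        apply Nat.cast_le.mpr
        apply Finset.card_le_card_of_injOn (fun i k => i.2 (j.succAbove k))
        · intro i hi
          rw [Finset.mem_coe, Finset.mem_filter, Finset.mem_filter] at hi
          obtain ⟨⟨hs, _⟩, hz⟩ := hi
          unfold solT at hs
          rw [Finset.mem_filter, Finset.mem_product, Fintype.mem_piFinset] at hs
          rw [Finset.mem_coe, Finset.mem_filter, Fintype.mem_piFinset]
          refine ⟨fun k => hs.1.2 _, ?_⟩
          rw [← hz, ← hs.2, Fin.sum_univ_succAbove _ j]
          ring
        · intro i hi i' hi' h
          rw [Finset.mem_coe, Finset.mem_filter] at hi hi'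
          have e := hi.2.trans hi'.2.symm
          simp only [Prod.mk.injEq] at e
          apply Prod.ext e.1
          funext k
          rcases Fin.eq_self_or_eq_succAbove j k with hk | ⟨l, hk⟩
          · rw [hk]; exact e.2
          · rw [hk]; exact congrFun h l
      refine hc.trans ?_
      apply card_le_integral
      · exact (S_cont A (fun x => (x : ℤ) ^ 4)).norm.pow 7
      · intro α
        have e1 := prod_eC (fun _ : Fin 7 => A) (fun k w => sgn8 (j.succAbove k) * (w : ℤ) ^ 4) α
        set C : ℤ := (z.1.1 : ℤ) ^ 4 - (z.1.2 : ℤ) ^ 4 + sgn8 j * (z.2 : ℤ) ^ 4 with hC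
        have e2 : ∑ v ∈ Fintype.piFinset (fun _ : Fin 7 => A), eC (α * ((C + ∑ k, sgn8 (j.succAbove k) * (v k : ℤ) ^ 4 : ℤ) : ℝ)) =
            eC (α * C) * ∑ v ∈ Fintype.piFinset (fun _ : Fin 7 => A), eC (α * ((∑ k, sgn8 (j.succAbove k) * (v k : ℤ) ^ 4 : ℤ) : ℝ)) := by
          rw [Finset.mul_sum]
          apply Finset.sum_congr rfl
          intro v _
          rw [← eC_add, Int.cast_add, mul_add]
        rw [e2, e1, norm_mul, norm_eC, one_mul, norm_prod]
        have e3 : ∀ k : Fin 7, ‖∑ w ∈ A, eC (α * ((sgn8 (j.succAbove k) * (w : ℤ) ^ 4 : ℤ) : ℝ))‖ =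
            ‖∑ w ∈ A, eC (α * (((w : ℤ) ^ 4 : ℤ) : ℝ))‖ := fun k =>
          norm_sum_sign A (fun w => (w : ℤ) ^ 4) _ (sgn8_cases _) α
        rw [Finset.prod_congr rfl (fun k _ => e3 k)]
        simp
    · intro i hi
      rw [Finset.mem_coe, Finset.mem_filter] at hi
      have hs := hi.1
      unfold solT at hs
      rw [Finset.mem_filter, Finset.mem_product, Fintype.mem_piFinset] at hs
      rw [Finset.mem_coe, hZ, Finset.mem_filter, Finset.mem_product]
      exact ⟨⟨hs.1.1, hs.1.2 j⟩, hi.2⟩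
  refine hfib.trans ?_
  gcongr

lemma total_count (X A AQ Ms : Finset ℕ) (hAQ : ∀ u ∈ A, ∀ m ∈ Ms, m ∣ u → u / m ∈ AQ) (D : ℝ)
    (hD : ∀ x ∈ X, ∀ y ∈ X, ((A.filter (fun u => badU Ms (x * y) u)).card : ℝ) ≤ D) :
    ((solT X A).card : ℝ) ≤ 8 * (Ms.card : ℝ) ^ 7 * ∑ m ∈ Ms, Jm (X.filter (fun x => Nat.Coprime x m)) AQ m +
      8 * ((X.card : ℝ) ^ 2 * D * ∫ α in (0 : ℝ)..1, ‖∑ x ∈ A, eC (α * (((x : ℤ) ^ 4 : ℤ) : ℝ))‖ ^ 7) := by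
  have hsub : solT X A ⊆ (solT X A).filter (fun i => ∀ j, goodU Ms (i.1.1 * i.1.2) (i.2 j)) ∪
      (Finset.univ : Finset (Fin 8)).biUnion (fun j => (solT X A).filter (fun i => badU Ms (i.1.1 * i.1.2) (i.2 j))) := by
    intro i hi
    rw [Finset.mem_union, Finset.mem_filter, Finset.mem_biUnion]
    by_cases h : ∀ j, goodU Ms (i.1.1 * i.1.2) (i.2 j)
    · exact Or.inl ⟨hi, h⟩
    · push Not at h
      obtain ⟨j, hj⟩ := h
      exact Or.inr ⟨j, Finset.mem_univ _, Finset.mem_filter.2 ⟨hi, hj⟩⟩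
  have h1 : (solT X A).card ≤ ((solT X A).filter (fun i => ∀ j, goodU Ms (i.1.1 * i.1.2) (i.2 j))).card +
      ∑ j : Fin 8, ((solT X A).filter (fun i => badU Ms (i.1.1 * i.1.2) (i.2 j))).card :=
    (Finset.card_le_card hsub).trans ((Finset.card_union_le _ _).trans (Nat.add_le_add_left Finset.card_biUnion_le _))
  have h2 : ((solT X A).card : ℝ) ≤ ((solT X A).filter (fun i => ∀ j, goodU Ms (i.1.1 * i.1.2) (i.2 j))).card +
      ∑ j : Fin 8, (((solT X A).filter (fun i => badU Ms (i.1.1 * i.1.2) (i.2 j))).card : ℝ) := by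
    exact_mod_cast h1
  refine h2.trans (add_le_add (good_count X A AQ Ms hAQ) ?_)
  refine (Finset.sum_le_sum (fun j _ => bad_count X A (badU Ms) D hD j)).trans ?_
  rw [Finset.sum_const, Finset.card_univ, Fintype.card_fin, nsmul_eq_mul]
  push_cast
  exact le_refl _


/-! ### Arithmetic of bad elements -/

lemma coprime_split (n : ℕ) (u : ℕ) (hu : 1 ≤ u) :
    ∃ a v : ℕ, u = a * v ∧ Nat.Coprime n a ∧ ∀ p : ℕ, p.Prime → p ∣ v → p ∣ n := by
  induction u using Nat.strong_induction_on with
  | _ u ih =>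
    by_cases hc : Nat.Coprime n u
    · refine ⟨u, 1, by ring, hc, ?_⟩
      intro p hp h
      exact absurd (Nat.dvd_one.1 h) hp.one_lt.ne'
    · obtain ⟨p, hp, h1, h2⟩ := Nat.Prime.not_coprime_iff_dvd.1 hc
      obtain ⟨w, hw⟩ := h2
      have hw0 : 1 ≤ w := by
        rcases Nat.eq_zero_or_pos w with h | h
        · subst h; omega
        · exact h
      have hlt : w < u := by
        rw [hw]; have := hp.two_le; nlinarith
      obtain ⟨a, v, e, hca, hv⟩ := ih w hlt hw0
      refine ⟨a, p * v, by rw [hw, e]; ring, hca, ?_⟩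
      intro q hq h
      rcases (Nat.Prime.dvd_mul hq).1 h with h3 | h3
      · rw [(Nat.prime_dvd_prime_iff_eq hq hp).1 h3]; exact h1
      · exact hv q hq h3

lemma smooth_divisor (M R : ℝ) (hM : 1 ≤ M) (a : ℕ) (hs : ∀ p : ℕ, p.Prime → p ∣ a → (p : ℝ) ≤ R)
    (ha : M < a) : ∃ m : ℕ, m ∣ a ∧ M < m ∧ (m : ℝ) ≤ M * R := by
  have hex : ∃ m : ℕ, m ∣ a ∧ M < m := ⟨a, dvd_refl a, ha⟩
  obtain ⟨h1, h2⟩ := Nat.find_spec hex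
  set m := Nat.find hex with hm
  refine ⟨m, h1, h2, ?_⟩
  have hm1 : m ≠ 1 := by
    intro h; rw [h] at h2; push_cast at h2; linarith
  have hm0 : 0 < m := by
    have : (0 : ℝ) < m := by linarith
    exact_mod_cast this
  set q := m.minFac with hq
  have hqp : q.Prime := Nat.minFac_prime hm1
  have hqd : q ∣ m := Nat.minFac_dvd m
  have hlt : m / q < m := Nat.div_lt_self hm0 hqp.one_lt
  have h3 := Nat.find_min hex hlt
  have h4 : ¬ M < ((m / q : ℕ) : ℝ) := fun h => h3 ⟨(Nat.div_dvd_of_dvd hqd).trans h1, h⟩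
  have h5 : (m : ℝ) = ((m / q : ℕ) : ℝ) * q := by
    exact_mod_cast (Nat.div_mul_cancel hqd).symm
  rw [h5]
  have h6 := hs q hqp (hqd.trans h1)
  push Not at h4
  gcongr

/-- the smooth numbers up to `P` -/
noncomputable def smoothSet (P R : ℝ) : Finset ℕ := (Finset.Icc 1 ⌊P⌋₊).filter (fun x => IsSmooth R (x : ℤ))

/-- the integers in `(M, MR]` -/
noncomputable def midSet (M R : ℝ) : Finset ℕ := (Finset.Icc 1 ⌊M * R⌋₊).filter (fun m => M < (m : ℝ))

lemma mem_smoothSet {P R : ℝ} (hP : 0 ≤ P) {x : ℕ} : x ∈ smoothSet P R ↔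
    1 ≤ x ∧ (x : ℝ) ≤ P ∧ ∀ p : ℕ, p.Prime → p ∣ x → (p : ℝ) ≤ R := by
  unfold smoothSet IsSmooth
  rw [Finset.mem_filter, Finset.mem_Icc, Nat.le_floor_iff hP]
  constructor
  · rintro ⟨⟨h1, h2⟩, h3⟩
    exact ⟨h1, h2, fun p hp h => h3 p hp (Int.natCast_dvd_natCast.2 h)⟩
  · rintro ⟨h1, h2, h3⟩
    exact ⟨⟨h1, h2⟩, fun p hp h => h3 p hp (Int.natCast_dvd_natCast.1 h)⟩

lemma mem_midSet {M R : ℝ} (h : 0 ≤ M * R) (hM : 0 ≤ M) {m : ℕ} : m ∈ midSet M R ↔ M < m ∧ (m : ℝ) ≤ M * R := by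
  unfold midSet
  rw [Finset.mem_filter, Finset.mem_Icc, Nat.le_floor_iff h]
  constructor
  · rintro ⟨⟨_, h2⟩, h3⟩; exact ⟨h3, h2⟩
  · rintro ⟨h3, h2⟩
    refine ⟨⟨?_, h2⟩, h3⟩
    have : (0 : ℝ) < m := by linarith
    exact_mod_cast this

/-- integers up to `N` composed of primes dividing `n` -/
noncomputable def radSet (N n : ℕ) : Finset ℕ := (Finset.Icc 1 N).filter (fun v => ∀ p : ℕ, p.Prime → p ∣ v → p ∣ n)

lemma bad_card (P M R : ℝ) (hP : 1 ≤ P) (hM : 1 ≤ M) (hR : 1 ≤ R) (n : ℕ) :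
    (((smoothSet P R).filter (fun u => badU (midSet M R) n u)).card : ℝ) ≤ M * ((radSet ⌊P⌋₊ n).card : ℝ) := by
  have h1 : ((smoothSet P R).filter (fun u => badU (midSet M R) n u)).card ≤
      (Finset.Icc 1 ⌊M⌋₊ ×ˢ radSet ⌊P⌋₊ n).card := by
    refine (Finset.card_le_card ?_).trans (Finset.card_image_le (f := fun q : ℕ × ℕ => q.1 * q.2))
    intro u hu
    rw [Finset.mem_filter, mem_smoothSet (by linarith)] at hu
    obtain ⟨⟨hu1, hu2, hu3⟩, hb⟩ := hu
    obtain ⟨a, v, e, hca, hv⟩ := coprime_split n u hu1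
    rw [Finset.mem_image]
    refine ⟨(a, v), ?_, e.symm⟩
    have ha0 : 1 ≤ a := by
      rcases Nat.eq_zero_or_pos a with h | h
      · subst h; omega
      · exact h
    have hv0 : 1 ≤ v := by
      rcases Nat.eq_zero_or_pos v with h | h
      · subst h; omega
      · exact h
    rw [Finset.mem_product, Finset.mem_Icc, Nat.le_floor_iff (by linarith)]
    refine ⟨⟨ha0, ?_⟩, ?_⟩
    · by_contra hlt
      push Not at hlt
      obtain ⟨m, hm1, hm2, hm3⟩ := smooth_divisor M R hM a (fun p hp h => hu3 p hp (h.trans ⟨v, e⟩)) hlt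
      apply hb
      refine ⟨m, (mem_midSet (by positivity) (by linarith)).2 ⟨hm2, hm3⟩, hm1.trans ⟨v, e⟩, ?_⟩
      exact Nat.Coprime.coprime_dvd_right hm1 hca
    · unfold radSet
      rw [Finset.mem_filter, Finset.mem_Icc]
      refine ⟨⟨hv0, ?_⟩, hv⟩
      have : v ≤ u := by rw [e]; nlinarith
      exact this.trans (Nat.le_floor hu2)
  rw [Finset.card_product, Nat.card_Icc, Nat.add_sub_cancel] at h1
  have h2 : (((smoothSet P R).filter (fun u => badU (midSet M R) n u)).card : ℝ) ≤ (⌊M⌋₊ : ℝ) * ((radSet ⌊P⌋₊ n).card : ℝ) := by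
    exact_mod_cast h1
  refine h2.trans ?_
  gcongr
  exact Nat.floor_le (by linarith)

lemma rad_split (n K : ℕ) (hn : n ≠ 0) (hK0 : K ≠ 0) (v : ℕ) (hv : 1 ≤ v) (h : ∀ p : ℕ, p.Prime → p ∣ v → p ∣ n) :
    ∃ b r : ℕ, v = b ^ K * r ∧ r ∣ n ^ K := by
  induction v using Nat.strong_induction_on with
  | _ v ih =>
    by_cases hd : v ∣ n ^ K
    · exact ⟨1, v, by simp, hd⟩
    · have h1 : ¬ v.factorization ≤ (n ^ K).factorization := by
        rw [Nat.factorization_le_iff_dvd (by omega) (by positivity)]; exact hd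
      rw [Finsupp.le_def] at h1
      push Not at h1
      obtain ⟨p, hp⟩ := h1
      rw [Nat.factorization_pow] at hp
      simp only [Finsupp.smul_apply, smul_eq_mul] at hp
      have hpp : p.Prime := by
        by_contra hc
        have h0 : v.factorization p = 0 := Nat.factorization_eq_zero_of_not_prime _ hc
        rw [h0] at hp
        exact absurd hp (Nat.not_lt_zero _)
      have hpv : p ∣ v := by
        by_contra hc
        have h0 : v.factorization p = 0 := Nat.factorization_eq_zero_of_not_dvd hc
        rw [h0] at hp
        exact absurd hp (Nat.not_lt_zero _)
      have hpn : 1 ≤ n.factorization p := (hpp.dvd_iff_one_le_factorization hn).1 (h p hpp hpv)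
      have hKv : K ≤ v.factorization p := by nlinarith
      have hdv : p ^ K ∣ v := (hpp.pow_dvd_iff_le_factorization (by omega)).2 hKv
      obtain ⟨w, hw⟩ := hdv
      have hw0 : 1 ≤ w := by
        rcases Nat.eq_zero_or_pos w with h | h
        · subst h; omega
        · exact h
      have hlt : w < v := by
        have : 1 < p ^ K := Nat.one_lt_pow hK0 hpp.one_lt
        rw [hw]; nlinarith
      obtain ⟨b, r, e, hr⟩ := ih w hlt hw0 (fun q hq hqw => h q hq (hqw.trans ⟨p ^ K, by rw [hw]; ring⟩))
      exact ⟨p * b, r, by rw [hw, e, mul_pow]; ring, hr⟩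

lemma rad_card (N n K B : ℕ) (hn : n ≠ 0) (hK : K ≠ 0) (hB : N < (B + 1) ^ K) :
    (radSet N n).card ≤ B * (n ^ K).divisors.card := by
  rw [← Nat.add_sub_cancel (n := B) (m := 1), ← Nat.card_Icc, ← Finset.card_product]
  refine (Finset.card_le_card ?_).trans (Finset.card_image_le (f := fun q : ℕ × ℕ => q.1 ^ K * q.2))
  intro v hv
  unfold radSet at hv
  rw [Finset.mem_filter, Finset.mem_Icc] at hv
  obtain ⟨⟨hv1, hv2⟩, hv3⟩ := hv
  obtain ⟨b, r, e, hr⟩ := rad_split n K hn hK v hv1 hv3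
  rw [Finset.mem_image]
  refine ⟨(b, r), ?_, e.symm⟩
  rw [Finset.mem_product, Finset.mem_Icc, Nat.mem_divisors]
  have hb0 : 1 ≤ b := by
    rcases Nat.eq_zero_or_pos b with h | h
    · subst h; rw [zero_pow hK] at e; omega
    · exact h
  have hr0 : 1 ≤ r := by
    rcases Nat.eq_zero_or_pos r with h | h
    · subst h; omega
    · exact h
  refine ⟨⟨hb0, ?_⟩, hr, by positivity⟩
  have h1 : b ^ K ≤ v := by rw [e]; nlinarith [Nat.pow_pos (n := K) hb0]
  have h2 : b ^ K < (B + 1) ^ K := by omega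
  exact Nat.lt_succ_iff.1 (lt_of_pow_lt_pow_left₀ K (by omega) h2)

/-! ### The main inequality -/

lemma moment7 (A : Finset ℕ) (Z W t B : ℝ) (hZ : 0 ≤ Z) (hW : 1 ≤ W) (ht : 0 < t)
    (hd : ∀ n : ℕ, 0 < n → (n : ℝ) ≤ 4 * Z ^ 4 → (n.divisors.card : ℝ) ≤ W)
    (hA : ∀ x ∈ A, 1 ≤ x ∧ (x : ℝ) ≤ Z)
    (hB : ∫ α in (0 : ℝ)..1, ‖∑ x ∈ A, eC (α * (((x : ℤ) ^ 4 : ℤ) : ℝ))‖ ^ 8 ≤ B) :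
    ∫ α in (0 : ℝ)..1, ‖∑ x ∈ A, eC (α * (((x : ℤ) ^ 4 : ℤ) : ℝ))‖ ^ 7 ≤ t ^ 3 * (2 * W ^ 2 * Z ^ 2) + B / t := by
  set g : ℝ → ℝ := fun α => ‖∑ x ∈ A, eC (α * (((x : ℤ) ^ 4 : ℤ) : ℝ))‖ with hg
  have cg : Continuous g := (S_cont A (fun x => (x : ℤ) ^ 4)).norm
  have h4 : ∫ α in (0 : ℝ)..1, g α ^ 4 ≤ 2 * W ^ 2 * Z ^ 2 := by
    have r : ExpRep (fun α => ∑ x ∈ A, eC (α * (((x : ℤ) ^ 4 : ℤ) : ℝ))) A (fun x => (x : ℤ) ^ 4) := fun α => rfl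
    have e := ExpRep.card (F := fun α => g α ^ 4) r.norm4
    rw [e]
    refine le_trans ?_ (U4_raw Z W hZ hW hd A hA)
    apply Nat.cast_le.mpr
    apply Finset.card_le_card
    intro y hy
    rw [Finset.mem_filter] at hy ⊢
    refine ⟨hy.1, ?_⟩
    unfold ph4
    linarith [hy.2]
  have i4 : IntervalIntegrable (fun α => t ^ 3 * g α ^ 4) volume 0 1 :=
    (continuous_const.mul (cg.pow 4)).intervalIntegrable _ _
  have i8 : IntervalIntegrable (fun α => g α ^ 8 / t) volume 0 1 :=
    ((cg.pow 8).div_const t).intervalIntegrable _ _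
  calc ∫ α in (0 : ℝ)..1, g α ^ 7 ≤ ∫ α in (0 : ℝ)..1, (t ^ 3 * g α ^ 4 + g α ^ 8 / t) := by
        apply intervalIntegral.integral_mono_on (by norm_num) ((cg.pow 7).intervalIntegrable _ _) (i4.add i8)
        intro α _
        show g α ^ 7 ≤ t ^ 3 * g α ^ 4 + g α ^ 8 / t
        have g0 : 0 ≤ g α := norm_nonneg _
        rcases le_total (g α) t with h | h
        · have : g α ^ 7 ≤ t ^ 3 * g α ^ 4 := by
            calc g α ^ 7 = g α ^ 3 * g α ^ 4 := by ring
              _ ≤ _ := by gcongr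
          have : 0 ≤ g α ^ 8 / t := by positivity
          linarith
        · have : g α ^ 7 ≤ g α ^ 8 / t := by
            rw [le_div_iff₀ ht]
            calc g α ^ 7 * t ≤ g α ^ 7 * g α := by gcongr
              _ = _ := by ring
          have : 0 ≤ t ^ 3 * g α ^ 4 := by positivity
          linarith
    _ = t ^ 3 * (∫ α in (0 : ℝ)..1, g α ^ 4) + (∫ α in (0 : ℝ)..1, g α ^ 8) / t := by
        rw [intervalIntegral.integral_add i4 i8, intervalIntegral.integral_const_mul, intervalIntegral.integral_div]
    _ ≤ _ := by gcongr

namespace Par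
variable {P M H Q X1 W : ℝ}

set_option maxHeartbeats 1000000 in
lemma J_total (p : Par P M H Q X1 W) (R : ℝ) (hR : 1 ≤ R) (hRW : R ≤ W) (A : Finset ℕ)
    (hA : ∀ x ∈ A, 1 ≤ x ∧ (x : ℝ) ≤ Q) (B : ℝ) (hB : 0 < B) (hB10 : ∫ α in (0 : ℝ)..1, ‖GA A α‖ ^ 10 ≤ B) :
    ∑ m ∈ midSet M R, Jm ((Finset.Icc 1 ⌊P⌋₊).filter (fun x => Nat.Coprime x m)) A m ≤
      100000 * W ^ 7 * (M * P) * ((∫ α in (0 : ℝ)..1, ‖GA A α‖ ^ 8) + H * (X1 ^ (1 / 12 : ℝ) * B ^ (2 / 3 : ℝ))) := by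
  have hP := p.hP; have hM := p.hM; have hH := p.hH; have hW := p.hW; have hWP := p.hWP; have hP8 := p.hP8
  have hMP := p.MleP; have hX1 := p.hX1
  have hMR : 1 ≤ M * R := by nlinarith
  set U8 := ∫ α in (0 : ℝ)..1, ‖GA A α‖ ^ 8 with hU8
  have hU80 : 0 ≤ U8 := by
    rw [hU8]; apply intervalIntegral.integral_nonneg (by norm_num); intros; positivity
  set Hn := ⌊H⌋₊ with hHn
  set N := ⌊2 * P⌋₊ with hN
  have hms : ∀ m ∈ midSet M R, M < m ∧ (m : ℝ) ≤ M * R := fun m hm =>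
    (mem_midSet (by linarith) (by linarith)).1 hm
  have hN1 : P ≤ N := by
    have := Nat.lt_floor_add_one (2 * P)
    rw [← hN] at this; linarith
  have hN2 : (N : ℝ) ≤ 2 * P := Nat.floor_le (by linarith)
  have hcard : ((midSet M R).card : ℝ) ≤ M * W := by
    have h1 : (midSet M R).card ≤ ⌊M * R⌋₊ := by
      unfold midSet
      refine (Finset.card_filter_le _ _).trans ?_
      rw [Nat.card_Icc, Nat.add_sub_cancel]
    calc ((midSet M R).card : ℝ) ≤ (⌊M * R⌋₊ : ℝ) := by exact_mod_cast h1
      _ ≤ M * R := Nat.floor_le (by linarith)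
      _ ≤ _ := by gcongr
  have hX : ((Finset.Icc 1 ⌊P⌋₊).card : ℝ) ≤ P := by
    rw [Nat.card_Icc, Nat.add_sub_cancel]; exact Nat.floor_le (by linarith)
  set G : ℕ → ℝ := fun m => ∫ α in (0 : ℝ)..1, (∑ h ∈ Finset.Icc 1 Hn, ‖Phi N α h m‖) * ‖GA A α‖ ^ 8 with hG
  have hG0 : ∀ m, 0 ≤ G m := by
    intro m
    apply intervalIntegral.integral_nonneg (by norm_num); intros; positivity
  have h1 : ∀ m ∈ midSet M R, Jm ((Finset.Icc 1 ⌊P⌋₊).filter (fun x => Nat.Coprime x m)) A m ≤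
      4 * W ^ 2 * (P * U8 + 2 * G m) := by
    intro m hm
    obtain ⟨hm1, hm2⟩ := hms m hm
    have hm0 : 1 ≤ m := by
      have : (0 : ℝ) < m := by linarith
      exact_mod_cast this
    have hb := Jm_bound ((Finset.Icc 1 ⌊P⌋₊).filter (fun x => Nat.Coprime x m)) A m Hn N hm0 (by
      intro x hx
      rw [Finset.mem_filter, Finset.mem_Icc, Nat.le_floor_iff (by linarith)] at hx
      refine ⟨hx.1.1, ?_, ?_⟩
      · apply Nat.le_floor; push_cast; linarith [hx.1.2]
      · have h2 : H < Hn + 1 := Nat.lt_floor_add_one H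
        have : (x : ℝ) < ((Hn + 1) * m ^ 4 : ℕ) := by
          push_cast
          calc (x : ℝ) ≤ P := hx.1.2
            _ = H * M ^ 4 := p.eH.symm
            _ < (Hn + 1) * M ^ 4 := by gcongr
            _ ≤ _ := by gcongr
        exact_mod_cast this) (by
      intro x hx
      exact (Finset.mem_filter.1 hx).2)
    refine hb.trans ?_
    have hdm : ((m ^ 4).divisors.card : ℝ) ≤ W := by
      apply p.hd _ (by positivity)
      push_cast
      calc (m : ℝ) ^ 4 ≤ (P * P) ^ 4 := by
            gcongr
            calc (m : ℝ) ≤ M * R := hm2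
              _ ≤ P * P := by gcongr; linarith
        _ = P ^ 8 := by ring
        _ ≤ P ^ 20 := pow_le_pow_right₀ (by linarith) (by norm_num)
    have hc : (((Finset.Icc 1 ⌊P⌋₊).filter (fun x => Nat.Coprime x m)).card : ℝ) ≤ P := by
      refine le_trans ?_ hX
      exact_mod_cast Finset.card_filter_le _ _
    have hg := hG0 m
    push_cast
    calc (2 * ((m ^ 4).divisors.card : ℝ)) ^ 2 * ((((Finset.Icc 1 ⌊P⌋₊).filter (fun x => Nat.Coprime x m)).card : ℝ) * U8 + 2 * G m)
        ≤ (2 * W) ^ 2 * (P * U8 + 2 * G m) := by gcongr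
      _ = _ := by ring
  have h2 : ∑ m ∈ midSet M R, G m = ∫ α in (0 : ℝ)..1, Fsum (midSet M R) Hn N α * ‖GA A α‖ ^ 8 := by
    rw [hG, ← intervalIntegral.integral_finsetSum]
    · congr 1
      funext α
      rw [← Finset.sum_mul]
      unfold Fsum
      rw [Finset.sum_comm]
    · intro m _
      apply Continuous.intervalIntegrable
      exact (continuous_finsetSum _ (fun h _ => (Phi_cont N h m).norm)).mul ((GA_cont A).norm.pow 8)
  have hY : ((⌊M * R⌋₊ : ℕ) : ℝ) ≤ M * W := (Nat.floor_le (by linarith)).trans (by gcongr)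
  have h3 := p.FG_bound ⌊M * R⌋₊ hY (Nat.le_floor (by push_cast; exact hMR)) (midSet M R)
    (fun m hm => ⟨(hms m hm).1.le, Nat.le_floor (hms m hm).2⟩) hcard Hn N (Nat.floor_le (by linarith)) hN1 hN2 A hA B hB hB10
  rw [← h2] at h3
  have hW3 : W ^ 3 ≤ W ^ 7 := pow_le_pow_right₀ hW (by norm_num)
  set V := X1 ^ (1 / 12 : ℝ) * B ^ (2 / 3 : ℝ) with hV
  have hV0 : 0 ≤ V := by positivity
  calc _ ≤ ∑ m ∈ midSet M R, 4 * W ^ 2 * (P * U8 + 2 * G m) := Finset.sum_le_sum h1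
    _ = 4 * W ^ 2 * ((midSet M R).card * (P * U8) + 2 * ∑ m ∈ midSet M R, G m) := by
        rw [← Finset.mul_sum, Finset.sum_add_distrib, Finset.sum_const, nsmul_eq_mul, ← Finset.mul_sum]
    _ ≤ 4 * W ^ 2 * ((M * W) * (P * U8) + 2 * (72 * W ^ 5 * (M * P) * U8 + 12000 * W ^ 5 * (H * M * P) * V)) := by
        gcongr
    _ = 4 * W ^ 3 * (M * P * U8) + 576 * W ^ 7 * (M * P * U8) + 96000 * W ^ 7 * (M * P * (H * V)) := by ring
    _ ≤ 4 * W ^ 7 * (M * P * U8) + 576 * W ^ 7 * (M * P * U8) + 100000 * W ^ 7 * (M * P * (H * V)) := by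
        gcongr
        norm_num
    _ = 580 * (W ^ 7 * (M * P * U8)) + 100000 * W ^ 7 * (M * P * (H * V)) := by ring
    _ ≤ 100000 * (W ^ 7 * (M * P * U8)) + 100000 * W ^ 7 * (M * P * (H * V)) := by
        gcongr
        norm_num
    _ = _ := by ring

set_option maxHeartbeats 1000000 in
lemma main_bound (p : Par P M H Q X1 W) (R : ℝ) (hR : 1 ≤ R) (hRW : R ≤ W)
    (hV : ∀ n : ℕ, 0 < n → (n : ℝ) ≤ P ^ 2 → ((radSet ⌊P⌋₊ n).card : ℝ) ≤ W)
    (B8 B10 C8 t : ℝ) (hB10 : 0 < B10) (ht : 0 < t)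
    (h8Q : ∫ α in (0 : ℝ)..1, ‖GA (smoothSet Q R) α‖ ^ 8 ≤ B8)
    (h10Q : ∫ α in (0 : ℝ)..1, ‖GA (smoothSet Q R) α‖ ^ 10 ≤ B10)
    (h8P : ∫ α in (0 : ℝ)..1, ‖∑ x ∈ smoothSet P R, eC (α * (((x : ℤ) ^ 4 : ℤ) : ℝ))‖ ^ 8 ≤ C8) :
    ((solT (Finset.Icc 1 ⌊P⌋₊) (smoothSet P R)).card : ℝ) ≤
      800000 * W ^ 14 * (M ^ 8 * P) * (B8 + H * (X1 ^ (1 / 12 : ℝ) * B10 ^ (2 / 3 : ℝ))) +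
      8 * (P ^ 2 * (M * W) * (t ^ 3 * (2 * W ^ 2 * P ^ 2) + C8 / t)) := by
  have hP := p.hP; have hM := p.hM; have hH := p.hH; have hW := p.hW; have hWP := p.hWP; have hP8 := p.hP8
  have hX1 := p.hX1; have hQ := p.hQ
  have hMR : 1 ≤ M * R := by nlinarith
  have hAQ : ∀ u ∈ smoothSet P R, ∀ m ∈ midSet M R, m ∣ u → u / m ∈ smoothSet Q R := by
    intro u hu m hm hmu
    rw [mem_smoothSet (by linarith)] at hu ⊢
    rw [mem_midSet (by linarith) (by linarith)] at hm
    obtain ⟨h1, h2, h3⟩ := hu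
    have hmpos : (0 : ℝ) < m := by linarith [hm.1]
    have hm0 : 0 < m := by exact_mod_cast hmpos
    refine ⟨Nat.div_pos (Nat.le_of_dvd (by omega) hmu) hm0, ?_, ?_⟩
    · rw [Nat.cast_div hmu (by positivity), div_le_iff₀ hmpos]
      calc (u : ℝ) ≤ P := h2
        _ = Q * M := by rw [← p.eQ]; ring
        _ ≤ Q * m := by gcongr; exact hm.1.le
    · intro q hq hqd
      exact h3 q hq (hqd.trans (Nat.div_dvd_of_dvd hmu))
  have hXmem : ∀ x ∈ Finset.Icc 1 ⌊P⌋₊, 1 ≤ x ∧ (x : ℝ) ≤ P := by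
    intro x hx
    rw [Finset.mem_Icc, Nat.le_floor_iff (by linarith)] at hx
    exact hx
  have hX : ((Finset.Icc 1 ⌊P⌋₊).card : ℝ) ≤ P := by
    rw [Nat.card_Icc, Nat.add_sub_cancel]; exact Nat.floor_le (by linarith)
  have hD : ∀ x ∈ Finset.Icc 1 ⌊P⌋₊, ∀ y ∈ Finset.Icc 1 ⌊P⌋₊,
      (((smoothSet P R).filter (fun u => badU (midSet M R) (x * y) u)).card : ℝ) ≤ M * W := by
    intro x hx y hy
    obtain ⟨hx1, hx2⟩ := hXmem x hx
    obtain ⟨hy1, hy2⟩ := hXmem y hy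
    have hxy : 0 < x * y := Nat.mul_pos hx1 hy1
    refine (bad_card P M R (by linarith) hM hR (x * y)).trans ?_
    gcongr
    apply hV _ hxy
    push_cast
    calc (x : ℝ) * y ≤ P * P := by gcongr
      _ = _ := by ring
  have h1 := total_count (Finset.Icc 1 ⌊P⌋₊) (smoothSet P R) (smoothSet Q R) (midSet M R) hAQ (M * W) hD
  have h2 := p.J_total R hR hRW (smoothSet Q R) (by
    intro x hx
    rw [mem_smoothSet (by linarith)] at hx
    exact ⟨hx.1, hx.2.1⟩) B10 hB10 h10Q
  have h3 := moment7 (smoothSet P R) P W t C8 (by linarith) hW ht (by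
    intro n hn h
    apply p.hd n hn (h.trans _)
    calc 4 * P ^ 4 ≤ P ^ 16 * P ^ 4 := by
          gcongr
          calc (4 : ℝ) ≤ 8 ^ 16 := by norm_num
            _ ≤ _ := by gcongr
      _ = _ := by ring) (by
    intro x hx
    rw [mem_smoothSet (by linarith)] at hx
    exact ⟨hx.1, hx.2.1⟩) h8P
  have hcard : ((midSet M R).card : ℝ) ≤ M * W := by
    have h1 : (midSet M R).card ≤ ⌊M * R⌋₊ := by
      unfold midSet
      refine (Finset.card_filter_le _ _).trans ?_
      rw [Nat.card_Icc, Nat.add_sub_cancel]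
    calc ((midSet M R).card : ℝ) ≤ (⌊M * R⌋₊ : ℝ) := by exact_mod_cast h1
      _ ≤ M * R := Nat.floor_le (by linarith)
      _ ≤ _ := by gcongr
  set V := X1 ^ (1 / 12 : ℝ) * B10 ^ (2 / 3 : ℝ) with hV
  have hV0 : 0 ≤ V := by positivity
  set U8 := ∫ α in (0 : ℝ)..1, ‖GA (smoothSet Q R) α‖ ^ 8 with hU8
  have hU80 : 0 ≤ U8 := by
    rw [hU8]; apply intervalIntegral.integral_nonneg (by norm_num); intros; positivity
  set I7 := ∫ α in (0 : ℝ)..1, ‖∑ x ∈ smoothSet P R, eC (α * (((x : ℤ) ^ 4 : ℤ) : ℝ))‖ ^ 7 with hI7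
  have hI70 : 0 ≤ I7 := by
    rw [hI7]; apply intervalIntegral.integral_nonneg (by norm_num); intros; positivity
  set Jt := ∑ m ∈ midSet M R, Jm ((Finset.Icc 1 ⌊P⌋₊).filter (fun x => Nat.Coprime x m)) (smoothSet Q R) m with hJt
  have hJt0 : 0 ≤ Jt := by
    rw [hJt]; apply Finset.sum_nonneg; intro m _; rw [Jm_eq]; positivity
  refine h1.trans ?_
  apply add_le_add
  · calc 8 * ((midSet M R).card : ℝ) ^ 7 * Jt ≤ 8 * (M * W) ^ 7 * (100000 * W ^ 7 * (M * P) * (B8 + H * V)) := by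
          gcongr
          refine h2.trans ?_
          gcongr
      _ = _ := by ring
  · gcongr

end Par


lemma ExpRep.congrF {ι : Type*} {F F1 : ℝ → ℂ} {s : Finset ι} {φ : ι → ℤ} (h1 : ExpRep F s φ)
    (e : ∀ α, F1 α = F α) : ExpRep F1 s φ := fun α => (e α).trans (h1 α)

/-- the sum `∑ e(α x^4)` over `A`. -/
noncomputable def SA (A : Finset ℕ) (α : ℝ) : ℂ := ∑ x ∈ A, eC (α * (((x : ℤ) ^ 4 : ℤ) : ℝ))

lemma SA_rep (A : Finset ℕ) : ExpRep (SA A) A (fun x => (x : ℤ) ^ 4) := fun _ => rfl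

lemma Icc_nat_int (P : ℝ) (hP : 0 ≤ P) (f : ℤ → ℂ) :
    ∑ x ∈ Finset.Icc (⌊0 * P⌋ + 1) ⌊P⌋, f x = ∑ x ∈ Finset.Icc 1 ⌊P⌋₊, f (x : ℤ) := by
  have hfl : ((⌊P⌋₊ : ℕ) : ℤ) = ⌊P⌋ := Int.natCast_floor_eq_floor hP
  rw [zero_mul, Int.floor_zero, zero_add]
  symm
  apply Finset.sum_bij (fun (x : ℕ) _ => (x : ℤ))
  · intro a ha
    rw [Finset.mem_Icc] at ha ⊢
    omega
  · intro a _ b _ h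
    exact_mod_cast h
  · intro b hb
    rw [Finset.mem_Icc] at hb
    refine ⟨b.toNat, ?_, ?_⟩
    · rw [Finset.mem_Icc]; omega
    · omega
  · intro a _; rfl

lemma fW_eq (P : ℝ) (hP : 0 ≤ P) (α : ℝ) : fW 0 P α = SA (Finset.Icc 1 ⌊P⌋₊) α := by
  unfold fW SA
  rw [Icc_nat_int P hP]
  apply Finset.sum_congr rfl
  intro x _
  push_cast; rfl

lemma gW_eq (P R : ℝ) (hP : 0 ≤ P) (α : ℝ) : gW 0 P R α = SA (smoothSet P R) α := by
  unfold gW SA smoothSet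
  rw [Icc_nat_int P hP, Finset.sum_filter]
  apply Finset.sum_congr rfl
  intro x _
  split_ifs
  · push_cast; rfl
  · rfl

lemma int_solT (P R : ℝ) (hP : 0 ≤ P) :
    ∫ α in (0 : ℝ)..1, ‖fW 0 P α‖ ^ 2 * ‖gW 0 P R α‖ ^ 8 =
      ((solT (Finset.Icc 1 ⌊P⌋₊) (smoothSet P R)).card : ℝ) := by
  have h := (SA_rep (Finset.Icc 1 ⌊P⌋₊)).normSq.mul (rep8 _ _ _ (SA_rep (smoothSet P R)))
  have h2 := h.congrF (F1 := fun α => ((‖SA (Finset.Icc 1 ⌊P⌋₊) α‖ ^ 2 * ‖SA (smoothSet P R) α‖ ^ 8 : ℝ) : ℂ))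
    (fun α => Complex.ofReal_mul _ _)
  have h3 := h2.card
  rw [show (fun α => ‖fW 0 P α‖ ^ 2 * ‖gW 0 P R α‖ ^ 8) =
    (fun α => ‖SA (Finset.Icc 1 ⌊P⌋₊) α‖ ^ 2 * ‖SA (smoothSet P R) α‖ ^ 8) by
      funext α; rw [fW_eq P hP, gW_eq P R hP], h3]
  unfold solT
  norm_cast

lemma int_double {ι : Type*} {F : ℝ → ℝ} {s : Finset ι} {φ : ι → ℤ} (h1 : ExpRep (fun α => (F α : ℂ)) s φ) :
    ∫ α in (0 : ℝ)..1, F (2 * α) = ∫ α in (0 : ℝ)..1, F α := by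
  have h2 : ExpRep (fun α => (F (2 * α) : ℂ)) s (fun i => 2 * φ i) := by
    intro α
    show (F (2 * α) : ℂ) = _
    have : (F (2 * α) : ℂ) = _ := h1 (2 * α)
    rw [this]
    apply Finset.sum_congr rfl
    intro i _
    congr 1; push_cast; ring
  rw [h1.card, h2.card]
  congr 2
  apply Finset.filter_congr
  intro i _
  omega

lemma GA_SA (A : Finset ℕ) (α : ℝ) : GA A α = SA A (2 * α) := by
  unfold GA SA
  apply Finset.sum_congr rfl
  intro i _
  congr 1; push_cast; ring

lemma int_mono_set {κ : Type*} (A X : Finset ℕ) (hAX : A ⊆ X) (G : ℝ → ℂ) (t : Finset κ) (ψ : κ → ℤ)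
    (hG : ExpRep G t ψ) :
    ∫ α in (0 : ℝ)..1, ‖SA A α‖ ^ 2 * ‖G α‖ ^ 2 ≤ ∫ α in (0 : ℝ)..1, ‖SA X α‖ ^ 2 * ‖G α‖ ^ 2 := by
  have key : ∀ Y : Finset ℕ, ∫ α in (0 : ℝ)..1, ‖SA Y α‖ ^ 2 * ‖G α‖ ^ 2 =
      ((((Y ×ˢ Y) ×ˢ (t ×ˢ t)).filter (fun i => ((i.1.1 : ℤ) ^ 4 - (i.1.2 : ℤ) ^ 4) + (ψ i.2.1 - ψ i.2.2) = 0)).card : ℝ) := by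
    intro Y
    have h := (SA_rep Y).normSq.mul hG.normSq
    have h2 := h.congrF (F1 := fun α => ((‖SA Y α‖ ^ 2 * ‖G α‖ ^ 2 : ℝ) : ℂ))
      (fun α => Complex.ofReal_mul _ _)
    exact h2.card
  rw [key, key]
  apply Nat.cast_le.mpr
  apply Finset.card_le_card
  apply Finset.filter_subset_filter
  exact Finset.product_subset_product (Finset.product_subset_product hAX hAX) (Finset.Subset.refl _)

lemma smooth_sub (P R : ℝ) : smoothSet P R ⊆ Finset.Icc 1 ⌊P⌋₊ := Finset.filter_subset _ _

lemma SA8_le (P R : ℝ) (hP : 0 ≤ P) :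
    ∫ α in (0 : ℝ)..1, ‖SA (smoothSet P R) α‖ ^ 8 ≤ ∫ α in (0 : ℝ)..1, ‖fW 0 P α‖ ^ 2 * ‖gW 0 P R α‖ ^ 6 := by
  have r := SA_rep (smoothSet P R)
  have h := int_mono_set (smoothSet P R) (Finset.Icc 1 ⌊P⌋₊) (smooth_sub P R) _ _ _ (r.mul (r.mul r))
  convert h using 3 with α α
  · rw [norm_mul, norm_mul]; ring
  · rw [fW_eq P hP, gW_eq P R hP, norm_mul, norm_mul]; ring

lemma SA10_le (P R : ℝ) (hP : 0 ≤ P) :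
    ∫ α in (0 : ℝ)..1, ‖SA (smoothSet P R) α‖ ^ 10 ≤ ∫ α in (0 : ℝ)..1, ‖fW 0 P α‖ ^ 2 * ‖gW 0 P R α‖ ^ 8 := by
  have r := SA_rep (smoothSet P R)
  have h := int_mono_set (smoothSet P R) (Finset.Icc 1 ⌊P⌋₊) (smooth_sub P R) _ _ _ ((r.mul r).mul (r.mul r))
  convert h using 3 with α α
  · rw [norm_mul, norm_mul]; ring
  · rw [fW_eq P hP, gW_eq P R hP, norm_mul, norm_mul]; ring

lemma GA8_le (P R : ℝ) (hP : 0 ≤ P) :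
    ∫ α in (0 : ℝ)..1, ‖GA (smoothSet P R) α‖ ^ 8 ≤ ∫ α in (0 : ℝ)..1, ‖fW 0 P α‖ ^ 2 * ‖gW 0 P R α‖ ^ 6 := by
  refine le_trans (le_of_eq ?_) (SA8_le P R hP)
  rw [← int_double (rep8 _ _ _ (SA_rep (smoothSet P R)))]
  simp only [GA_SA]

lemma GA10_le (P R : ℝ) (hP : 0 ≤ P) :
    ∫ α in (0 : ℝ)..1, ‖GA (smoothSet P R) α‖ ^ 10 ≤ ∫ α in (0 : ℝ)..1, ‖fW 0 P α‖ ^ 2 * ‖gW 0 P R α‖ ^ 8 := by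
  refine le_trans (le_of_eq ?_) (SA10_le P R hP)
  have h := (SA_rep (smoothSet P R)).normSq.mul (rep8 _ _ _ (SA_rep (smoothSet P R)))
  have h2 := h.congrF (F1 := fun α => ((‖SA (smoothSet P R) α‖ ^ 10 : ℝ) : ℂ)) (by
    intro α
    show ((‖SA (smoothSet P R) α‖ ^ 10 : ℝ) : ℂ) = ((‖SA (smoothSet P R) α‖ ^ 2 : ℝ) : ℂ) * ((‖SA (smoothSet P R) α‖ ^ 8 : ℝ) : ℂ)
    rw [← Complex.ofReal_mul]; congr 1; ring)
  rw [← int_double h2]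
  simp only [GA_SA]

/-- trivial bound -/
lemma int_trivial (P R : ℝ) (hP : 0 ≤ P) :
    ∫ α in (0 : ℝ)..1, ‖fW 0 P α‖ ^ 2 * ‖gW 0 P R α‖ ^ 8 ≤ P ^ 10 := by
  rw [int_solT P R hP]
  have hc : ((Finset.Icc 1 ⌊P⌋₊).card : ℝ) ≤ P := by
    rw [Nat.card_Icc, Nat.add_sub_cancel]; exact Nat.floor_le hP
  have hs : ((smoothSet P R).card : ℝ) ≤ P := le_trans (Nat.cast_le.mpr (Finset.card_le_card (smooth_sub P R))) hc
  have h1 : ((solT (Finset.Icc 1 ⌊P⌋₊) (smoothSet P R)).card : ℝ) ≤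
      ((Finset.Icc 1 ⌊P⌋₊).card : ℝ) * ((Finset.Icc 1 ⌊P⌋₊).card : ℝ) * ((smoothSet P R).card : ℝ) ^ 8 := by
    have : (solT (Finset.Icc 1 ⌊P⌋₊) (smoothSet P R)).card ≤
      (Finset.Icc 1 ⌊P⌋₊).card * (Finset.Icc 1 ⌊P⌋₊).card * (smoothSet P R).card ^ 8 := by
      refine (Finset.card_filter_le _ _).trans ?_
      rw [Finset.card_product, Finset.card_product, Fintype.card_piFinset_const]
    exact_mod_cast this
  calc _ ≤ _ := h1
    _ ≤ P * P * P ^ 8 := by gcongr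
    _ = P ^ 10 := by ring


lemma ev_rpow (c ε : ℝ) (hε : 0 < ε) : ∃ P0 : ℝ, ∀ P : ℝ, P0 ≤ P → c < P ^ ε := by
  have h := (tendsto_rpow_atTop hε).eventually_gt_atTop c
  exact Filter.eventually_atTop.1 h

lemma ev_div (ε : ℝ) (hε : 0 < ε) : ∃ P0 : ℝ, ∀ P : ℝ, P0 ≤ P → 1 ≤ P →
    ∀ n : ℕ, 0 < n → (n : ℝ) ≤ P ^ 20 → (n.divisors.card : ℝ) ≤ P ^ ε := by
  obtain ⟨C, hC, h⟩ := card_divisors_bound (ε := ε / 40) (by positivity)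
  obtain ⟨P0, h0⟩ := ev_rpow C (ε / 2) (by positivity)
  refine ⟨P0, fun P hP h1 n hn hnP => ?_⟩
  have p0 : (0 : ℝ) < P := by linarith
  calc (n.divisors.card : ℝ) ≤ C * (n : ℝ) ^ (ε / 40) := h n hn.ne'
    _ ≤ C * (P ^ 20) ^ (ε / 40) := by gcongr
    _ = C * P ^ (ε / 2) := by
        rw [← Real.rpow_natCast, ← Real.rpow_mul p0.le]; congr 2; push_cast; ring
    _ ≤ P ^ (ε / 2) * P ^ (ε / 2) := by gcongr; exact (h0 P hP).le
    _ = P ^ ε := by rw [← Real.rpow_add p0]; congr 1; ring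

lemma ev_log (ε : ℝ) (hε : 0 < ε) : ∃ P0 : ℝ, ∀ P : ℝ, P0 ≤ P → 1 ≤ P →
    ∀ x : ℝ, 1 ≤ x → x ≤ P ^ 20 → 1 + Real.log x ≤ P ^ ε := by
  obtain ⟨P0, h0⟩ := ev_rpow (1 + 40 / ε) (ε / 2) (by positivity)
  refine ⟨P0, fun P hP h1 x hx hxP => ?_⟩
  have p0 : (0 : ℝ) < P := by linarith
  have e1 : Real.log x ≤ 20 * Real.log P := by
    have := Real.log_le_log (by linarith) hxP
    rw [Real.log_pow] at this
    exact_mod_cast this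
  have e2 : Real.log P ≤ P ^ (ε / 2) / (ε / 2) := Real.log_le_rpow_div p0.le (by positivity)
  have e3 : 1 ≤ P ^ (ε / 2) := Real.one_le_rpow h1 (by positivity)
  calc 1 + Real.log x ≤ 1 + 20 * (P ^ (ε / 2) / (ε / 2)) := by linarith
    _ = 1 + 40 / ε * P ^ (ε / 2) := by field_simp; ring
    _ ≤ (1 + 40 / ε) * P ^ (ε / 2) := by linarith
    _ ≤ P ^ (ε / 2) * P ^ (ε / 2) := by gcongr; exact (h0 P hP).le
    _ = P ^ ε := by rw [← Real.rpow_add p0]; congr 1; ring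

set_option maxHeartbeats 1000000 in
lemma ev_rad (ε : ℝ) (hε : 0 < ε) : ∃ P0 : ℝ, ∀ P : ℝ, P0 ≤ P → 1 ≤ P →
    ∀ n : ℕ, 0 < n → (n : ℝ) ≤ P ^ 2 → ((radSet ⌊P⌋₊ n).card : ℝ) ≤ P ^ ε := by
  obtain ⟨K, hK⟩ := exists_nat_gt (4 / ε)
  have K0 : (0 : ℝ) < K := lt_trans (by positivity) hK
  have K1 : K ≠ 0 := by rintro rfl; simp at K0
  obtain ⟨C, hC, h⟩ := card_divisors_bound (ε := ε / (8 * K)) (by positivity)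
  obtain ⟨P0, h0⟩ := ev_rpow C (ε / 2) (by positivity)
  refine ⟨P0, fun P hP h1 n hn hnP => ?_⟩
  have p0 : (0 : ℝ) < P := by linarith
  set B : ℕ := ⌊P ^ (1 / (K : ℝ))⌋₊ with hB
  have b1 : (B : ℝ) ≤ P ^ (ε / 4) := by
    refine (Nat.floor_le (by positivity)).trans ?_
    apply Real.rpow_le_rpow_of_exponent_le h1
    rw [div_lt_iff₀ hε] at hK
    rw [div_le_div_iff₀ K0 (by norm_num)]
    linarith
  have b2 : ⌊P⌋₊ < (B + 1) ^ K := by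
    rw [Nat.floor_lt p0.le]
    push_cast
    have e : P ^ (1 / (K : ℝ)) < (B : ℝ) + 1 := Nat.lt_floor_add_one _
    calc P = (P ^ (1 / (K : ℝ))) ^ K := by
          rw [← Real.rpow_natCast, ← Real.rpow_mul p0.le, one_div, inv_mul_cancel₀ K0.ne', Real.rpow_one]
      _ < _ := by gcongr
  have e1 := rad_card ⌊P⌋₊ n K B hn.ne' K1 b2
  have e2 : ((radSet ⌊P⌋₊ n).card : ℝ) ≤ (B : ℝ) * ((n ^ K).divisors.card : ℝ) := by exact_mod_cast e1
  have e3 : ((n ^ K).divisors.card : ℝ) ≤ C * P ^ (ε / 4) := by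
    calc ((n ^ K).divisors.card : ℝ) ≤ C * ((n ^ K : ℕ) : ℝ) ^ (ε / (8 * K)) := h _ (pow_ne_zero _ hn.ne')
      _ ≤ C * ((P ^ 2) ^ K) ^ (ε / (8 * K)) := by push_cast; gcongr
      _ = C * P ^ (ε / 4) := by
          rw [← pow_mul, ← Real.rpow_natCast, ← Real.rpow_mul p0.le]; congr 2; push_cast; field_simp; norm_num
  calc _ ≤ _ := e2
    _ ≤ P ^ (ε / 4) * (C * P ^ (ε / 4)) := by gcongr
    _ = C * P ^ (ε / 2) := by
        rw [mul_left_comm, ← Real.rpow_add p0]; congr 2; ring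
    _ ≤ P ^ (ε / 2) * P ^ (ε / 2) := by gcongr; exact (h0 P hP).le
    _ = P ^ ε := by rw [← Real.rpow_add p0]; congr 1; ring

lemma rpow_pow_eq {P : ℝ} (hP : 0 < P) (a : ℝ) (n : ℕ) : (P ^ a) ^ n = P ^ (a * n) := by
  rw [← Real.rpow_natCast, ← Real.rpow_mul hP.le]

set_option maxHeartbeats 1000000 in
lemma mkPar (θ ε : ℝ) (h1 : 3 / 17 < θ) (h2 : θ < 12 / 67) (hε : 0 < ε) (hε1 : ε ≤ 1 / 100) :
    ∃ P0 : ℝ, ∀ P : ℝ, P0 ≤ P → 2 ≤ P →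
      Par P (P ^ θ) (P ^ (1 - 4 * θ)) (P ^ (1 - θ)) (P ^ (4 - 17 * θ)) (P ^ ε) ∧
      (∀ n : ℕ, 0 < n → (n : ℝ) ≤ P ^ 2 → ((radSet ⌊P⌋₊ n).card : ℝ) ≤ P ^ ε) := by
  obtain ⟨Pa, ha⟩ := ev_rpow 64 (1 / 50) (by norm_num)
  obtain ⟨Pb, hb⟩ := ev_div ε hε
  obtain ⟨Pc, hc⟩ := ev_log ε hε
  obtain ⟨Pd, hd⟩ := ev_rad ε hε
  refine ⟨max (max Pa Pb) (max Pc (max Pd 8)), fun P hP hP2 => ?_⟩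
  simp only [max_le_iff] at hP
  obtain ⟨⟨hPa, hPb⟩, hPc, hPd, hP8⟩ := hP
  have p1 : (1 : ℝ) ≤ P := by linarith
  have p0 : (0 : ℝ) < P := by linarith
  have h64 := ha P hPa
  have mono : ∀ {a b : ℝ}, a ≤ b → P ^ a ≤ P ^ b := fun h => Real.rpow_le_rpow_of_exponent_le p1 h
  have one : ∀ {a : ℝ}, 0 ≤ a → 1 ≤ P ^ a := fun h => Real.one_le_rpow p1 h
  have add : ∀ a b : ℝ, P ^ a * P ^ b = P ^ (a + b) := fun a b => (Real.rpow_add p0 a b).symm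
  have P1 : P = P ^ (1 : ℝ) := (Real.rpow_one P).symm
  have sq : Real.sqrt (P ^ θ) = P ^ (θ * (1 / 2)) := by rw [Real.sqrt_eq_rpow, ← Real.rpow_mul p0.le]
  refine ⟨?_, hd P hPd p1⟩
  constructor
  · exact hP2
  · exact one (by linarith)
  · exact one (by linarith)
  · have : P ^ (1 / 50 : ℝ) ≤ P ^ (1 - θ) := mono (by linarith)
    linarith
  · exact one (by linarith)
  · exact one hε.le
  · rw [add]; conv_rhs => rw [P1]
    congr 1; ring
  · rw [rpow_pow_eq p0, add]; conv_rhs => rw [P1]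
    congr 1; push_cast; ring
  · rw [rpow_pow_eq p0, rpow_pow_eq p0, add]
    congr 1; push_cast; ring
  · rw [rpow_pow_eq p0]; apply mono; push_cast; linarith
  · conv_rhs => rw [P1]
    apply mono; linarith
  · rw [sq, rpow_pow_eq p0, mul_assoc, add]
    calc 64 * P ^ (θ * (1 / 2) + (1 - 4 * θ) * (3 : ℕ)) < P ^ (1 / 50 : ℝ) * P ^ (θ * (1 / 2) + (1 - 4 * θ) * (3 : ℕ)) := by gcongr
      _ = P ^ (1 / 50 + (θ * (1 / 2) + (1 - 4 * θ) * (3 : ℕ))) := add _ _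
      _ ≤ P ^ (1 : ℝ) := by apply mono; push_cast; linarith
      _ = P := P1.symm
  · rw [sq, rpow_pow_eq p0, rpow_pow_eq p0, rpow_pow_eq p0]
    have e : P ^ ((1 - 4 * θ) * (3 : ℕ)) * P = P ^ ((1 - 4 * θ) * (3 : ℕ) + 1) := by rw [Real.rpow_add p0, Real.rpow_one]
    rw [e, mul_assoc, mul_assoc, add, add]
    calc 8 * P ^ (θ * (8 : ℕ) + (ε * (9 : ℕ) + θ * (1 / 2))) < P ^ (1 / 50 : ℝ) * P ^ (θ * (8 : ℕ) + (ε * (9 : ℕ) + θ * (1 / 2))) := by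
          gcongr; linarith
      _ = P ^ (1 / 50 + (θ * (8 : ℕ) + (ε * (9 : ℕ) + θ * (1 / 2)))) := add _ _
      _ ≤ _ := by apply mono; push_cast; linarith
  · have e : P ^ ((1 - 4 * θ) * (3 : ℕ)) * P = P ^ ((1 - 4 * θ) * (3 : ℕ) + 1) := by rw [Real.rpow_add p0, Real.rpow_one]
    rw [rpow_pow_eq p0, rpow_pow_eq p0, e]
    apply mono; push_cast; linarith
  · refine ⟨P ^ ((8 * θ - 1) / 3), by positivity, ?_, ?_⟩
    · have e : P ^ ((8 * θ - 1) / 3 * (3 : ℕ)) * P = P ^ ((8 * θ - 1) / 3 * (3 : ℕ) + 1) := by rw [Real.rpow_add p0, Real.rpow_one]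
      rw [rpow_pow_eq p0, rpow_pow_eq p0, e]
      congr 1; push_cast; ring
    · rw [rpow_pow_eq p0, rpow_pow_eq p0, rpow_pow_eq p0, add]
      apply mono; push_cast; linarith
  · exact hb P hPb p1
  · exact hc P hPc p1
  · conv_rhs => rw [P1]
    apply mono; linarith
  · exact hP8


set_option maxHeartbeats 2000000 in
/-- the final numerical estimate -/
lemma final_num (Δ₈ Δ₁₀ θ ε C8 C10 P : ℝ) (hP : 1 ≤ P) (hC8 : 0 < C8) (hC10 : 0 < C10)
    (h81 : 1 / 2 < Δ₈) (hθ1 : 3 / 17 < θ) (hθ2 : θ < 12 / 67)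
    (hu : (1 - θ) * (3 * Δ₈ - 2 * Δ₁₀) = 7 - 33 * θ) (hε : 0 < ε) :
    800000 * (P ^ ε) ^ 14 * ((P ^ θ) ^ 8 * P) * (C8 * (P ^ (1 - θ)) ^ (4 + Δ₈) +
        P ^ (1 - 4 * θ) * ((P ^ (4 - 17 * θ)) ^ (1 / 12 : ℝ) * (C10 * (P ^ (1 - θ)) ^ (6 + Δ₁₀)) ^ (2 / 3 : ℝ))) +
      8 * (P ^ 2 * (P ^ θ * P ^ ε) * ((P ^ ((2 + Δ₈) / 4)) ^ 3 * (2 * (P ^ ε) ^ 2 * P ^ 2) +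
        C8 * P ^ (4 + Δ₈) / P ^ ((2 + Δ₈) / 4))) ≤
    (800000 * (C8 + C10 ^ (2 / 3 : ℝ)) + 8 * (2 + C8)) *
      P ^ (6 + (Δ₈ * (1 - θ) + 4 * θ - 1) + 14 * ε) := by
  have p0 : 0 < P := by linarith
  have mono : ∀ {a b : ℝ}, a ≤ b → P ^ a ≤ P ^ b := fun h => Real.rpow_le_rpow_of_exponent_le hP h
  have add : ∀ a b : ℝ, P ^ a * P ^ b = P ^ (a + b) := fun a b => (Real.rpow_add p0 a b).symm
  set E : ℝ := 6 + (Δ₈ * (1 - θ) + 4 * θ - 1) + 14 * ε with hE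
  set D : ℝ := C10 ^ (2 / 3 : ℝ) with hD
  have D0 : 0 < D := by positivity
  have P1 : P = P ^ (1 : ℝ) := (Real.rpow_one P).symm
  have P2 : P ^ 2 = P ^ (2 : ℝ) := by rw [← Real.rpow_natCast]; norm_num
  have q1 : (P ^ ε) ^ 14 * ((P ^ θ) ^ 8 * P) = P ^ (14 * ε + 8 * θ + 1) := by
    rw [rpow_pow_eq p0, rpow_pow_eq p0]
    nth_rewrite 3 [P1]
    rw [add, add]; congr 1; push_cast; ring
  have q2 : (P ^ (1 - θ)) ^ (4 + Δ₈) = P ^ ((1 - θ) * (4 + Δ₈)) := by rw [← Real.rpow_mul p0.le]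
  have q3 : (C10 * (P ^ (1 - θ)) ^ (6 + Δ₁₀)) ^ (2 / 3 : ℝ) = D * P ^ ((1 - θ) * (6 + Δ₁₀) * (2 / 3)) := by
    rw [Real.mul_rpow hC10.le (by positivity), ← Real.rpow_mul p0.le, ← Real.rpow_mul p0.le]
  have q4 : P ^ (1 - 4 * θ) * ((P ^ (4 - 17 * θ)) ^ (1 / 12 : ℝ) * (D * P ^ ((1 - θ) * (6 + Δ₁₀) * (2 / 3)))) =
      D * P ^ ((1 - 4 * θ) + (4 - 17 * θ) * (1 / 12) + (1 - θ) * (6 + Δ₁₀) * (2 / 3)) := by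
    rw [← Real.rpow_mul p0.le, Real.rpow_add p0, Real.rpow_add p0]; ring
  have q5 : P ^ ((1 - 4 * θ) + (4 - 17 * θ) * (1 / 12) + (1 - θ) * (6 + Δ₁₀) * (2 / 3)) ≤ P ^ ((1 - θ) * (4 + Δ₈)) := by
    apply mono; nlinarith
  have T1 : 800000 * (P ^ ε) ^ 14 * ((P ^ θ) ^ 8 * P) * (C8 * (P ^ (1 - θ)) ^ (4 + Δ₈) +
        P ^ (1 - 4 * θ) * ((P ^ (4 - 17 * θ)) ^ (1 / 12 : ℝ) * (C10 * (P ^ (1 - θ)) ^ (6 + Δ₁₀)) ^ (2 / 3 : ℝ))) ≤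
      800000 * (C8 + D) * P ^ E := by
    rw [mul_assoc 800000, q1, q2, q3, q4]
    calc _ ≤ 800000 * P ^ (14 * ε + 8 * θ + 1) * (C8 * P ^ ((1 - θ) * (4 + Δ₈)) + D * P ^ ((1 - θ) * (4 + Δ₈))) := by gcongr
      _ = 800000 * (C8 + D) * (P ^ (14 * ε + 8 * θ + 1) * P ^ ((1 - θ) * (4 + Δ₈))) := by ring
      _ = 800000 * (C8 + D) * P ^ E := by rw [add]; congr 2; rw [hE]; ring
  have q6 : (P ^ ((2 + Δ₈) / 4)) ^ 3 * (2 * (P ^ ε) ^ 2 * P ^ 2) = 2 * P ^ (7 / 2 + 3 / 4 * Δ₈ + 2 * ε) := by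
    rw [rpow_pow_eq p0, rpow_pow_eq p0, P2]
    rw [show ∀ a b c : ℝ, a * (2 * b * c) = 2 * (a * b * c) by intros; ring, add, add]
    congr 2; push_cast; ring
  have q7 : C8 * P ^ (4 + Δ₈) / P ^ ((2 + Δ₈) / 4) = C8 * P ^ (7 / 2 + 3 / 4 * Δ₈) := by
    rw [mul_div_assoc, ← Real.rpow_sub p0]; congr 2; ring
  have q8 : P ^ (7 / 2 + 3 / 4 * Δ₈) ≤ P ^ (7 / 2 + 3 / 4 * Δ₈ + 2 * ε) := mono (by linarith)
  have q9 : P ^ 2 * (P ^ θ * P ^ ε) = P ^ (2 + θ + ε) := by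
    rw [P2, add, add]; congr 1; ring
  have T2 : 8 * (P ^ 2 * (P ^ θ * P ^ ε) * ((P ^ ((2 + Δ₈) / 4)) ^ 3 * (2 * (P ^ ε) ^ 2 * P ^ 2) +
        C8 * P ^ (4 + Δ₈) / P ^ ((2 + Δ₈) / 4))) ≤ 8 * (2 + C8) * P ^ E := by
    rw [q6, q7, q9]
    calc _ ≤ 8 * (P ^ (2 + θ + ε) * (2 * P ^ (7 / 2 + 3 / 4 * Δ₈ + 2 * ε) + C8 * P ^ (7 / 2 + 3 / 4 * Δ₈ + 2 * ε))) := by gcongr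
      _ = 8 * (2 + C8) * (P ^ (2 + θ + ε) * P ^ (7 / 2 + 3 / 4 * Δ₈ + 2 * ε)) := by ring
      _ = 8 * (2 + C8) * P ^ (2 + θ + ε + (7 / 2 + 3 / 4 * Δ₈ + 2 * ε)) := by rw [add]
      _ ≤ 8 * (2 + C8) * P ^ E := by
          gcongr 8 * (2 + C8) * ?_
          apply mono
          rw [hE]
          nlinarith [mul_pos (show (0 : ℝ) < 1 / 4 - θ by linarith) (show (0 : ℝ) < Δ₈ by linarith)]
  calc _ ≤ 800000 * (C8 + D) * P ^ E + 8 * (2 + C8) * P ^ E := add_le_add T1 T2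
    _ = _ := by ring

lemma theta_facts (Δ₈ Δ₁₀ : ℝ) (h81 : 1 / 2 < Δ₈) (h82 : Δ₈ < 3 / 5)
    (h1 : 3 / 2 * Δ₈ - 5 / 7 < Δ₁₀) (h2 : Δ₁₀ < 2 * Δ₈ - 27 / 28) :
    ∃ θ : ℝ, max (3 / 17) ((7 + 2 * Δ₁₀ - 3 * Δ₈) / (33 + 2 * Δ₁₀ - 3 * Δ₈)) = θ ∧
      3 / 17 < θ ∧ θ < 12 / 67 ∧ (1 - θ) * (3 * Δ₈ - 2 * Δ₁₀) = 7 - 33 * θ := by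
  have d : 0 < 33 + 2 * Δ₁₀ - 3 * Δ₈ := by linarith
  have a : 3 / 17 < (7 + 2 * Δ₁₀ - 3 * Δ₈) / (33 + 2 * Δ₁₀ - 3 * Δ₈) := by
    rw [div_lt_div_iff₀ (by norm_num) d]; linarith
  refine ⟨_, max_eq_right a.le, a, ?_, ?_⟩
  · rw [div_lt_div_iff₀ d (by norm_num)]; linarith
  · field_simp; ring

set_option maxHeartbeats 2000000 in
theorem stmt6 (Δ₈ Δ₁₀ : ℝ)
    (h8 : AdmissibleExponent 8 Δ₈) (h10 : AdmissibleExponent 10 Δ₁₀)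
    (h81 : 1 / 2 < Δ₈) (h82 : Δ₈ < 3 / 5)
    (h101 : 1 / 10 < Δ₁₀) (h102 : Δ₁₀ < 1 / 4)
    (h1 : 3 / 2 * Δ₈ - 5 / 7 < Δ₁₀) (h2 : Δ₁₀ < 2 * Δ₈ - 27 / 28) :
    ∀ Δ : ℝ,
      Δ₈ * (1 - max (3 / 17) ((7 + 2 * Δ₁₀ - 3 * Δ₈) / (33 + 2 * Δ₁₀ - 3 * Δ₈)))
        + 4 * max (3 / 17) ((7 + 2 * Δ₁₀ - 3 * Δ₈) / (33 + 2 * Δ₁₀ - 3 * Δ₈)) - 1 < Δ →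
      AdmissibleExponent 10 Δ := by
  intro Δ hΔ
  obtain ⟨θ, hθ, hθ1, hθ2, hu⟩ := theta_facts Δ₈ Δ₁₀ h81 h82 h1 h2
  rw [hθ] at hΔ
  obtain ⟨η8, hη8, C8, hC8, A8⟩ := h8
  obtain ⟨η10, hη10, C10, hC10, A10⟩ := h10
  set ε : ℝ := min (1 / 100) ((Δ - (Δ₈ * (1 - θ) + 4 * θ - 1)) / 14) with hε
  have ε0 : 0 < ε := lt_min (by norm_num) (by linarith)
  have ε1 : ε ≤ 1 / 100 := min_le_left _ _
  have ε2 : 14 * ε ≤ Δ - (Δ₈ * (1 - θ) + 4 * θ - 1) := by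
    have := min_le_right (1 / 100 : ℝ) ((Δ - (Δ₈ * (1 - θ) + 4 * θ - 1)) / 14)
    linarith
  obtain ⟨P0, hP0⟩ := mkPar θ ε hθ1 hθ2 ε0 ε1
  have θ1 : 0 < 1 - θ := by linarith
  have Δpos : 0 < Δ + 1 := by
    have : 0 < Δ₈ * (1 - θ) := by positivity
    linarith
  set K : ℝ := 800000 * (C8 + C10 ^ (2 / 3 : ℝ)) + 8 * (2 + C8) with hK
  have K0 : 0 < K := by positivity
  refine ⟨min ε (min η8 (min ((1 - θ) * η8) ((1 - θ) * η10))), ?_, max K (|P0| ^ 10), lt_max_of_lt_left K0, ?_⟩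
  · exact lt_min ε0 (lt_min hη8 (lt_min (by positivity) (by positivity)))
  intro P hP R hR hRP
  have p1 : (1 : ℝ) ≤ P := by linarith
  have p0 : (0 : ℝ) < P := by linarith
  show (∫ α in (0:ℝ)..1, ‖fW 0 P α‖ ^ 2 * ‖gW 0 P R α‖ ^ 8) ≤ max K (|P0| ^ 10) * P ^ (((10 : ℕ) : ℝ) - 4 + Δ)
  rcases lt_or_ge P P0 with hlt | hge
  · have e1 : 1 ≤ P ^ (((10 : ℕ) : ℝ) - 4 + Δ) := Real.one_le_rpow p1 (by push_cast; linarith)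
    calc _ ≤ P ^ 10 := int_trivial P R p0.le
      _ ≤ |P0| ^ 10 := by
          have := le_abs_self P0
          gcongr; linarith
      _ ≤ max K (|P0| ^ 10) := le_max_right _ _
      _ ≤ _ := le_mul_of_one_le_right (K0.le.trans (le_max_left _ _)) e1
  obtain ⟨par, hrad⟩ := hP0 P hge hP
  have RR : ∀ z : ℝ, min ε (min η8 (min ((1 - θ) * η8) ((1 - θ) * η10))) ≤ z → R ≤ P ^ z :=
    fun z hz => hRP.trans (Real.rpow_le_rpow_of_exponent_le p1 hz)
  have m1 := min_le_left ε (min η8 (min ((1 - θ) * η8) ((1 - θ) * η10)))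
  have m2 := min_le_right ε (min η8 (min ((1 - θ) * η8) ((1 - θ) * η10)))
  have m3 := min_le_left η8 (min ((1 - θ) * η8) ((1 - θ) * η10))
  have m4 := min_le_right η8 (min ((1 - θ) * η8) ((1 - θ) * η10))
  have m5 := min_le_left ((1 - θ) * η8) ((1 - θ) * η10)
  have m6 := min_le_right ((1 - θ) * η8) ((1 - θ) * η10)
  have r1 : R ≤ P ^ ε := RR _ m1
  have r2 : R ≤ P ^ η8 := RR _ (m2.trans m3)
  have r3 : R ≤ (P ^ (1 - θ)) ^ η8 := by rw [← Real.rpow_mul p0.le]; exact RR _ (m2.trans (m4.trans m5))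
  have r4 : R ≤ (P ^ (1 - θ)) ^ η10 := by rw [← Real.rpow_mul p0.le]; exact RR _ (m2.trans (m4.trans m6))
  have Q0 : 0 ≤ P ^ (1 - θ) := by positivity
  have x8 : (((8 : ℕ) : ℝ) - 4 + Δ₈) = 4 + Δ₈ := by push_cast; ring
  have x10 : (((10 : ℕ) : ℝ) - 4 + Δ₁₀) = 6 + Δ₁₀ := by push_cast; ring
  have b1 := A8 _ par.hQ R hR r3
  have b2 := A10 _ par.hQ R hR r4
  have b3 := A8 P hP R hR r2
  rw [x8] at b1 b3
  rw [x10] at b2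
  have main := par.main_bound R hR r1 hrad (C8 * (P ^ (1 - θ)) ^ (4 + Δ₈)) (C10 * (P ^ (1 - θ)) ^ (6 + Δ₁₀))
    (C8 * P ^ (4 + Δ₈)) (P ^ ((2 + Δ₈) / 4)) (by positivity) (by positivity)
    ((GA8_le _ R Q0).trans b1) ((GA10_le _ R Q0).trans b2) ((SA8_le P R p0.le).trans b3)
  rw [int_solT P R p0.le]
  refine main.trans ((final_num Δ₈ Δ₁₀ θ ε C8 C10 P p1 hC8 hC10 h81 hθ1 hθ2 hu ε0).trans ?_)
  have e2 : P ^ (6 + (Δ₈ * (1 - θ) + 4 * θ - 1) + 14 * ε) ≤ P ^ (((10 : ℕ) : ℝ) - 4 + Δ) := by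
    apply Real.rpow_le_rpow_of_exponent_le p1
    push_cast; linarith
  calc _ ≤ K * P ^ (((10 : ℕ) : ℝ) - 4 + Δ) := by rw [← hK]; gcongr
    _ ≤ _ := by gcongr; exact le_max_left _ _
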